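/- The entropy function of the quadratic family is Hölder continuous: there exist C > 0 and β > 0 such that |h(a) − h(a')| ≤ C |a − a'|^β for all a, a' ∈ [-2, 1/4]. -/

import Mathlib

open Filter Set MeasureTheory

/-- The quadratic family `f_a(x) = x² + a`. -/
noncomputable def fa (a : ℝ) : ℝ → ℝ := fun x => x ^ 2 + a

/-- The invariant interval `I_a`. -/
noncomputable def Ia (a : ℝ) : Set ℝ :=
  Set.Icc ((-1 - Real.sqrt (1 - 4 * a)) / 2) ((1 + Real.sqrt (1 - 4 * a)) / 2)

/-- Topological entropy of `f_a` restricted to `I_a`. -/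
noncomputable def h (a : ℝ) : ℝ := (Dynamics.coverEntropy (fa a) (Ia a)).toReal

theorem fa_apply (a x : ℝ) : fa a x = x ^ 2 + a := rfl

theorem continuous_fa (a : ℝ) : Continuous (fa a) := by
  unfold fa; fun_prop

theorem iterate_succ_fa (a x : ℝ) (n : ℕ) : (fa a)^[n + 1] x = ((fa a)^[n] x) ^ 2 + a := by
  rw [Function.iterate_succ_apply', fa_apply]

/-- The right endpoint of the invariant interval, a repelling fixed point of `fa a`. -/
noncomputable def bt (a : ℝ) : ℝ := (1 + √(1 - 4 * a)) / 2

theorem Ia_eq (a : ℝ) : Ia a = Icc (-bt a) (bt a) := by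
  unfold Ia bt
  congr 1
  ring

theorem bt_sq {a : ℝ} (ha : a ≤ 1 / 4) : bt a ^ 2 = bt a - a := by
  unfold bt
  have := Real.sq_sqrt (show 0 ≤ 1 - 4 * a by linarith)
  linear_combination this / 4

theorem half_le_bt (a : ℝ) : 1 / 2 ≤ bt a := by
  unfold bt
  have := Real.sqrt_nonneg (1 - 4 * a)
  linarith

theorem bt_pos (a : ℝ) : 0 < bt a := by linarith [half_le_bt a]

theorem bt_le_two {a : ℝ} (ha : -2 ≤ a) : bt a ≤ 2 := by
  unfold bt
  have : √(1 - 4 * a) ≤ 3 := Real.sqrt_le_iff.2 ⟨by norm_num, by linarith⟩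
  linarith

theorem mem_Ia {a x : ℝ} : x ∈ Ia a ↔ |x| ≤ bt a := by
  rw [Ia_eq, mem_Icc, abs_le]

theorem zero_mem (a : ℝ) : (0 : ℝ) ∈ Ia a := by
  rw [mem_Ia, abs_zero]; exact (bt_pos a).le

theorem neg_bt_le {a : ℝ} (ha : a ∈ Icc (-2 : ℝ) (1 / 4)) : -bt a ≤ a := by
  have h1 := bt_sq ha.2
  have h2 := bt_le_two ha.1
  nlinarith [bt_pos a]

theorem mapsTo_fa {a : ℝ} (ha : a ∈ Icc (-2 : ℝ) (1 / 4)) : MapsTo (fa a) (Ia a) (Ia a) := by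
  intro x hx
  rw [mem_Ia] at *
  have h1 := bt_sq ha.2
  have h2 : x ^ 2 ≤ bt a ^ 2 := sq_le_sq' (abs_le.1 hx).1 (abs_le.1 hx).2
  rw [fa_apply, abs_le]
  constructor <;> nlinarith [neg_bt_le ha, sq_nonneg x]

theorem iterate_mem {a : ℝ} (ha : a ∈ Icc (-2 : ℝ) (1 / 4)) {x : ℝ} (hx : x ∈ Ia a) (n : ℕ) :
    (fa a)^[n] x ∈ Ia a := (mapsTo_fa ha).iterate n hx

open Classical in
/-- The set of times `i < n` at which the orbit of `x` is negative. -/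
noncomputable def itin (a : ℝ) (n : ℕ) (x : ℝ) : Finset ℕ :=
  (Finset.range n).filter fun i => (fa a)^[i] x < 0

theorem itin_eq_iff {a : ℝ} {n : ℕ} {x y : ℝ} :
    itin a n x = itin a n y ↔ ∀ i < n, ((fa a)^[i] x < 0 ↔ (fa a)^[i] y < 0) := by
  simp only [itin, Finset.ext_iff, Finset.mem_filter, Finset.mem_range]
  constructor
  · intro H i hi
    have := H i
    tauto
  · intro H i
    have := H i
    tauto

theorem finite_itin_image (a : ℝ) (n : ℕ) (s : Set ℝ) : (itin a n '' s).Finite :=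
  (Finset.finite_toSet (Finset.range n).powerset).subset (by
    rintro _ ⟨x, -, rfl⟩
    exact Finset.mem_coe.2 (Finset.mem_powerset.2 (Finset.filter_subset _ _)))

/-- The number of itineraries of length `n`. -/
noncomputable def wd (a : ℝ) (n : ℕ) : ℕ := (itin a n '' Ia a).ncard

theorem ncard_image_le_of_factors {α β γ : Type*} [Nonempty β] {f : α → β} {g : α → γ} {s : Set α}
    (hg : (g '' s).Finite) (H : ∀ x ∈ s, ∀ y ∈ s, g x = g y → f x = f y) :
    (f '' s).ncard ≤ (g '' s).ncard := by
  have : ∀ t : γ, ∃ x : β, t ∈ g '' s → ∃ y ∈ s, g y = t ∧ x = f y := by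
    intro t
    by_cases ht : t ∈ g '' s
    · obtain ⟨y, hy, rfl⟩ := ht
      exact ⟨f y, fun _ => ⟨y, hy, rfl, rfl⟩⟩
    · exact ⟨Classical.arbitrary β, fun h => absurd h ht⟩
  choose p hp using this
  refine (ncard_le_ncard (t := p '' (g '' s)) ?_ (hg.image p)).trans (ncard_image_le hg)
  rintro _ ⟨x, hx, rfl⟩
  refine ⟨g x, ⟨x, hx, rfl⟩, ?_⟩
  obtain ⟨y, hy, h1, h2⟩ := hp (g x) ⟨x, hx, rfl⟩
  rw [h2]
  exact H _ hy _ hx h1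

theorem wd_pos (a : ℝ) (n : ℕ) : 0 < wd a n :=
  (ncard_pos (finite_itin_image a n _)).2 ⟨_, 0, zero_mem a, rfl⟩

theorem itin_add {a : ℝ} {m n : ℕ} {x y : ℝ} (h1 : itin a m x = itin a m y)
    (h2 : itin a n ((fa a)^[m] x) = itin a n ((fa a)^[m] y)) :
    itin a (m + n) x = itin a (m + n) y := by
  rw [itin_eq_iff] at *
  intro i hi
  rcases lt_or_ge i m with h | h
  · exact h1 i h
  · have := h2 (i - m) (by omega)
    rwa [← Function.iterate_add_apply, ← Function.iterate_add_apply,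
      Nat.sub_add_cancel h] at this

theorem ncard_itin_add_le {a : ℝ} (m n : ℕ) {s t : Set ℝ} (hst : MapsTo (fa a)^[m] s t) :
    (itin a (m + n) '' s).ncard ≤ (itin a m '' s).ncard * (itin a n '' t).ncard := by
  have hfin : ((itin a m '' s) ×ˢ (itin a n '' t)).Finite :=
    (finite_itin_image a m s).prod (finite_itin_image a n t)
  have hsub : (fun x => (itin a m x, itin a n ((fa a)^[m] x))) '' s ⊆
      (itin a m '' s) ×ˢ (itin a n '' t) := by
    rintro _ ⟨x, hx, rfl⟩
    exact ⟨⟨x, hx, rfl⟩, ⟨_, hst hx, rfl⟩⟩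
  rw [← ncard_prod]
  refine (ncard_image_le_of_factors (hfin.subset hsub) ?_).trans (ncard_le_ncard hsub hfin)
  intro x _ y _ hxy
  simp only [Prod.mk.injEq] at hxy
  exact itin_add hxy.1 hxy.2

theorem wd_add_le {a : ℝ} (ha : a ∈ Icc (-2 : ℝ) (1 / 4)) (m n : ℕ) :
    wd a (m + n) ≤ wd a m * wd a n :=
  ncard_itin_add_le m n fun _ hx => iterate_mem ha hx m

/-- The sign of the derivative of `(fa a)^[n]` at `x`. -/
noncomputable def orient (a : ℝ) (n : ℕ) (x : ℝ) : ℝ :=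
  ∏ j ∈ Finset.range n, if (fa a)^[j] x < 0 then -1 else 1

theorem orient_succ (a : ℝ) (n : ℕ) (x : ℝ) :
    orient a (n + 1) x = orient a n x * if (fa a)^[n] x < 0 then -1 else 1 :=
  Finset.prod_range_succ _ _

theorem abs_orient (a : ℝ) (n : ℕ) (x : ℝ) : |orient a n x| = 1 := by
  induction n with
  | zero => simp [orient]
  | succ n ih => rw [orient_succ, abs_mul, ih]; split_ifs <;> simp

theorem orient_congr {a : ℝ} {n : ℕ} {x y : ℝ} (H : itin a n x = itin a n y) {i : ℕ} (hi : i ≤ n) :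
    orient a i x = orient a i y := by
  rw [itin_eq_iff] at H
  refine Finset.prod_congr rfl fun j hj => ?_
  rw [Finset.mem_range] at hj
  simp only [H j (hj.trans_le hi)]

theorem orient_mul_sub_pos {a : ℝ} {n : ℕ} {x y : ℝ} (H : itin a n x = itin a n y) (hxy : x < y)
    {i : ℕ} (hi : i ≤ n) : 0 < orient a i x * ((fa a)^[i] y - (fa a)^[i] x) := by
  induction i with
  | zero => simpa [orient] using hxy
  | succ i ih =>
    have h1 := ih (by omega)
    have h2 := itin_eq_iff.1 H i (by omega)
    have h3 : (fa a)^[i] x ≠ (fa a)^[i] y := fun h => by simp [h] at h1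
    rw [iterate_succ_fa, iterate_succ_fa, orient_succ]
    split_ifs with h4
    · have h5 := h2.1 h4
      nlinarith [mul_pos h1 (show 0 < -((fa a)^[i] x + (fa a)^[i] y) by linarith)]
    · have h5 : 0 ≤ (fa a)^[i] y := not_lt.1 fun h => h4 (h2.2 h)
      have h6 : 0 ≤ (fa a)^[i] x := not_lt.1 h4
      have h7 : 0 < (fa a)^[i] x + (fa a)^[i] y := by
        rcases lt_or_gt_of_ne h3 with h | h <;> linarith
      nlinarith [mul_pos h1 h7]

theorem iterate_injOn_of_itin {a : ℝ} {n : ℕ} {x y : ℝ} (H : itin a n x = itin a n y)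
    (hxy : (fa a)^[n] x = (fa a)^[n] y) : x = y := by
  rcases lt_trichotomy x y with h | h | h
  · simpa [hxy] using orient_mul_sub_pos H h le_rfl
  · exact h
  · simpa [hxy] using orient_mul_sub_pos H.symm h le_rfl

/-- The total oriented orbit sum, which is increasing on cylinders and controls their
dynamical size. -/
noncomputable def orbitSum (a : ℝ) (n : ℕ) (x : ℝ) : ℝ :=
  ∑ i ∈ Finset.range n, orient a i x * (fa a)^[i] x

theorem abs_orbitSum_le {a : ℝ} (ha : a ∈ Icc (-2 : ℝ) (1 / 4)) (n : ℕ) {x : ℝ} (hx : x ∈ Ia a) :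
    |orbitSum a n x| ≤ 2 * n := by
  refine (Finset.abs_sum_le_sum_abs _ _).trans ?_
  refine (Finset.sum_le_card_nsmul _ _ 2 fun i _ => ?_).trans (by simp [mul_comm])
  rw [abs_mul, abs_orient, one_mul]
  exact (mem_Ia.1 (iterate_mem ha hx i)).trans (bt_le_two ha.1)

theorem abs_iterate_sub_le {a : ℝ} {n : ℕ} {x y : ℝ} (H : itin a n x = itin a n y)
    {i : ℕ} (hi : i < n) :
    |(fa a)^[i] x - (fa a)^[i] y| ≤ |orbitSum a n x - orbitSum a n y| := by
  wlog hxy : x < y generalizing x y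
  · rcases (not_lt.1 hxy).lt_or_eq with h | h
    · have := this H.symm h
      rwa [abs_sub_comm, abs_sub_comm (orbitSum a n x)]
    · simp [h]
  have h0 : orbitSum a n y - orbitSum a n x =
      ∑ j ∈ Finset.range n, orient a j x * ((fa a)^[j] y - (fa a)^[j] x) := by
    unfold orbitSum
    rw [← Finset.sum_sub_distrib]
    refine Finset.sum_congr rfl fun j hj => ?_
    rw [← orient_congr H (Finset.mem_range.1 hj).le]
    ring
  have h1 : ∀ j ∈ Finset.range n, 0 ≤ orient a j x * ((fa a)^[j] y - (fa a)^[j] x) :=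
    fun j hj => (orient_mul_sub_pos H hxy (Finset.mem_range.1 hj).le).le
  have h2 := Finset.single_le_sum h1 (Finset.mem_range.2 hi)
  rw [abs_sub_comm, abs_sub_comm (orbitSum a n x), h0]
  refine le_trans ?_ (h2.trans (le_abs_self _))
  rw [← abs_of_nonneg (h1 i (Finset.mem_range.2 hi)), abs_mul, abs_orient, one_mul]

theorem exists_dynCover {a : ℝ} (ha : a ∈ Icc (-2 : ℝ) (1 / 4)) (n : ℕ) {ε : ℝ} (hε : 0 < ε) :
    ∃ s : Finset ℝ, Dynamics.IsDynCoverOf (fa a) (Ia a) {p : ℝ × ℝ | dist p.1 p.2 < ε} n s ∧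
      (s.card : ℝ) ≤ wd a n * (4 * n / ε + 1) := by
  set g : ℝ → Finset ℕ × ℕ := fun x => (itin a n x, ⌊(orbitSum a n x + 2 * n) / ε⌋₊) with hg
  have hnn : ∀ x ∈ Ia a, 0 ≤ orbitSum a n x + 2 * n := fun x hx => by
    linarith [(abs_le.1 (abs_orbitSum_le ha n hx)).1]
  have hsub : g '' Ia a ⊆ (itin a n '' Ia a) ×ˢ (Iic ⌊4 * n / ε⌋₊) := by
    rintro _ ⟨x, hx, rfl⟩
    refine ⟨⟨x, hx, rfl⟩, Nat.floor_le_floor ?_⟩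
    gcongr
    linarith [(abs_le.1 (abs_orbitSum_le ha n hx)).2]
  have hfin : ((itin a n '' Ia a) ×ˢ (Iic ⌊4 * n / ε⌋₊)).Finite :=
    (finite_itin_image a n _).prod (finite_Iic _)
  obtain ⟨s, hs, hbij⟩ := exists_subset_bijOn (Ia a) g
  have hsfin : s.Finite := hbij.finite_iff_finite.2 (hfin.subset hsub)
  refine ⟨hsfin.toFinset, ?_, ?_⟩
  · rw [hsfin.coe_toFinset]
    intro x hx
    obtain ⟨y, hy, hxy⟩ := hbij.surjOn ⟨x, hx, rfl⟩
    refine ⟨y, hy, ?_⟩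
    rw [Dynamics.mem_dynEntourage]
    intro i hi
    simp only [hg, Prod.mk.injEq] at hxy
    have h1 := abs_iterate_sub_le hxy.1 hi
    show dist ((fa a)^[i] x) ((fa a)^[i] y) < ε
    rw [dist_comm, Real.dist_eq]
    refine h1.trans_lt ?_
    have hy1 := Nat.floor_le (div_nonneg (hnn y (hs hy)) hε.le)
    have hy2 := Nat.lt_floor_add_one ((orbitSum a n y + 2 * n) / ε)
    have hx1 := Nat.floor_le (div_nonneg (hnn x hx) hε.le)
    have hx2 := Nat.lt_floor_add_one ((orbitSum a n x + 2 * n) / ε)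
    rw [hxy.2] at hy1 hy2
    have key : |(orbitSum a n y + 2 * n) / ε - (orbitSum a n x + 2 * n) / ε| < 1 := by
      rw [abs_lt]; constructor <;> linarith
    rw [← sub_div, abs_div, abs_of_pos hε, div_lt_one hε] at key
    rwa [add_sub_add_right_eq_sub] at key
  · have h1 : hsfin.toFinset.card ≤ wd a n * (⌊4 * n / ε⌋₊ + 1) := by
      rw [← ncard_eq_toFinset_card s hsfin, ← hbij.injOn.ncard_image, hbij.image_eq]
      refine (ncard_le_ncard hsub hfin).trans ?_
      rw [ncard_prod, wd]
      gcongr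
      rw [← Nat.card_coe_set_eq]
      simp
    have h2 := Nat.floor_le (show 0 ≤ 4 * n / ε by positivity)
    calc (hsfin.toFinset.card : ℝ) ≤ wd a n * (⌊4 * n / ε⌋₊ + 1) := by exact_mod_cast h1
      _ ≤ _ := by gcongr

theorem wd_mul_le {a : ℝ} (ha : a ∈ Icc (-2 : ℝ) (1 / 4)) (n k : ℕ) :
    wd a (n * k) ≤ wd a n ^ k := by
  induction k with
  | zero =>
    rw [mul_zero, pow_zero, wd]
    refine (ncard_le_one (finite_itin_image a 0 _)).2 ?_
    rintro _ ⟨x, -, rfl⟩ _ ⟨y, -, rfl⟩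
    simp [itin]
  | succ k ih =>
    rw [mul_add, mul_one, pow_succ]
    exact (wd_add_le ha _ _).trans (Nat.mul_le_mul_right _ ih)

theorem coverEntropy_le {a : ℝ} (ha : a ∈ Icc (-2 : ℝ) (1 / 4)) {n : ℕ} (hn : n ≠ 0) :
    Dynamics.coverEntropy (fa a) (Ia a) ≤ ((Real.log (wd a n) / n : ℝ) : EReal) := by
  refine iSup₂_le fun V hV => ?_
  obtain ⟨δ, hδ, hV⟩ := Metric.mem_uniformity_dist.1 hV
  set U : SetRel ℝ ℝ := {p : ℝ × ℝ | dist p.1 p.2 < δ / 2} with hU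
  have hsymm : U.IsSymm := ⟨fun x y hxy => by simpa [hU, dist_comm] using hxy⟩
  have hUV : SetRel.comp U U ⊆ V := by
    rintro ⟨x, y⟩ ⟨z, h1, h2⟩
    refine hV ?_
    have h1 : dist x z < δ / 2 := h1
    have h2 : dist z y < δ / 2 := h2
    linarith [dist_triangle x z y]
  refine (Dynamics.coverEntropyEntourage_antitone _ _ hUV).trans ?_
  have hnpos : (0 : ℝ) < n := by positivity
  have hbound : ∀ k : ℕ, 0 < k → Dynamics.coverEntropyEntourage (fa a) (Ia a) (SetRel.comp U U) ≤
      (((Real.log (wd a n) + Real.log ((8 * n / δ + 1) * k) / k) / n : ℝ) : EReal) := by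
    intro k hk
    have hk' : (1 : ℝ) ≤ k := by exact_mod_cast hk
    obtain ⟨s, hs, hcard⟩ := exists_dynCover ha (n * k) (half_pos hδ)
    refine (hs.coverEntropyEntourage_le_log_card_div (mapsTo_fa ha) (by positivity)).trans ?_
    have hspos : 0 < s.card := by
      have := Dynamics.IsDynCoverOf.nonempty ⟨0, zero_mem a⟩ hs
      exact Finset.card_pos.2 (by exact_mod_cast this)
    have hlog : ENNReal.log (s.card : ENNReal) = (Real.log s.card : ℝ) := by
      rw [ENNReal.log_pos_real (by positivity) (by simp)]
      simp
    have hw := wd_pos a n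
    have h1 : Real.log s.card ≤ k * Real.log (wd a n) + Real.log ((8 * n / δ + 1) * k) := by
      rw [← Real.log_pow, ← Real.log_mul (by positivity) (by positivity)]
      refine Real.log_le_log (by exact_mod_cast hspos) (hcard.trans ?_)
      have h2 : (wd a (n * k) : ℝ) ≤ (wd a n : ℝ) ^ k := by exact_mod_cast wd_mul_le ha n k
      have h3 : 4 * ((n * k : ℕ) : ℝ) / (δ / 2) + 1 ≤ (8 * n / δ + 1) * k := by
        push_cast
        have : 4 * ((n : ℝ) * k) / (δ / 2) = 8 * n / δ * k := by field_simp; ring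
        rw [this]
        linarith
      gcongr
    have h4 : (((n * k : ℕ) : EReal)) = (((n * k : ℕ) : ℝ) : EReal) := by simp
    rw [hlog, h4, ← EReal.coe_div]
    refine EReal.coe_le_coe_iff.2 ?_
    push_cast
    have hkpos : (0 : ℝ) < k := by linarith
    rw [div_le_div_iff₀ (by positivity) (by positivity)]
    have : (Real.log (wd a n) + Real.log ((8 * n / δ + 1) * k) / k) * (n * k) =
      (k * Real.log (wd a n) + Real.log ((8 * n / δ + 1) * k)) * n := by
      field_simp
    rw [this]
    gcongr
  refine ge_of_tendsto (x := atTop) (f := fun k : ℕ =>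
    (((Real.log (wd a n) + Real.log ((8 * n / δ + 1) * k) / k) / n : ℝ) : EReal)) ?_ ?_
  · refine (continuous_coe_real_ereal.tendsto _).comp ?_
    have hc : (0 : ℝ) < 8 * n / δ + 1 := by positivity
    have h1 : Tendsto (fun x : ℝ => Real.log ((8 * n / δ + 1) * x) / x) atTop (nhds 0) := by
      have h2 := (Real.isLittleO_log_id_atTop.tendsto_div_nhds_zero.comp
        (tendsto_id.const_mul_atTop hc)).mul_const (8 * n / δ + 1)
      rw [zero_mul] at h2
      refine h2.congr' ?_
      filter_upwards [eventually_gt_atTop 0] with x hx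
      simp only [Function.comp, id]
      field_simp
    have h3 := ((h1.comp tendsto_natCast_atTop_atTop).const_add (Real.log (wd a n))).div_const
      (n : ℝ)
    rw [add_zero] at h3
    exact h3
  · filter_upwards [eventually_gt_atTop 0] with k hk using hbound k hk

theorem coverEntropy_ne_bot (a : ℝ) : Dynamics.coverEntropy (fa a) (Ia a) ≠ ⊥ := by
  have := Dynamics.coverEntropy_nonneg (fa a) ⟨0, zero_mem a⟩
  intro h
  rw [h] at this
  exact absurd this (by simp)

theorem coverEntropy_ne_top {a : ℝ} (ha : a ∈ Icc (-2 : ℝ) (1 / 4)) :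
    Dynamics.coverEntropy (fa a) (Ia a) ≠ ⊤ :=
  ((coverEntropy_le ha one_ne_zero).trans_lt (EReal.coe_lt_top _)).ne

theorem coe_h {a : ℝ} (ha : a ∈ Icc (-2 : ℝ) (1 / 4)) :
    (h a : EReal) = Dynamics.coverEntropy (fa a) (Ia a) :=
  EReal.coe_toReal (coverEntropy_ne_top ha) (coverEntropy_ne_bot a)

theorem h_nonneg (a : ℝ) : 0 ≤ h a :=
  EReal.toReal_nonneg (Dynamics.coverEntropy_nonneg (fa a) ⟨0, zero_mem a⟩)

theorem h_le_log_div {a : ℝ} (ha : a ∈ Icc (-2 : ℝ) (1 / 4)) {n : ℕ} (hn : n ≠ 0) :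
    h a ≤ Real.log (wd a n) / n := by
  have := coverEntropy_le ha hn
  rw [← coe_h ha] at this
  exact_mod_cast this

theorem continuous_iterate_fa (a : ℝ) (n : ℕ) : Continuous (fa a)^[n] :=
  (continuous_fa a).iterate n

theorem finite_preimage_iterate (a c : ℝ) (n : ℕ) : {x : ℝ | (fa a)^[n] x = c}.Finite := by
  induction n with
  | zero => simp
  | succ n ih =>
    have : {x : ℝ | (fa a)^[n + 1] x = c} = (fa a) ⁻¹' {x : ℝ | (fa a)^[n] x = c} := by
      ext x; simp [Function.iterate_succ_apply]
    rw [this]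
    refine ih.preimage' fun b _ => ?_
    refine (Set.toFinite {√(b - a), -√(b - a)}).subset fun x hx => ?_
    have hx : x ^ 2 + a = b := hx
    have h1 : √(b - a) = |x| := by rw [← hx, add_sub_cancel_right, Real.sqrt_sq_eq_abs]
    rw [h1]
    rcases abs_cases x with h | h <;> simp [h.1]

/-- Between two points whose `i`-th iterates have different signs there is a zero. -/
theorem exists_zero_of_sign_ne {a x y : ℝ} (i : ℕ) (hxy : x ≤ y)
    (H : ¬((fa a)^[i] x < 0 ↔ (fa a)^[i] y < 0)) : ∃ z ∈ Icc x y, (fa a)^[i] z = 0 := by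
  have hc := (continuous_iterate_fa a i).continuousOn (s := Icc x y)
  by_cases hx : (fa a)^[i] x < 0
  · have hy : 0 ≤ (fa a)^[i] y := by
      by_contra h
      exact H ⟨fun _ => not_le.1 h, fun _ => hx⟩
    exact intermediate_value_Icc hxy hc ⟨hx.le, hy⟩
  · have hy : (fa a)^[i] y < 0 := by by_contra h; exact H (by tauto)
    exact intermediate_value_Icc' hxy hc ⟨hy.le, not_lt.1 hx⟩

theorem exists_pos_ncard_ball_le (a : ℝ) (m : ℕ) :
    ∃ ε > 0, ∀ c : ℝ, (itin a m '' Metric.ball c ε).ncard ≤ 3 := by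
  set Z : Set ℝ := ⋃ i ∈ Finset.range m, {x : ℝ | (fa a)^[i] x = 0} with hZ
  have hZfin : Z.Finite := (Finset.range m).finite_toSet.biUnion fun i _ =>
    finite_preimage_iterate a 0 i
  obtain ⟨C, hC, hsep⟩ := einfsep_pos.1 hZfin.einfsep_pos
  obtain ⟨ε, hε, hεC⟩ := ENNReal.lt_iff_exists_nnreal_btwn.1 hC
  have hε' : (0 : ℝ) < ε := by exact_mod_cast hε
  refine ⟨ε / 2, by positivity, fun c => ?_⟩
  obtain ⟨z, hz⟩ : ∃ z, ∀ x ∈ Metric.ball c (ε / 2), x ∈ Z → x = z := by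
    by_cases hex : ∃ z ∈ Metric.ball c (ε / 2), z ∈ Z
    · obtain ⟨z, hz, hzZ⟩ := hex
      refine ⟨z, fun x hx hxZ => ?_⟩
      by_contra hne
      have h1 := hsep x hxZ z hzZ hne
      have h2 : dist x z < ε := by
        have := dist_triangle_right x z c
        rw [Metric.mem_ball] at hx hz
        linarith
      have h3 : edist x z < ε := by
        rw [edist_dist]
        exact (ENNReal.ofReal_lt_iff_lt_toReal dist_nonneg (by simp)).2 (by simpa using h2)
      exact absurd (h1.trans_lt h3) (not_lt.2 hεC.le)
    · push Not at hex
      exact ⟨0, fun x hx hxZ => absurd hxZ (hex x hx)⟩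
  have hconv : ∀ x ∈ Metric.ball c (ε / 2), ∀ y ∈ Metric.ball c (ε / 2), ∀ t ∈ Icc x y,
      t ∈ Metric.ball c (ε / 2) := fun x hx y hy t ht => by
    rw [Real.ball_eq_Ioo] at *
    exact ⟨hx.1.trans_le ht.1, ht.2.trans_lt hy.2⟩
  have key : ∀ x ∈ Metric.ball c (ε / 2), ∀ y ∈ Metric.ball c (ε / 2), x ≤ y →
      (y < z ∨ z < x ∨ x = y) → itin a m x = itin a m y := by
    intro x hx y hy hxy hor
    rw [itin_eq_iff]
    intro i hi
    by_contra hne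
    obtain ⟨t, ht, ht0⟩ := exists_zero_of_sign_ne i hxy hne
    have htz : t = z := hz t (hconv x hx y hy t ht)
      (mem_biUnion (Finset.mem_coe.2 (Finset.mem_range.2 hi)) ht0)
    rcases hor with h | h | h
    · exact absurd ht.2 (by rw [htz]; exact not_le.2 h)
    · exact absurd ht.1 (by rw [htz]; exact not_le.2 h)
    · subst h
      exact hne Iff.rfl
  have h3 : ((fun x : ℝ => SignType.sign (x - z)) '' Metric.ball c (ε / 2)).ncard ≤ 3 := by
    refine (ncard_le_ncard (subset_univ _) (toFinite _)).trans ?_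
    rw [ncard_univ, Nat.card_eq_fintype_card]
    rfl
  refine (ncard_image_le_of_factors (toFinite _) ?_).trans h3
  intro x hx y hy hxy
  replace hxy : SignType.sign (x - z) = SignType.sign (y - z) := hxy
  wlog hle : x ≤ y generalizing x y
  · exact (this y hy x hx hxy.symm (not_le.1 hle).le).symm
  refine key x hx y hy hle ?_
  rcases lt_trichotomy (y - z) 0 with h | h | h
  · exact Or.inl (by linarith)
  · rw [h, sign_zero, sign_eq_zero_iff] at hxy
    exact Or.inr (Or.inr (by linarith))
  · rw [sign_pos h, sign_eq_one_iff] at hxy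
    exact Or.inr (Or.inl (by linarith))

theorem wd_mul_le_coverMincard (a : ℝ) (m : ℕ) :
    ∃ ε > 0, ∀ k, ∀ s : Finset ℝ,
      Dynamics.IsDynCoverOf (fa a) (Ia a) {p : ℝ × ℝ | dist p.1 p.2 < ε} (m * k) s →
      wd a (m * k) ≤ 3 ^ k * s.card := by
  obtain ⟨ε, hε, hball⟩ := exists_pos_ncard_ball_le a m
  refine ⟨ε, hε, fun k s hs => ?_⟩
  by_cases hm : m = 0
  · subst hm
    rw [zero_mul] at hs ⊢
    have h1 : wd a 0 ≤ 1 := by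
      refine (ncard_le_one (finite_itin_image a 0 _)).2 ?_
      rintro _ ⟨x, -, rfl⟩ _ ⟨y, -, rfl⟩
      simp [itin]
    have h2 : 0 < s.card := Finset.card_pos.2
      (by exact_mod_cast Dynamics.IsDynCoverOf.nonempty ⟨0, zero_mem a⟩ hs)
    exact h1.trans (Nat.mul_pos (by positivity) h2)
  have hdyn : ∀ c : ℝ, ∀ k : ℕ,
      (itin a (m * k) '' {x | ∀ i < m * k, dist ((fa a)^[i] x) ((fa a)^[i] c) < ε}).ncard
        ≤ 3 ^ k := by
    intro c k
    induction k with
    | zero =>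
      refine (ncard_le_one (finite_itin_image a _ _)).2 ?_
      rintro _ ⟨x, -, rfl⟩ _ ⟨y, -, rfl⟩
      simp [itin]
    | succ k ih =>
      rw [mul_add, mul_one, pow_succ]
      refine (ncard_itin_add_le (t := Metric.ball ((fa a)^[m * k] c) ε) _ _ ?_).trans
        (Nat.mul_le_mul ((ncard_le_ncard (image_mono ?_) (finite_itin_image a _ _)).trans ih)
          (hball _))
      · intro x hx
        exact hx (m * k) (by omega)
      · intro x hx i hi
        exact hx i (by omega)
  have hsub : itin a (m * k) '' Ia a ⊆ ⋃ c ∈ s,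
      itin a (m * k) '' {x | ∀ i < m * k, dist ((fa a)^[i] x) ((fa a)^[i] c) < ε} := by
    rintro _ ⟨x, hx, rfl⟩
    obtain ⟨c, hc, hxc⟩ := hs hx
    rw [Dynamics.mem_dynEntourage] at hxc
    exact mem_biUnion hc ⟨x, hxc, rfl⟩
  rw [wd]
  refine (ncard_le_ncard hsub ?_).trans ?_
  · exact s.finite_toSet.biUnion fun c _ => finite_itin_image a _ _
  refine (Finset.set_ncard_biUnion_le s _).trans ?_
  refine (Finset.sum_le_card_nsmul _ _ _ fun c _ => hdyn c k).trans ?_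
  rw [smul_eq_mul, mul_comm]

theorem eventually_wd_mul_le {a : ℝ} (ha : a ∈ Icc (-2 : ℝ) (1 / 4)) {h' : ℝ} (hh : h a < h') (m : ℕ) :
    ∀ᶠ k : ℕ in atTop, (wd a (m * k) : ℝ) ≤ 3 ^ k * Real.exp (h' * (m * k : ℕ)) := by
  by_cases hm : m = 0
  · refine Eventually.of_forall fun k => ?_
    subst hm
    have h1 : wd a 0 ≤ 1 := by
      refine (ncard_le_one (finite_itin_image a 0 _)).2 ?_
      rintro _ ⟨x, -, rfl⟩ _ ⟨y, -, rfl⟩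
      simp [itin]
    have h2 : (wd a 0 : ℝ) ≤ 1 := by exact_mod_cast h1
    simp only [zero_mul, Nat.cast_zero, mul_zero, Real.exp_zero, mul_one]
    exact h2.trans (one_le_pow₀ (by norm_num))
  obtain ⟨ε, hε, H⟩ := wd_mul_le_coverMincard a m
  set U : SetRel ℝ ℝ := {p : ℝ × ℝ | dist p.1 p.2 < ε} with hU
  have hUmem : U ∈ uniformity ℝ := Metric.dist_mem_uniformity hε
  have h1 : Dynamics.coverEntropyEntourage (fa a) (Ia a) U < (h' : EReal) :=
    (Dynamics.coverEntropyEntourage_le_coverEntropy _ _ hUmem).trans_lt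
      (by rw [← coe_h ha]; exact_mod_cast hh)
  have h2 := ExpGrowth.eventually_le_exp h1
  have hcomp : IsCompact (Ia a) := by rw [Ia_eq]; exact isCompact_Icc
  have h3 := (tendsto_id.const_mul_atTop' (Nat.pos_of_ne_zero hm)).eventually h2
  filter_upwards [h3] with k hk
  obtain ⟨s, hs, hcard⟩ := (Dynamics.coverMincard_finite_iff _ _ _ _).1
    (Dynamics.coverMincard_finite_of_isCompact_invariant hcomp (mapsTo_fa ha)
      hUmem (m * k))
  have hw := H k s hs
  simp only [id] at hk
  rw [← hcard] at hk
  have h4 : (((m * k : ℕ) : EReal)) = (((m * k : ℕ) : ℝ) : EReal) := by simp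
  rw [h4, ← EReal.coe_mul, EReal.exp_coe] at hk
  have h5 : (s.card : ℝ) ≤ Real.exp (h' * (m * k : ℕ)) := by
    have : ((s.card : ℝ)) = (((s.card : ℕ∞) : ENNReal)).toReal := by simp
    rw [this]
    exact ENNReal.toReal_le_of_le_ofReal (Real.exp_pos _).le hk
  calc (wd a (m * k) : ℝ) ≤ 3 ^ k * s.card := by exact_mod_cast hw
    _ ≤ _ := by gcongr

theorem subadditive_log_wd {a : ℝ} (ha : a ∈ Icc (-2 : ℝ) (1 / 4)) :
    Subadditive fun n => Real.log (wd a n) := by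
  intro m n
  have hm := wd_pos a m
  have hn := wd_pos a n
  have := wd_pos a (m + n)
  rw [← Real.log_mul (by positivity) (by positivity)]
  refine Real.log_le_log (by positivity) ?_
  exact_mod_cast wd_add_le ha m n

theorem eventually_wd_lt {a : ℝ} (ha : a ∈ Icc (-2 : ℝ) (1 / 4)) {h' : ℝ} (hh : h a < h') :
    ∀ᶠ n : ℕ in atTop, (wd a n : ℝ) ≤ Real.exp (h' * n) := by
  obtain ⟨h₁, hh₁, hh₂⟩ := exists_between hh
  obtain ⟨m, hm⟩ := exists_nat_gt (Real.log 3 / (h' - h₁))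
  have hlog3 : 0 < Real.log 3 := Real.log_pos (by norm_num)
  have hm0 : (0 : ℝ) < m := lt_trans (div_pos hlog3 (by linarith)) hm
  have hmn : m ≠ 0 := by exact_mod_cast hm0.ne'
  obtain ⟨k, hk, hk0⟩ := ((eventually_wd_mul_le ha hh₁ m).and (eventually_gt_atTop 0)).exists
  have hkpos : (0 : ℝ) < k := by exact_mod_cast hk0
  have hw := wd_pos a (m * k)
  have h1 : Real.log (wd a (m * k)) / (m * k : ℕ) < h' := by
    rw [div_lt_iff₀ (by positivity)]
    have h2 : Real.log (wd a (m * k)) ≤ k * Real.log 3 + h₁ * (m * k : ℕ) := by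
      rw [Real.log_le_iff_le_exp (by exact_mod_cast hw), Real.exp_add, mul_comm (k : ℝ),
        Real.exp_mul, Real.exp_log (by norm_num), Real.rpow_natCast]
      exact hk
    rw [div_lt_iff₀ (by linarith)] at hm
    push_cast at h2 ⊢
    nlinarith
  filter_upwards [(subadditive_log_wd ha).eventually_div_lt_of_div_lt (by positivity) h1,
    eventually_gt_atTop 0] with n hn hn0
  have hwn := wd_pos a n
  rw [div_lt_iff₀ (by exact_mod_cast hn0)] at hn
  exact (Real.log_le_iff_le_exp (by exact_mod_cast hwn)).1 hn.le

/-- The exponential of the entropy. -/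
noncomputable def gr (a : ℝ) : ℝ := Real.exp (h a)

theorem one_le_gr (a : ℝ) : 1 ≤ gr a := Real.one_le_exp (h_nonneg a)

theorem gr_pow_le_wd {a : ℝ} (ha : a ∈ Icc (-2 : ℝ) (1 / 4)) (n : ℕ) : gr a ^ n ≤ wd a n := by
  rcases eq_or_ne n 0 with rfl | hn
  · have := wd_pos a 0
    simpa using Nat.one_le_iff_ne_zero.2 this.ne'
  have h1 := h_le_log_div ha hn
  rw [le_div_iff₀ (by positivity)] at h1
  rw [gr, ← Real.exp_nat_mul, mul_comm]
  exact (Real.le_log_iff_exp_le (by exact_mod_cast wd_pos a n)).1 h1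

theorem eventually_wd_le_pow {a : ℝ} (ha : a ∈ Icc (-2 : ℝ) (1 / 4)) {r : ℝ} (hr : gr a < r) :
    ∀ᶠ n : ℕ in atTop, (wd a n : ℝ) ≤ r ^ n := by
  have hr0 : 0 < r := (Real.exp_pos _).trans hr
  filter_upwards [eventually_wd_lt ha ((Real.lt_log_iff_exp_lt hr0).2 hr)] with n hn
  rwa [Real.exp_mul, Real.exp_log hr0, Real.rpow_natCast] at hn

theorem iterate_fa_neg (a x : ℝ) {n : ℕ} (hn : n ≠ 0) : (fa a)^[n] (-x) = (fa a)^[n] x := by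
  obtain ⟨m, rfl⟩ := Nat.exists_eq_succ_of_ne_zero hn
  rw [Function.iterate_succ_apply, Function.iterate_succ_apply, fa_apply, fa_apply, neg_sq]

theorem iterate_fa_abs (a x : ℝ) {n : ℕ} (hn : n ≠ 0) : (fa a)^[n] |x| = (fa a)^[n] x := by
  rcases abs_choice x with h | h <;> rw [h]
  exact iterate_fa_neg a x hn

theorem two_le_gr_pow_of_wd {a : ℝ} (ha : a ∈ Icc (-2 : ℝ) (1 / 4)) {M : ℕ} (hM : M ≠ 0)
    (H : ∀ k, 2 ^ k ≤ wd a (M * k)) : 2 ≤ gr a ^ M := by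
  by_contra hlt
  push Not at hlt
  have h1 : ∀ᶠ r in nhdsWithin (gr a) (Ioi (gr a)), r ^ M < 2 :=
    ((continuous_pow M).tendsto (gr a)).eventually_lt_const hlt |>.filter_mono nhdsWithin_le_nhds
  obtain ⟨r, hr, hr'⟩ := (h1.and self_mem_nhdsWithin).exists
  have h2 := (tendsto_id.const_mul_atTop' (Nat.pos_of_ne_zero hM)).eventually
    (eventually_wd_le_pow ha hr')
  obtain ⟨k, hk, hk0⟩ := (h2.and (eventually_gt_atTop 0)).exists
  have h3 : (2 : ℝ) ^ k ≤ wd a (M * k) := by exact_mod_cast H k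
  have h4 := h3.trans hk
  simp only [id] at h4
  rw [pow_mul] at h4
  have hr0 : 0 ≤ r := (zero_le_one.trans (one_le_gr a)).trans (le_of_lt hr')
  exact absurd (pow_lt_pow_left₀ hr (pow_nonneg hr0 M) hk0.ne') (not_lt.2 h4)

/-- A full horseshoe for the `M`-th iterate forces entropy at least `log 2 / M`. -/
theorem two_le_gr_pow {a : ℝ} (ha : a ∈ Icc (-2 : ℝ) (1 / 4)) {M : ℕ} (hM : M ≠ 0) {q τ : ℝ}
    (hq : 0 < q) (hqb : q ≤ bt a) (hτ : |τ| = 1) (hfix : (fa a)^[M] q = τ * q)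
    (h0 : τ * (fa a)^[M] 0 ≤ -q) : 2 ≤ gr a ^ M := by
  have hτ2 : τ * τ = 1 := by rw [← abs_mul_abs_self, hτ, one_mul]
  have hpre : ∀ y ∈ Ioo (-q) q, ∃ x ∈ Ioo 0 q, (fa a)^[M] x = y := by
    intro y hy
    have hy' : τ * y ∈ Icc (τ * (fa a)^[M] 0) (τ * (fa a)^[M] q) := by
      have h1 : |τ * y| < q := by rw [abs_mul, hτ, one_mul]; exact abs_lt.2 hy
      rw [abs_lt] at h1
      rw [hfix, ← mul_assoc, hτ2, one_mul]
      exact ⟨h0.trans h1.1.le, h1.2.le⟩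
    obtain ⟨x, hx, hxy⟩ := intermediate_value_Icc hq.le
      ((continuous_iterate_fa a M).const_mul τ).continuousOn hy'
    have hxy' : (fa a)^[M] x = y := by
      have : τ * τ * (fa a)^[M] x = τ * τ * y := by rw [mul_assoc, mul_assoc]; exact congrArg _ hxy
      simpa [hτ2] using this
    have habs : ∀ t, |t| = |τ * t| := fun t => by rw [abs_mul, hτ, one_mul]
    have hylt := abs_lt.2 hy
    refine ⟨x, ⟨lt_of_le_of_ne hx.1 ?_, lt_of_le_of_ne hx.2 ?_⟩, hxy'⟩
    · rintro rfl
      rw [← hxy', habs, abs_of_nonpos (by linarith)] at hylt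
      linarith
    · rintro rfl
      rw [← hxy', hfix, abs_mul, hτ, one_mul, abs_of_pos hq] at hylt
      exact lt_irrefl _ hylt
  have hcode : ∀ k : ℕ, ∀ u : ℕ → Bool, ∃ x ∈ Ioo (-q) q,
      ∀ j < k, ((fa a)^[M * j] x < 0 ↔ u j = true) := by
    intro k
    induction k with
    | zero => exact fun u => ⟨0, ⟨by linarith, hq⟩, fun j hj => absurd hj (by omega)⟩
    | succ k ih =>
      intro u
      obtain ⟨y, hy, hyu⟩ := ih fun j => u (j + 1)
      obtain ⟨x, hx, hxy⟩ := hpre y hy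
      have step : ∀ z, (fa a)^[M] z = y → ∀ j < k,
          ((fa a)^[M * (j + 1)] z < 0 ↔ u (j + 1) = true) := by
        intro z hz j hj
        rw [mul_add, mul_one, Function.iterate_add_apply, hz]
        exact hyu j hj
      cases hu : u 0 with
      | true =>
        refine ⟨-x, ⟨by linarith [hx.2], by linarith [hx.1]⟩, fun j hj => ?_⟩
        rcases j with _ | j
        · simpa [hu] using hx.1
        · exact step (-x) (by rw [iterate_fa_neg a x hM, hxy]) j (by omega)
      | false =>
        refine ⟨x, ⟨by linarith [hx.1], hx.2⟩, fun j hj => ?_⟩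
        rcases j with _ | j
        · simpa [hu] using hx.1.le
        · exact step x hxy j (by omega)
  refine two_le_gr_pow_of_wd ha hM fun k => ?_
  choose p hp hpu using fun u : Fin k → Bool =>
    hcode k fun j => if hj : j < k then u ⟨j, hj⟩ else false
  have hinj : Function.Injective fun u => itin a (M * k) (p u) := by
    intro u v huv
    have huv := itin_eq_iff.1 huv
    funext j
    have h1 := hpu u j j.2
    have h2 := hpu v j j.2
    have h3 := huv (M * j) (Nat.mul_lt_mul_of_pos_left j.2 (Nat.pos_of_ne_zero hM))
    simp only [j.2, dif_pos] at h1 h2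
    rw [Bool.eq_iff_iff, ← h1, ← h2, h3]
  have hcard : (range fun u => itin a (M * k) (p u)).ncard = 2 ^ k := by
    rw [← image_univ, hinj.injOn.ncard_image, ncard_univ, Nat.card_eq_fintype_card]
    simp
  rw [← hcard, wd]
  refine ncard_le_ncard ?_ (finite_itin_image a _ _)
  rintro _ ⟨u, rfl⟩
  refine ⟨p u, mem_Ia.2 (le_trans ?_ hqb), rfl⟩
  exact (abs_lt.2 (hp u)).le

theorem two_le_gr_pow_of_signs {a : ℝ} (ha : a ∈ Icc (-2 : ℝ) (1 / 4)) {M : ℕ} (hM : M ≠ 0)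
    {σ : ℝ} (hσ : |σ| = 1) {G : ℝ → ℝ} (hG : ∀ x, G x = σ * (fa a)^[M] x)
    (h1 : 0 < G 0) (h2 : G (G 0) < 0) (h3 : G (G (G 0)) ≤ -G (G 0)) : 2 ≤ gr a ^ (2 * M) := by
  have hσ2 : σ * σ = 1 := by rw [← abs_mul_abs_self, hσ, one_mul]
  have heven : ∀ x, G (-x) = G x := fun x => by rw [hG, hG, iterate_fa_neg a x hM]
  have hσmul : ∀ x, (fa a)^[M] (σ * x) = (fa a)^[M] x := by
    intro x
    rw [← iterate_fa_abs a (σ * x) hM, abs_mul, hσ, one_mul, iterate_fa_abs a x hM]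
  have hGG : ∀ x, G (G x) = σ * (fa a)^[2 * M] x := by
    intro x
    rw [hG, hG, hσmul, two_mul, Function.iterate_add_apply]
  have hGc : Continuous G := by
    have : G = fun x => σ * (fa a)^[M] x := funext hG
    rw [this]
    exact (continuous_iterate_fa a M).const_mul σ
  have hmem : (0 : ℝ) ∈ Icc (G (-G (G 0)) - -G (G 0)) (G 0 - 0) :=
    ⟨by rw [heven]; linarith, by linarith⟩
  obtain ⟨q, hq, hq0⟩ := intermediate_value_Icc' (by linarith : (0 : ℝ) ≤ -G (G 0))
    (hGc.sub continuous_id).continuousOn hmem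
  have hfix : G q = q := by simpa [sub_eq_zero] using hq0
  have hqpos : 0 < q := by
    refine lt_of_le_of_ne hq.1 ?_
    rintro rfl
    linarith
  refine two_le_gr_pow ha (M := 2 * M) (by omega) hqpos ?_ hσ ?_ ?_
  · refine hq.2.trans ?_
    have := mem_Ia.1 (iterate_mem ha (zero_mem a) (2 * M))
    rw [hGG]
    refine (neg_le_abs _).trans ?_
    rwa [abs_mul, hσ, one_mul]
  · have : G (G q) = q := by rw [hfix, hfix]
    rw [hGG] at this
    calc (fa a)^[2 * M] q = σ * σ * (fa a)^[2 * M] q := by rw [hσ2, one_mul]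
      _ = σ * q := by rw [mul_assoc, this]
  · rw [← hGG]; linarith [hq.2]

theorem iterate_mem_uIcc {a : ℝ} {n : ℕ} {x y z : ℝ} (H : itin a n x = itin a n y)
    (hz : z ∈ uIcc x y) {i : ℕ} (hi : i ≤ n) :
    (fa a)^[i] z ∈ uIcc ((fa a)^[i] x) ((fa a)^[i] y) := by
  induction i with
  | zero => simpa using hz
  | succ i ih =>
    have h1 := ih (by omega)
    have h2 := itin_eq_iff.1 H i (by omega)
    simp only [iterate_succ_fa]
    rw [mem_uIcc] at h1 ⊢
    by_cases hx : (fa a)^[i] x < 0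
    · have hy := h2.1 hx
      rcases h1 with h | h
      · right; constructor <;> nlinarith
      · left; constructor <;> nlinarith
    · have hy : ¬ (fa a)^[i] y < 0 := fun h => hx (h2.2 h)
      rw [not_lt] at hx hy
      rcases h1 with h | h
      · left; constructor <;> nlinarith
      · right; constructor <;> nlinarith

theorem itin_eq_of_mem_uIcc {a : ℝ} {n : ℕ} {x y z : ℝ} (H : itin a n x = itin a n y)
    (hz : z ∈ uIcc x y) : itin a n z = itin a n x := by
  rw [itin_eq_iff]
  intro i hi
  have h1 := iterate_mem_uIcc H hz hi.le
  have h2 := itin_eq_iff.1 H i hi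
  rw [mem_uIcc] at h1
  constructor
  · intro h
    by_contra hx
    have hy : ¬ (fa a)^[i] y < 0 := fun h => hx (h2.2 h)
    rw [not_lt] at hx hy
    rcases h1 with h' | h' <;> linarith
  · intro hx
    have hy := h2.1 hx
    rcases h1 with h' | h' <;> linarith

/-- The number of preimages of the turning point under `(fa a)^[n]` in the invariant interval,
up to `x`. -/
noncomputable def zc (a : ℝ) (n : ℕ) (x : ℝ) : ℕ := {y | y ∈ Ia a ∧ y ≤ x ∧ (fa a)^[n] y = 0}.ncard

theorem finite_zc (a : ℝ) (n : ℕ) (p : ℝ → Prop) : {y | p y ∧ (fa a)^[n] y = 0}.Finite :=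
  (finite_preimage_iterate a 0 n).subset fun _ hy => hy.2

theorem finite_zc' (a : ℝ) (n : ℕ) (p q : ℝ → Prop) :
    {y | p y ∧ q y ∧ (fa a)^[n] y = 0}.Finite :=
  (finite_preimage_iterate a 0 n).subset fun _ hy => hy.2.2

theorem zc_mono (a : ℝ) (n : ℕ) : Monotone (zc a n) := fun _ _ hxy =>
  ncard_le_ncard (fun _ hz => ⟨hz.1, hz.2.1.trans hxy, hz.2.2⟩) (finite_zc' a n _ _)

theorem zc_bt (a : ℝ) (n : ℕ) : zc a n (bt a) = {y | y ∈ Ia a ∧ (fa a)^[n] y = 0}.ncard := by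
  unfold zc
  congr 1
  ext y
  simp only [mem_ofPred_eq, mem_Ia]
  exact ⟨fun h => ⟨h.1, h.2.2⟩, fun h => ⟨h.1, (abs_le.1 h.1).2, h.2⟩⟩

theorem zc_le_bt (a : ℝ) (n : ℕ) (x : ℝ) : zc a n x ≤ zc a n (bt a) := by
  rw [zc_bt]
  exact ncard_le_ncard (fun y hy => ⟨hy.1, hy.2.2⟩) (finite_zc a n _)

theorem zc_bt_le_wd (a : ℝ) (n : ℕ) : zc a n (bt a) ≤ wd a n := by
  have hinj : InjOn (itin a n) {y | y ∈ Ia a ∧ (fa a)^[n] y = 0} := fun x hx y hy hxy =>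
    iterate_injOn_of_itin hxy (hx.2.trans hy.2.symm)
  rw [zc_bt, ← hinj.ncard_image, wd]
  exact ncard_le_ncard (image_mono fun y hy => hy.1) (finite_itin_image a n _)

theorem wd_succ_le {a : ℝ} (n : ℕ) : wd a (n + 1) ≤ wd a n + zc a n (bt a) := by
  set A := itin a n '' {x | x ∈ Ia a ∧ (fa a)^[n] x < 0} with hA
  set B := itin a n '' {x | x ∈ Ia a ∧ ¬ (fa a)^[n] x < 0} with hB
  have hsplit : itin a (n + 1) '' Ia a =
      itin a (n + 1) '' {x | x ∈ Ia a ∧ (fa a)^[n] x < 0} ∪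
      itin a (n + 1) '' {x | x ∈ Ia a ∧ ¬ (fa a)^[n] x < 0} := by
    rw [← image_union]
    congr 1
    ext x
    simp only [mem_union, mem_ofPred_eq]
    tauto
  have hsucc : ∀ x y, itin a n x = itin a n y → ((fa a)^[n] x < 0 ↔ (fa a)^[n] y < 0) →
      itin a (n + 1) x = itin a (n + 1) y := by
    intro x y h1 h2
    rw [itin_eq_iff] at *
    intro i hi
    rcases (Nat.lt_succ_iff.1 hi).lt_or_eq with h | rfl
    · exact h1 i h
    · exact h2
  have h1 : wd a (n + 1) ≤ A.ncard + B.ncard := by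
    rw [wd, hsplit]
    refine (ncard_union_le _ _).trans (add_le_add ?_ ?_)
    · exact ncard_image_le_of_factors (finite_itin_image a n _) fun x hx y hy hxy =>
        hsucc x y hxy (iff_of_true hx.2 hy.2)
    · exact ncard_image_le_of_factors (finite_itin_image a n _) fun x hx y hy hxy =>
        hsucc x y hxy (iff_of_false hx.2 hy.2)
  have h2 := ncard_union_add_ncard_inter A B (finite_itin_image a n _) (finite_itin_image a n _)
  have h3 : (A ∪ B).ncard ≤ wd a n := by
    refine ncard_le_ncard ?_ (finite_itin_image a n _)
    rw [hA, hB, ← image_union]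
    refine image_mono ?_
    rintro x (hx | hx) <;> exact hx.1
  have h4 : (A ∩ B).ncard ≤ zc a n (bt a) := by
    rw [zc_bt]
    refine (ncard_le_ncard (t := itin a n '' {y | y ∈ Ia a ∧ (fa a)^[n] y = 0}) ?_
      (finite_itin_image a n _)).trans (ncard_image_le (finite_zc a n _))
    rintro _ ⟨⟨x, hx, rfl⟩, ⟨y, hy, hxy⟩⟩
    have hmem : ∃ z ∈ uIcc x y, (fa a)^[n] z = 0 := by
      rcases le_total x y with h | h
      · rw [uIcc_of_le h]
        exact exists_zero_of_sign_ne n h fun h' => hy.2 (h'.1 hx.2)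
      · rw [uIcc_of_ge h]
        exact exists_zero_of_sign_ne n h fun h' => hy.2 (h'.2 hx.2)
    obtain ⟨z, hz, hz0⟩ := hmem
    refine ⟨z, ⟨?_, hz0⟩, itin_eq_of_mem_uIcc hxy.symm hz⟩
    have hx1 := hx.1
    have hy1 := hy.1
    rw [Ia_eq] at hx1 hy1 ⊢
    exact uIcc_subset_Icc hx1 hy1 hz
  omega

theorem zc_eq_add (a : ℝ) (n : ℕ) {u v : ℝ} (huv : u ≤ v) :
    zc a n v = zc a n u + {y | (y ∈ Ia a ∧ u < y ∧ y ≤ v) ∧ (fa a)^[n] y = 0}.ncard := by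
  rw [zc, zc, ← ncard_union_eq _ (finite_zc' a n _ _) (finite_zc a n _)]
  · congr 1
    ext y
    simp only [mem_union, mem_ofPred_eq]
    constructor
    · rintro ⟨h1, h2, h3⟩
      rcases le_or_gt y u with h | h
      · exact Or.inl ⟨h1, h, h3⟩
      · exact Or.inr ⟨⟨h1, h, h2⟩, h3⟩
    · rintro (⟨h1, h2, h3⟩ | ⟨⟨h1, h, h2⟩, h3⟩)
      · exact ⟨h1, h2.trans huv, h3⟩
      · exact ⟨h1, h2, h3⟩
  · rw [disjoint_left]
    rintro y ⟨_, h2, _⟩ ⟨⟨_, h, _⟩, _⟩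
    linarith

theorem zc_succ_sub {a : ℝ} (ha : a ∈ Icc (-2 : ℝ) (1 / 4)) (n : ℕ) {x : ℝ} (hx0 : 0 ≤ x)
    (hx : x ≤ bt a) :
    (zc a (n + 1) x : ℝ) - zc a (n + 1) 0 = zc a n (fa a x) - zc a n a := by
  have h1 := zc_eq_add a (n + 1) hx0
  have hax : a ≤ fa a x := by rw [fa_apply]; nlinarith
  have h2 := zc_eq_add a n hax
  have h3 : {y | (y ∈ Ia a ∧ a < y ∧ y ≤ fa a x) ∧ (fa a)^[n] y = 0} =
      fa a '' {y | (y ∈ Ia a ∧ 0 < y ∧ y ≤ x) ∧ (fa a)^[n + 1] y = 0} := by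
    ext y
    simp only [mem_ofPred_eq, mem_image]
    constructor
    · rintro ⟨⟨hy, hay, hyx⟩, hy0⟩
      have hs : √(y - a) ^ 2 = y - a := Real.sq_sqrt (by linarith)
      have hfs : fa a √(y - a) = y := by rw [fa_apply, hs]; ring
      have hle : √(y - a) ≤ x := by
        rw [fa_apply] at hyx
        exact Real.sqrt_le_iff.2 ⟨hx0, by linarith⟩
      have hpos : 0 < √(y - a) := Real.sqrt_pos.2 (by linarith)
      refine ⟨√(y - a), ⟨⟨?_, hpos, hle⟩, ?_⟩, hfs⟩
      · rw [mem_Ia, abs_of_pos hpos]; linarith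
      · rw [Function.iterate_succ_apply, hfs, hy0]
    · rintro ⟨y, ⟨⟨hy, hy0, hyx⟩, hz⟩, rfl⟩
      refine ⟨⟨mapsTo_fa ha hy, ?_, ?_⟩, ?_⟩
      · rw [fa_apply]; nlinarith
      · rw [fa_apply, fa_apply]; nlinarith
      · rwa [Function.iterate_succ_apply] at hz
  have h4 : InjOn (fa a) {y | (y ∈ Ia a ∧ 0 < y ∧ y ≤ x) ∧ (fa a)^[n + 1] y = 0} := by
    intro y hy z hz hyz
    rw [fa_apply, fa_apply] at hyz
    have h5 := hy.1.2.1
    have h6 := hz.1.2.1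
    nlinarith [sq_nonneg (y - z), mul_pos h5 h6]
  rw [h3, h4.ncard_image] at h2
  rw [h1, h2]
  push_cast
  ring

theorem zc_zero_of_nonneg {a : ℝ} {x : ℝ} (hx : 0 ≤ x) : zc a 0 x = zc a 0 0 := by
  unfold zc
  congr 1
  ext y
  simp only [mem_ofPred_eq, Function.iterate_zero, id]
  constructor
  · rintro ⟨h1, h2, h3⟩; exact ⟨h1, h3.le, h3⟩
  · rintro ⟨h1, h2, h3⟩; exact ⟨h1, by linarith, h3⟩

theorem zc_add_neg {a : ℝ} {n : ℕ} (hn : n ≠ 0) (x : ℝ) :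
    zc a n (bt a) ≤ zc a n x + zc a n (-x) ∧ zc a n x + zc a n (-x) ≤ zc a n (bt a) + 1 := by
  have h1 : zc a n (-x) = {y | y ∈ Ia a ∧ x ≤ y ∧ (fa a)^[n] y = 0}.ncard := by
    rw [zc, ← neg_injective.injOn.ncard_image]
    congr 1
    ext y
    simp only [mem_ofPred_eq, mem_image, mem_Ia]
    constructor
    · rintro ⟨z, ⟨hz1, hz2, hz3⟩, rfl⟩
      exact ⟨by rwa [abs_neg], by linarith, by rw [iterate_fa_neg a z hn, hz3]⟩
    · rintro ⟨hz1, hz2, hz3⟩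
      exact ⟨-y, ⟨by rwa [abs_neg], by linarith, by rw [iterate_fa_neg a y hn, hz3]⟩, neg_neg y⟩
  have h2 := ncard_union_add_ncard_inter {y | y ∈ Ia a ∧ y ≤ x ∧ (fa a)^[n] y = 0}
    {y | y ∈ Ia a ∧ x ≤ y ∧ (fa a)^[n] y = 0} (finite_zc' a n _ _) (finite_zc' a n _ _)
  have h3 : {y | y ∈ Ia a ∧ y ≤ x ∧ (fa a)^[n] y = 0} ∪ {y | y ∈ Ia a ∧ x ≤ y ∧ (fa a)^[n] y = 0} =
      {y | y ∈ Ia a ∧ (fa a)^[n] y = 0} := by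
    ext y
    simp only [mem_union, mem_ofPred_eq]
    have := le_total y x
    tauto
  have h4 : ({y | y ∈ Ia a ∧ y ≤ x ∧ (fa a)^[n] y = 0} ∩
      {y | y ∈ Ia a ∧ x ≤ y ∧ (fa a)^[n] y = 0}).ncard ≤ 1 := by
    rw [ncard_le_one ((finite_zc' a n _ _).inter_of_left _)]
    rintro y ⟨⟨_, h5, _⟩, ⟨_, h6, _⟩⟩ z ⟨⟨_, h7, _⟩, ⟨_, h8, _⟩⟩
    linarith
  rw [h3, ← zc_bt, ← h1] at h2
  change _ = zc a n x + _ at h2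
  omega

theorem abs_zc_add_neg_le {a : ℝ} (n : ℕ) (x : ℝ) :
    |((zc a n x : ℝ) - zc a n 0) + ((zc a n (-x) : ℝ) - zc a n 0)| ≤ 2 := by
  rcases eq_or_ne n 0 with rfl | hn
  · have hle : ∀ y, zc a 0 y ≤ 1 := by
      intro y
      rw [zc, ncard_le_one (finite_zc' a 0 _ _)]
      rintro y ⟨_, _, h⟩ z ⟨_, _, h'⟩
      exact h.trans h'.symm
    have h1 : (zc a 0 x : ℝ) ≤ 1 := by exact_mod_cast hle x
    have h2 : (zc a 0 (-x) : ℝ) ≤ 1 := by exact_mod_cast hle (-x)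
    have h3 : (zc a 0 0 : ℝ) ≤ 1 := by exact_mod_cast hle 0
    have h4 : (0 : ℝ) ≤ zc a 0 x := by positivity
    have h5 : (0 : ℝ) ≤ zc a 0 (-x) := by positivity
    have h6 : (0 : ℝ) ≤ zc a 0 0 := by positivity
    rw [abs_le]; constructor <;> linarith
  · have h1 := zc_add_neg (a := a) hn x
    have h2 := zc_add_neg (a := a) hn 0
    rw [neg_zero] at h2
    have h3 : (zc a n (bt a) : ℝ) ≤ zc a n x + zc a n (-x) := by exact_mod_cast h1.1
    have h4 : (zc a n x : ℝ) + zc a n (-x) ≤ zc a n (bt a) + 1 := by exact_mod_cast h1.2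
    have h5 : (zc a n (bt a) : ℝ) ≤ zc a n 0 + zc a n 0 := by exact_mod_cast h2.1
    have h6 : (zc a n 0 : ℝ) + zc a n 0 ≤ zc a n (bt a) + 1 := by exact_mod_cast h2.2
    rw [abs_le]; constructor <;> linarith

theorem summable_wd {a : ℝ} (ha : a ∈ Icc (-2 : ℝ) (1 / 4)) {t : ℝ} (ht0 : 0 < t)
    (ht : t < (gr a)⁻¹) : Summable fun n => t ^ n * (wd a n : ℝ) := by
  have hg : gr a < t⁻¹ := by
    rwa [lt_inv_comm₀ (by linarith [one_le_gr a]) ht0]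
  obtain ⟨r, hr, hr'⟩ := exists_between hg
  have hr0 : 0 < r := by linarith [one_le_gr a]
  have htr : t * r < 1 := by
    rw [lt_inv_comm₀ hr0 ht0] at hr'
    calc t * r < r⁻¹ * r := by gcongr
      _ = 1 := inv_mul_cancel₀ hr0.ne'
  refine summable_of_isBigO_nat (summable_geometric_of_lt_one (by positivity) htr) ?_
  refine Asymptotics.IsBigO.of_bound 1 ?_
  filter_upwards [eventually_wd_le_pow ha hr] with n hn
  rw [one_mul, mul_pow, Real.norm_of_nonneg (by positivity), Real.norm_of_nonneg (by positivity)]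
  gcongr

/-- The Abel sum of the number of preimages of the turning point. -/
noncomputable def zSum (a t : ℝ) : ℝ := ∑' n, t ^ n * (zc a n (bt a) : ℝ)

/-- The Abel sum of the signed number of preimages of the turning point between `0` and `x`. -/
noncomputable def aSum (a t x : ℝ) : ℝ := ∑' n, t ^ n * ((zc a n x : ℝ) - zc a n 0)

theorem summable_zc {a : ℝ} (ha : a ∈ Icc (-2 : ℝ) (1 / 4)) {t : ℝ} (ht0 : 0 < t)
    (ht : t < (gr a)⁻¹) (x : ℝ) : Summable fun n => t ^ n * (zc a n x : ℝ) := by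
  refine (summable_wd ha ht0 ht).of_nonneg_of_le (fun n => by positivity) fun n => ?_
  gcongr
  exact (zc_le_bt a n x).trans (zc_bt_le_wd a n)

theorem summable_aSum {a : ℝ} (ha : a ∈ Icc (-2 : ℝ) (1 / 4)) {t : ℝ} (ht0 : 0 < t)
    (ht : t < (gr a)⁻¹) (x : ℝ) : Summable fun n => t ^ n * ((zc a n x : ℝ) - zc a n 0) := by
  simpa [mul_sub] using (summable_zc ha ht0 ht x).sub (summable_zc ha ht0 ht 0)

theorem zSum_ge {a : ℝ} (ha : a ∈ Icc (-2 : ℝ) (1 / 4)) {t : ℝ} (ht0 : 0 < t)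
    (ht : t < (gr a)⁻¹) : (gr a - 1) / (1 - gr a * t) ≤ zSum a t := by
  have hs := one_le_gr a
  have hst : gr a * t < 1 := by
    calc gr a * t < gr a * (gr a)⁻¹ := by gcongr
      _ = 1 := mul_inv_cancel₀ (by positivity)
  have hw := summable_wd ha ht0 ht
  have hz := summable_zc ha ht0 ht (bt a)
  set W := ∑' n, t ^ n * (wd a n : ℝ) with hW
  have h1 : (1 - gr a * t)⁻¹ ≤ W := by
    rw [← tsum_geometric_of_lt_one (by positivity) hst]
    refine (summable_geometric_of_lt_one (by positivity) hst).tsum_le_tsum (fun n => ?_) hw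
    rw [mul_pow, mul_comm]
    gcongr
    exact gr_pow_le_wd ha n
  have h2 : W ≤ 1 + t * (W + zSum a t) := by
    have hw0 : wd a 0 ≤ 1 := by
      refine (ncard_le_one (finite_itin_image a 0 _)).2 ?_
      rintro _ ⟨x, -, rfl⟩ _ ⟨y, -, rfl⟩
      simp [itin]
    have hw0' : (wd a 0 : ℝ) ≤ 1 := by exact_mod_cast hw0
    have hW0 : W = t ^ 0 * (wd a 0 : ℝ) + ∑' n, t ^ (n + 1) * (wd a (n + 1) : ℝ) :=
      hw.tsum_eq_zero_add
    rw [pow_zero, one_mul] at hW0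
    suffices ∑' n, t ^ (n + 1) * (wd a (n + 1) : ℝ) ≤ t * (W + zSum a t) by linarith
    rw [zSum, hW, ← hw.tsum_add hz, ← tsum_mul_left]
    refine ((summable_nat_add_iff 1).2 hw).tsum_le_tsum (fun n => ?_) ((hw.add hz).mul_left t)
    have : (wd a (n + 1) : ℝ) ≤ wd a n + zc a n (bt a) := by exact_mod_cast wd_succ_le n
    rw [pow_succ]
    calc t ^ n * t * (wd a (n + 1) : ℝ) ≤ t ^ n * t * (wd a n + zc a n (bt a)) := by gcongr
      _ = _ := by ring
  have h3 : 0 < 1 - gr a * t := by linarith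
  rw [div_le_iff₀ h3]
  have ht1 : t ≤ 1 := by nlinarith
  have h4 : 1 ≤ W * (1 - gr a * t) := by
    rw [inv_le_iff_one_le_mul₀ h3] at h1
    linarith
  have h5 : t * (gr a - 1) ≤ t * (zSum a t * (1 - gr a * t)) := by nlinarith
  exact le_of_mul_le_mul_left h5 ht0

theorem tendsto_zSum {a : ℝ} (ha : a ∈ Icc (-2 : ℝ) (1 / 4)) (hs : 1 < gr a) :
    Tendsto (zSum a) (nhdsWithin (gr a)⁻¹ (Iio (gr a)⁻¹)) atTop := by
  have hg : 0 < gr a := by linarith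
  have hev : ∀ᶠ t in nhdsWithin (gr a)⁻¹ (Iio (gr a)⁻¹), 0 < t ∧ t < (gr a)⁻¹ :=
    ((lt_mem_nhds (inv_pos.2 hg)).filter_mono nhdsWithin_le_nhds).and self_mem_nhdsWithin
  refine tendsto_atTop_mono' _ (f₁ := fun t => (gr a - 1) / (1 - gr a * t)) ?_ ?_
  · filter_upwards [hev] with t ht using zSum_ge ha ht.1 ht.2
  · have h1 : Tendsto (fun t => 1 - gr a * t) (nhdsWithin (gr a)⁻¹ (Iio (gr a)⁻¹))
        (nhdsWithin 0 (Ioi 0)) := by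
      refine tendsto_nhdsWithin_iff.2 ⟨?_, ?_⟩
      · have : Continuous fun t => 1 - gr a * t := by fun_prop
        have h2 := this.tendsto (gr a)⁻¹
        rw [mul_inv_cancel₀ hg.ne', sub_self] at h2
        exact h2.mono_left nhdsWithin_le_nhds
      · filter_upwards [self_mem_nhdsWithin] with t ht
        have : gr a * t < gr a * (gr a)⁻¹ := by gcongr; exact ht
        rw [mul_inv_cancel₀ hg.ne'] at this
        exact sub_pos.2 this
    exact (tendsto_inv_nhdsGT_zero.comp h1).const_mul_atTop (sub_pos.2 hs)

theorem aSum_fa {a : ℝ} (ha : a ∈ Icc (-2 : ℝ) (1 / 4)) {t : ℝ} (ht0 : 0 < t)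
    (ht : t < (gr a)⁻¹) {x : ℝ} (hx0 : 0 ≤ x) (hx : x ≤ bt a) :
    aSum a t (fa a x) = aSum a t a + t⁻¹ * aSum a t x := by
  have h1 : aSum a t x = t * (aSum a t (fa a x) - aSum a t a) := by
    conv_lhs => rw [aSum, (summable_aSum ha ht0 ht x).tsum_eq_zero_add]
    rw [zc_zero_of_nonneg hx0, sub_self, mul_zero, zero_add, aSum, aSum,
      ← (summable_aSum ha ht0 ht _).tsum_sub (summable_aSum ha ht0 ht _), ← tsum_mul_left]
    refine tsum_congr fun n => ?_
    rw [zc_succ_sub ha n hx0 hx, pow_succ]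
    ring
  rw [h1]
  field_simp
  ring

theorem abs_aSum_add_neg_le {a : ℝ} (ha : a ∈ Icc (-2 : ℝ) (1 / 4)) {t : ℝ} (ht0 : 0 < t)
    (ht : t < (gr a)⁻¹) (ht1 : t < 1) (x : ℝ) :
    |aSum a t x + aSum a t (-x)| ≤ 2 * (1 - t)⁻¹ := by
  have hgeo := summable_geometric_of_lt_one ht0.le ht1
  rw [aSum, aSum, ← (summable_aSum ha ht0 ht _).tsum_add (summable_aSum ha ht0 ht _),
    ← tsum_geometric_of_lt_one ht0.le ht1, ← tsum_mul_left]
  rw [← Real.norm_eq_abs]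
  refine tsum_of_norm_bounded (hgeo.mul_left 2).hasSum fun n => ?_
  rw [← mul_add, norm_mul, norm_pow, Real.norm_of_nonneg ht0.le, mul_comm]
  gcongr
  exact abs_zc_add_neg_le n x

theorem aSum_mono {a : ℝ} (ha : a ∈ Icc (-2 : ℝ) (1 / 4)) {t : ℝ} (ht0 : 0 < t)
    (ht : t < (gr a)⁻¹) : Monotone (aSum a t) := by
  intro x y hxy
  refine (summable_aSum ha ht0 ht _).tsum_le_tsum (fun n => ?_) (summable_aSum ha ht0 ht _)
  have : zc a n x ≤ zc a n y := zc_mono a n hxy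
  gcongr

theorem abs_aSum_le {a : ℝ} (ha : a ∈ Icc (-2 : ℝ) (1 / 4)) {t : ℝ} (ht0 : 0 < t)
    (ht : t < (gr a)⁻¹) (x : ℝ) : |aSum a t x| ≤ zSum a t := by
  rw [← Real.norm_eq_abs]
  refine tsum_of_norm_bounded (summable_zc ha ht0 ht (bt a)).hasSum fun n => ?_
  rw [norm_mul, norm_pow, Real.norm_of_nonneg ht0.le]
  gcongr
  have h1 : (zc a n x : ℝ) ≤ zc a n (bt a) := by exact_mod_cast zc_le_bt a n x
  have h2 : (zc a n 0 : ℝ) ≤ zc a n (bt a) := by exact_mod_cast zc_le_bt a n 0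
  have h3 : (0 : ℝ) ≤ zc a n 0 := by positivity
  have h4 : (0 : ℝ) ≤ zc a n x := by positivity
  rw [Real.norm_eq_abs, abs_le]
  constructor <;> linarith

theorem zSum_le_aSum {a : ℝ} (ha : a ∈ Icc (-2 : ℝ) (1 / 4)) {t : ℝ} (ht0 : 0 < t)
    (ht : t < (gr a)⁻¹) (ht1 : t < 1) : zSum a t ≤ 2 * aSum a t (bt a) + 3 * (1 - t)⁻¹ := by
  have h1 := (abs_le.1 (abs_aSum_add_neg_le ha ht0 ht ht1 (bt a))).1
  have h2 : zSum a t ≤ aSum a t (bt a) - aSum a t (-bt a) + (1 - t)⁻¹ := by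
    have hgeo := summable_geometric_of_lt_one ht0.le ht1
    rw [aSum, aSum, ← (summable_aSum ha ht0 ht _).tsum_sub (summable_aSum ha ht0 ht _),
      ← tsum_geometric_of_lt_one ht0.le ht1,
      ← ((summable_aSum ha ht0 ht _).sub (summable_aSum ha ht0 ht _)).tsum_add hgeo]
    refine (summable_zc ha ht0 ht (bt a)).tsum_le_tsum (fun n => ?_)
      (((summable_aSum ha ht0 ht _).sub (summable_aSum ha ht0 ht _)).add hgeo)
    have h3 : zc a n (-bt a) ≤ 1 := by
      rw [zc, ncard_le_one (finite_zc' a n _ _)]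
      rintro y ⟨hy, hy', _⟩ z ⟨hz, hz', _⟩
      have h4 := (abs_le.1 (mem_Ia.1 hy)).1
      have h5 := (abs_le.1 (mem_Ia.1 hz)).1
      linarith
    have h3' : (zc a n (-bt a) : ℝ) ≤ 1 := by exact_mod_cast h3
    have h6 := pow_pos ht0 n
    nlinarith
  linarith

/-- The semiconjugacy of a quadratic map of positive entropy with a tent-like map of slope
`exp h`, normalized to vanish at the turning point. -/
theorem exists_semiconj {a : ℝ} (ha : a ∈ Icc (-2 : ℝ) (1 / 4)) (hs : 1 < gr a) :
    ∃ l : ℝ → ℝ, Monotone l ∧ (∀ x, l (-x) = -l x) ∧ 0 < l (bt a) ∧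
      ∀ x ∈ Ia a, l (fa a x) = l a + gr a * |l x| := by
  have hg : 0 < gr a := by linarith
  set U := Ultrafilter.of (nhdsWithin (gr a)⁻¹ (Iio (gr a)⁻¹)) with hU
  have hUle : (U : Filter ℝ) ≤ nhdsWithin (gr a)⁻¹ (Iio (gr a)⁻¹) := Ultrafilter.of_le _
  have hev : ∀ᶠ t in (U : Filter ℝ), 0 < t ∧ t < (gr a)⁻¹ :=
    (((lt_mem_nhds (inv_pos.2 hg)).filter_mono nhdsWithin_le_nhds).and
      self_mem_nhdsWithin).filter_mono hUle
  have hinv1 : (gr a)⁻¹ < 1 := inv_lt_one_of_one_lt₀ hs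
  have hZ : Tendsto (zSum a) U atTop := (tendsto_zSum ha hs).mono_left hUle
  have hid : Tendsto (fun t : ℝ => t) U (nhds (gr a)⁻¹) := hUle.trans nhdsWithin_le_nhds
  have hZpos : ∀ᶠ t in (U : Filter ℝ), 0 < zSum a t := hZ.eventually_gt_atTop 0
  have hlim : ∀ x, ∃ y, Tendsto (fun t => aSum a t x / zSum a t) U (nhds y) := by
    intro x
    have hmem : ∀ᶠ t in (U : Filter ℝ), aSum a t x / zSum a t ∈ Icc (-1 : ℝ) 1 := by
      filter_upwards [hev, hZpos] with t ht hz
      have := abs_aSum_le ha ht.1 ht.2 x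
      rwa [mem_Icc, ← abs_le, abs_div, abs_of_pos hz, div_le_one hz]
    obtain ⟨y, -, hy⟩ := isCompact_Icc.ultrafilter_le_nhds
      (U.map fun t => aSum a t x / zSum a t) (le_principal_iff.2 hmem)
    exact ⟨y, hy⟩
  choose l hl using hlim
  have herr : ∀ c : ℝ, Tendsto (fun t => c * (1 - t)⁻¹ / zSum a t) U (nhds 0) := by
    intro c
    refine Tendsto.div_atTop (a := c * (1 - (gr a)⁻¹)⁻¹) ?_ hZ
    exact ((tendsto_const_nhds.sub hid).inv₀ (by linarith)).const_mul c
  have hodd : ∀ x, l (-x) = -l x := by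
    intro x
    have h1 : Tendsto (fun t => aSum a t x / zSum a t + aSum a t (-x) / zSum a t) U (nhds 0) := by
      refine squeeze_zero_norm' ?_ (herr 2)
      filter_upwards [hev, hZpos] with t ht hz
      rw [← add_div, norm_div, Real.norm_eq_abs, Real.norm_of_nonneg hz.le]
      gcongr
      exact abs_aSum_add_neg_le ha ht.1 ht.2 (by linarith) x
    have h2 := tendsto_nhds_unique h1 ((hl x).add (hl (-x)))
    linarith
  have hpos : ∀ x ∈ Icc 0 (bt a), l (fa a x) = l a + gr a * l x := by
    intro x hx
    refine tendsto_nhds_unique (hl (fa a x)) ?_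
    have h1 := (hl a).add ((hid.inv₀ (inv_ne_zero hg.ne')).mul (hl x))
    rw [inv_inv] at h1
    refine h1.congr' ?_
    filter_upwards [hev] with t ht
    rw [aSum_fa ha ht.1 ht.2 hx.1 hx.2]
    ring
  have hmono : Monotone l := by
    intro x y hxy
    refine le_of_tendsto_of_tendsto (hl x) (hl y) ?_
    filter_upwards [hev, hZpos] with t ht hz
    exact div_le_div_of_nonneg_right (aSum_mono ha ht.1 ht.2 hxy) hz.le
  have hl0 : l 0 = 0 := by
    have := hodd 0
    rw [neg_zero] at this
    linarith
  refine ⟨l, hmono, hodd, ?_, ?_⟩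
  · have h1 := ((hl (bt a)).const_mul 2).add (herr 3)
    have h2 : (1 : ℝ) ≤ 2 * l (bt a) + 0 := by
      refine ge_of_tendsto h1 ?_
      filter_upwards [hev, hZpos] with t ht hz
      have := zSum_le_aSum ha ht.1 ht.2 (by linarith)
      rw [← mul_div_assoc, ← add_div, one_le_div hz]
      exact this
    linarith
  · intro x hx
    rw [mem_Ia] at hx
    rcases le_total 0 x with h | h
    · rw [abs_of_nonneg (by rw [← hl0]; exact hmono h)]
      exact hpos x ⟨h, (le_abs_self x).trans hx⟩
    · have h1 := hpos (-x) ⟨by linarith, (neg_le_abs x).trans hx⟩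
      have h2 : fa a (-x) = fa a x := by rw [fa_apply, fa_apply, neg_sq]
      rw [h2, hodd] at h1
      rw [abs_of_nonpos (by rw [← hl0]; exact hmono h)]
      exact h1

/-- `φ` does not increase cross-ratios on `[A, B]`. -/
def CrossRatio (φ : ℝ → ℝ) (A B : ℝ) : Prop :=
  ∀ x₁ x₂ x₃ x₄, A ≤ x₁ → x₁ < x₂ → x₂ < x₃ → x₃ < x₄ → x₄ ≤ B →
    (φ x₂ - φ x₁) * (φ x₄ - φ x₃) * ((x₃ - x₁) * (x₄ - x₂)) ≤
      (x₂ - x₁) * (x₄ - x₃) * ((φ x₃ - φ x₁) * (φ x₄ - φ x₂))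

theorem crossRatio_id (A B : ℝ) : CrossRatio (fun x => x) A B := by
  intro x₁ x₂ x₃ x₄ _ _ _ _ _
  exact le_rfl

theorem CrossRatio.comp {φ ψ : ℝ → ℝ} {A B A' B' : ℝ} (hφ : CrossRatio φ A B)
    (hmφ : StrictMonoOn φ (Icc A B)) (hmaps : MapsTo φ (Icc A B) (Icc A' B'))
    (hψ : CrossRatio ψ A' B') (hmψ : StrictMonoOn ψ (Icc A' B')) :
    CrossRatio (fun x => ψ (φ x)) A B := by
  intro x₁ x₂ x₃ x₄ h1 h2 h3 h4 h5
  have m1 : x₁ ∈ Icc A B := ⟨h1, by linarith⟩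
  have m2 : x₂ ∈ Icc A B := ⟨by linarith, by linarith⟩
  have m3 : x₃ ∈ Icc A B := ⟨by linarith, by linarith⟩
  have m4 : x₄ ∈ Icc A B := ⟨by linarith, h5⟩
  have k12 := hmφ m1 m2 h2
  have k23 := hmφ m2 m3 h3
  have k34 := hmφ m3 m4 h4
  have e1 := hψ _ _ _ _ (hmaps m1).1 k12 k23 k34 (hmaps m4).2
  have e2 := hφ x₁ x₂ x₃ x₄ h1 h2 h3 h4 h5
  have p12 := hmψ (hmaps m1) (hmaps m2) k12
  have p23 := hmψ (hmaps m2) (hmaps m3) k23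
  have p34 := hmψ (hmaps m3) (hmaps m4) k34
  have hX : 0 < (x₃ - x₁) * (x₄ - x₂) := mul_pos (by linarith) (by linarith)
  have hK : 0 < (φ x₃ - φ x₁) * (φ x₄ - φ x₂) := mul_pos (by linarith) (by linarith)
  have hR : 0 < (ψ (φ x₃) - ψ (φ x₁)) * (ψ (φ x₄) - ψ (φ x₂)) := mul_pos (by linarith) (by linarith)
  refine le_of_mul_le_mul_right ?_ hK
  have f1 := mul_le_mul_of_nonneg_right e1 hX.le
  have f2 := mul_le_mul_of_nonneg_right e2 hR.le
  linarith

theorem CrossRatio.neg_comp_sq {Φ : ℝ → ℝ} {a P l : ℝ} (hla : l ≤ a)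
    (hΦ : CrossRatio Φ l (a + P ^ 2)) (hm : StrictMonoOn Φ (Icc l (a + P ^ 2))) :
    CrossRatio (fun u => -Φ (u ^ 2 + a)) (-P) 0 ∧
      StrictMonoOn (fun u => -Φ (u ^ 2 + a)) (Icc (-P) 0) := by
  have hmem : ∀ u ∈ Icc (-P) 0, u ^ 2 + a ∈ Icc l (a + P ^ 2) := by
    intro u hu
    constructor
    · nlinarith
    · nlinarith [hu.1, hu.2]
  have hmono : StrictMonoOn (fun u => -Φ (u ^ 2 + a)) (Icc (-P) 0) := by
    intro u hu v hv huv
    refine neg_lt_neg (hm (hmem v hv) (hmem u hu) ?_)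
    nlinarith [hv.2]
  refine ⟨?_, hmono⟩
  intro u₁ u₂ u₃ u₄ h1 h2 h3 h4 h5
  have m1 : u₁ ∈ Icc (-P) 0 := ⟨h1, by linarith⟩
  have m2 : u₂ ∈ Icc (-P) 0 := ⟨by linarith, by linarith⟩
  have m3 : u₃ ∈ Icc (-P) 0 := ⟨by linarith, by linarith⟩
  have m4 : u₄ ∈ Icc (-P) 0 := ⟨by linarith, h5⟩
  have e := hΦ (u₄ ^ 2 + a) (u₃ ^ 2 + a) (u₂ ^ 2 + a) (u₁ ^ 2 + a) (hmem u₄ m4).1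
    (by nlinarith) (by nlinarith) (by nlinarith) (hmem u₁ m1).2
  have p12 := hmono m1 m2 h2
  have p23 := hmono m2 m3 h3
  have p34 := hmono m3 m4 h4
  simp only at p12 p23 p34 ⊢
  have hR : 0 < (-Φ (u₃ ^ 2 + a) - -Φ (u₁ ^ 2 + a)) * (-Φ (u₄ ^ 2 + a) - -Φ (u₂ ^ 2 + a)) :=
    mul_pos (by linarith) (by linarith)
  have hK : 0 < (u₁ + u₃) * (u₂ + u₄) := mul_pos_of_neg_of_neg (by linarith) (by linarith)
  have hKle : (u₁ + u₂) * (u₃ + u₄) ≤ (u₁ + u₃) * (u₂ + u₄) := by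
    nlinarith [mul_pos (sub_pos.2 (h2.trans (h3.trans h4))) (sub_pos.2 h3)]
  have hY : 0 < (u₂ - u₁) * (u₄ - u₃) := mul_pos (by linarith) (by linarith)
  refine le_of_mul_le_mul_right ?_ hK
  have f := mul_le_mul_of_nonneg_left hKle (mul_pos hY hR).le
  linarith

/-- Geometric bounds for the first return map of a restrictive interval of radius `P`, written as
`x ↦ Φ (x ^ 2 + a)`. -/
structure Lvl (Φ : ℝ → ℝ) (a P l : ℝ) : Prop where
  pos : 0 < P
  left_lt : l < a
  cont : Continuous Φ
  mono : StrictMonoOn Φ (Icc l (a + P ^ 2))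
  cr : CrossRatio Φ l (a + P ^ 2)
  top : Φ (a + P ^ 2) = P
  bot : -P ≤ Φ a
  left : Φ l ≤ -(7 / 5) * P
  lip : ∀ y₁ y₂, a ≤ y₁ → y₁ ≤ y₂ → y₂ ≤ a + P ^ 2 → Φ y₂ - Φ y₁ ≤ 44 / P * (y₂ - y₁)

/-- The semiconjugacy `l` transports `x ↦ Φ (x ^ 2 + a)` to a tent map of slope `S` on `[-P, P]`. -/
structure LvlSemi (lam Φ : ℝ → ℝ) (a P S : ℝ) : Prop where
  mono : Monotone lam
  odd : ∀ x, lam (-x) = -lam x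
  pos : 0 < lam P
  one_lt : 1 < S
  eq : ∀ x, |x| ≤ P → lam (Φ (x ^ 2 + a)) = lam (Φ a) + S * |lam x|

/-- The consequences of `Lvl` and `LvlSemi` involving the orientation reversing fixed point. -/
structure LvlFix (lam Φ : ℝ → ℝ) (a P S ρ : ℝ) : Prop where
  lamc : lam (Φ a) = -((S - 1) * lam P)
  S_le : S ≤ 2
  rho_pos : 0 < ρ
  rho_lt : ρ < P
  fix : Φ (ρ ^ 2 + a) = -ρ
  lam_rho : lam ρ = (S - 1) / (S + 1) * lam P
  rho_lt_c : ρ < -Φ a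
  c_le : -Φ a ≤ P
  c2_pos : 0 < Φ ((Φ a) ^ 2 + a)
  lam_c2 : lam (Φ ((Φ a) ^ 2 + a)) = (S - 1) ^ 2 * lam P
  P_le : P ≤ 3872 * ρ

section
variable {lam Φ : ℝ → ℝ} {a P S l : ℝ}

theorem LvlSemi.zero (hs : LvlSemi lam Φ a P S) : lam 0 = 0 := by
  have := hs.odd 0
  rw [neg_zero] at this
  linarith

theorem sq_add_mem_Icc {x : ℝ} (hx : |x| ≤ P) : x ^ 2 + a ∈ Icc a (a + P ^ 2) := by
  rw [abs_le] at hx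
  constructor
  · nlinarith
  · nlinarith [hx.1, hx.2]

theorem Lvl.mono_abs (hL : Lvl Φ a P l) {x y : ℝ} (hxy : |x| ≤ |y|) (hy : |y| ≤ P) :
    Φ (x ^ 2 + a) ≤ Φ (y ^ 2 + a) := by
  have h1 := sq_add_mem_Icc (a := a) (hxy.trans hy)
  have h2 := sq_add_mem_Icc (a := a) hy
  have h3 : x ^ 2 ≤ y ^ 2 := sq_le_sq.2 hxy
  exact hL.mono.monotoneOn ⟨hL.left_lt.le.trans h1.1, h1.2⟩ ⟨hL.left_lt.le.trans h2.1, h2.2⟩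
    (by linarith)

theorem Lvl.abs_sub_le (hL : Lvl Φ a P l) {x y : ℝ} (hx : |x| ≤ P) (hy : |y| ≤ P) :
    |Φ (x ^ 2 + a) - Φ (y ^ 2 + a)| ≤ 44 / P * |x ^ 2 - y ^ 2| := by
  wlog hxy : |x| ≤ |y| generalizing x y
  · rw [abs_sub_comm, abs_sub_comm (x ^ 2)]
    exact this hy hx (not_le.1 hxy).le
  have h1 := hL.mono_abs hxy hy
  have h3 : x ^ 2 ≤ y ^ 2 := sq_le_sq.2 hxy
  have h2 := hL.lip (x ^ 2 + a) (y ^ 2 + a) (sq_add_mem_Icc hx).1 (by linarith) (sq_add_mem_Icc hy).2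
  rw [abs_sub_comm, abs_sub_comm (x ^ 2), abs_of_nonneg (by linarith), abs_of_nonneg (by linarith)]
  linarith

theorem Lvl.lipschitz (hL : Lvl Φ a P l) {x y : ℝ} (hx : |x| ≤ P) (hy : |y| ≤ P) :
    |Φ (x ^ 2 + a) - Φ (y ^ 2 + a)| ≤ 88 * |x - y| := by
  refine (hL.abs_sub_le hx hy).trans ?_
  have hP := hL.pos
  have h1 : |x ^ 2 - y ^ 2| ≤ 2 * P * |x - y| := by
    rw [show x ^ 2 - y ^ 2 = (x + y) * (x - y) by ring, abs_mul]
    gcongr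
    linarith [abs_add_le x y]
  calc 44 / P * |x ^ 2 - y ^ 2| ≤ 44 / P * (2 * P * |x - y|) := by gcongr
    _ = 88 * |x - y| := by field_simp; ring

theorem Lvl.abs_le (hL : Lvl Φ a P l) {x : ℝ} (hx : |x| ≤ P) : |Φ (x ^ 2 + a)| ≤ P := by
  have h1 := hL.mono_abs (x := 0) (y := x) (by simp) hx
  have h2 := hL.mono_abs (x := x) (y := P) (by rwa [abs_of_pos hL.pos]) (abs_of_pos hL.pos).le
  rw [add_comm (P ^ 2) a, hL.top] at h2
  rw [zero_pow two_ne_zero, zero_add] at h1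
  exact _root_.abs_le.2 ⟨hL.bot.trans h1, h2⟩

theorem Lvl.exists_fix (hL : Lvl Φ a P l) (hs : LvlSemi lam Φ a P S) :
    ∃ ρ, LvlFix lam Φ a P S ρ := by
  have hP := hL.pos
  have hlP := hs.pos
  have hS := hs.one_lt
  have hgP : Φ (P ^ 2 + a) = P := by rw [add_comm, hL.top]
  have hlamc : lam (Φ a) = -((S - 1) * lam P) := by
    have := hs.eq P (abs_of_pos hP).le
    rw [hgP, abs_of_pos hlP] at this
    linarith
  have hlt : ∀ {x y}, lam x < lam y → x < y := fun h => lt_of_not_ge fun h' =>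
    absurd (hs.mono h') (not_le.2 h)
  have hc0 : Φ a < 0 := hlt (by rw [hlamc, hs.zero]; nlinarith)
  have hS2 : S ≤ 2 := by
    have := hs.mono hL.bot
    rw [hs.odd, hlamc] at this
    nlinarith
  have hmem : (0 : ℝ) ∈ Icc (Φ (0 ^ 2 + a) + 0) (Φ (P ^ 2 + a) + P) := by
    rw [hgP, zero_pow two_ne_zero, zero_add]
    constructor <;> linarith
  obtain ⟨ρ, hρ, hρ0⟩ := intermediate_value_Icc hP.le
    (f := fun x => Φ (x ^ 2 + a) + x)
    ((hL.cont.comp (by fun_prop)).add continuous_id).continuousOn hmem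
  simp only at hρ0
  have hfix : Φ (ρ ^ 2 + a) = -ρ := by linarith
  have hρpos : 0 < ρ := by
    refine lt_of_le_of_ne hρ.1 ?_
    rintro rfl
    rw [zero_pow two_ne_zero, zero_add] at hfix
    linarith
  have hρlt : ρ < P := by
    refine lt_of_le_of_ne hρ.2 ?_
    rintro rfl
    linarith
  have hlρ0 : 0 ≤ lam ρ := by rw [← hs.zero]; exact hs.mono hρ.1
  have hlρ : lam ρ = (S - 1) / (S + 1) * lam P := by
    have := hs.eq ρ (by rw [abs_of_pos hρpos]; exact hρ.2)
    rw [hfix, hs.odd, abs_of_nonneg hlρ0, hlamc] at this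
    have h1 : S + 1 ≠ 0 := by linarith
    field_simp
    linarith
  have hγ : ρ < -Φ a := by
    apply hlt
    rw [hs.odd, hlamc, hlρ, neg_neg, div_mul_eq_mul_div, div_lt_iff₀ (by linarith)]
    nlinarith [mul_pos (sub_pos.2 hS) hlP]
  have hγP : -Φ a ≤ P := by linarith [hL.bot]
  have habsc : |Φ a| ≤ P := by rw [abs_of_neg hc0]; exact hγP
  have hlc2 : lam (Φ ((Φ a) ^ 2 + a)) = (S - 1) ^ 2 * lam P := by
    rw [hs.eq _ habsc, hlamc, abs_neg, abs_of_pos (by nlinarith)]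
    ring
  have hc2 : 0 < Φ ((Φ a) ^ 2 + a) := by
    apply hlt
    rw [hlc2, hs.zero]
    have := sub_pos.2 hS
    positivity
  refine ⟨ρ, hlamc, hS2, hρpos, hρlt, hfix, hlρ, hγ, hγP, hc2, hlc2, ?_⟩
  have h1 := hL.lipschitz habsc (show |(-ρ)| ≤ P by rw [abs_neg, abs_of_pos hρpos]; exact hρ.2)
  have h2 := hL.lip a (ρ ^ 2 + a) le_rfl (by nlinarith) (by nlinarith)
  rw [neg_sq, hfix, abs_of_pos (by linarith), abs_of_neg (by linarith)] at h1
  rw [hfix] at h2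
  have h3 : ρ ≤ 88 * (44 / P * ρ ^ 2) := by linarith
  have h4 : P * ρ ≤ 3872 * ρ * ρ := by
    calc P * ρ ≤ P * (88 * (44 / P * ρ ^ 2)) := by gcongr
      _ = _ := by field_simp; ring
  exact le_of_mul_le_mul_right h4 hρpos
end

section
variable {lam Φ : ℝ → ℝ} {a P S l ρ : ℝ}

theorem LvlFix.seven_le (hL : Lvl Φ a P l) (hf : LvlFix lam Φ a P S ρ) : 7 * ρ ≤ 5 * P := by
  have hP := hL.pos
  have hρ := hf.rho_pos
  have hρP := hf.rho_lt
  have hll := hL.left_lt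
  have h1 := hL.cr l a (a + ρ ^ 2) (a + P ^ 2) le_rfl hll (by nlinarith) (by nlinarith) le_rfl
  rw [hL.top, add_comm a (ρ ^ 2), hf.fix] at h1
  have hB := hL.left
  have hγ := hf.rho_lt_c
  have hγP := hf.c_le
  obtain ⟨B, hBd⟩ : ∃ B, B = -Φ l := ⟨_, rfl⟩
  obtain ⟨γ, hγd⟩ : ∃ γ, γ = -Φ a := ⟨_, rfl⟩
  obtain ⟨d, hd⟩ : ∃ d, d = a - l := ⟨_, rfl⟩
  have hd0 : 0 < d := by linarith
  rw [← hγd] at hγ hγP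
  have hB' : 7 / 5 * P ≤ B := by linarith
  have h2 : (B - γ) * (P + ρ) * ((d + ρ ^ 2) * P ^ 2) ≤
      d * (P ^ 2 - ρ ^ 2) * ((B - ρ) * (P + γ)) := by
    rw [hBd, hγd, hd]
    linarith
  have h3 : (B - γ) * P ^ 2 ≤ (P - ρ) * ((B - ρ) * (P + γ)) := by
    have hpos : 0 < (P + ρ) * d := by positivity
    refine le_of_mul_le_mul_right ?_ hpos
    have h4 : 0 ≤ (B - γ) * (P + ρ) * (ρ ^ 2 * P ^ 2) := by
      have : 0 ≤ B - γ := by linarith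
      positivity
    linarith
  have h4 : (B - P) * P ≤ 2 * ((P - ρ) * (B - ρ)) := by
    refine le_of_mul_le_mul_right ?_ hP
    have e1 : (B - P) * P ^ 2 ≤ (B - γ) * P ^ 2 := by gcongr
    have e2 : (P - ρ) * ((B - ρ) * (P + γ)) ≤ (P - ρ) * ((B - ρ) * (P + P)) := by
      have : 0 ≤ P - ρ := by linarith
      have : 0 ≤ B - ρ := by linarith
      gcongr
    linarith
  by_contra hcon
  push Not at hcon
  have e1 : (P - ρ) ≤ 2 / 7 * P := by linarith
  nlinarith [mul_nonneg (sub_nonneg.2 hB') (show 0 ≤ P - 2 * (P - ρ) by linarith)]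

theorem LvlFix.six_le (hL : Lvl Φ a P l) (hf : LvlFix lam Φ a P S ρ) :
    6 * ρ ≤ 5 * -Φ a := by
  have hP := hL.pos
  have hρ := hf.rho_pos
  have h7 := hf.seven_le hL
  have hll := hL.left_lt
  have hγ := hf.rho_lt_c
  have hγP := hf.c_le
  have h1 := hL.cr l a (a + ρ ^ 2) (a + (Φ a) ^ 2) le_rfl hll (by nlinarith) (by nlinarith)
    (by nlinarith)
  rw [add_comm a (Φ a ^ 2), add_comm a (ρ ^ 2), hf.fix] at h1
  have hB := hL.left
  have hc2 := hf.c2_pos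
  obtain ⟨c, hcd⟩ : ∃ c, c = Φ (Φ a ^ 2 + a) := ⟨_, rfl⟩
  obtain ⟨B, hBd⟩ : ∃ B, B = -Φ l := ⟨_, rfl⟩
  obtain ⟨γ, hγd⟩ : ∃ γ, γ = -Φ a := ⟨_, rfl⟩
  obtain ⟨d, hd⟩ : ∃ d, d = a - l := ⟨_, rfl⟩
  have hd0 : 0 < d := by linarith
  rw [← hγd] at hγ hγP ⊢
  rw [← hcd] at hc2 h1
  have hB' : 49 / 25 * ρ ≤ B := by linarith
  have hγ0 : 0 < γ := by linarith
  have hBγ : 0 ≤ B - γ := by linarith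
  have hBρ : 0 ≤ B - ρ := by linarith
  have hγρ : 0 ≤ γ - ρ := by linarith
  have h2 : (B - γ) * (c + ρ) * ((d + ρ ^ 2) * γ ^ 2) ≤
      d * (γ ^ 2 - ρ ^ 2) * ((B - ρ) * (c + γ)) := by
    rw [hBd, hγd, hd]
    linarith
  have h3 : (B - γ) * (c + ρ) * γ ^ 2 ≤ (γ ^ 2 - ρ ^ 2) * ((B - ρ) * (c + γ)) := by
    refine le_of_mul_le_mul_right ?_ hd0
    have h4 : 0 ≤ (B - γ) * (c + ρ) * (ρ ^ 2 * γ ^ 2) := by positivity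
    linarith
  have h4 : (B - γ) * γ * ρ ≤ (γ ^ 2 - ρ ^ 2) * (B - ρ) := by
    have hpos : 0 < (c + ρ) * γ := by positivity
    refine le_of_mul_le_mul_right ?_ hpos
    have e1 : (c + γ) * ρ ≤ (c + ρ) * γ := by nlinarith
    have e2 : 0 ≤ (γ ^ 2 - ρ ^ 2) * (B - ρ) := by
      have : 0 ≤ γ ^ 2 - ρ ^ 2 := by nlinarith
      positivity
    have e3 := mul_le_mul_of_nonneg_left e1 e2
    have e4 := mul_le_mul_of_nonneg_right h3 hρ.le
    linarith
  by_contra hcon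
  push Not at hcon
  have k1 : 0 ≤ γ * ρ - (γ ^ 2 - ρ ^ 2) := by nlinarith
  have k2 := mul_nonneg (sub_nonneg.2 hB') k1
  have k3 : 0 ≤ ρ * (49 * γ ^ 2 - 49 * (ρ * γ) - 24 * ρ ^ 2) := by linarith
  have k4 := nonneg_of_mul_nonneg_right k3 hρ
  nlinarith

theorem LvlFix.gap (hL : Lvl Φ a P l) (hf : LvlFix lam Φ a P S ρ)
    (hc : Φ ((Φ a) ^ 2 + a) ≤ ρ) : |Φ a| ≤ (1 - 1 / 400) * P := by
  have h7 := hf.seven_le hL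
  have hP := hL.pos
  have hγ := hf.rho_lt_c
  have hρ := hf.rho_pos
  have h1 : |Φ a| = -Φ a := abs_of_neg (by linarith)
  have h2 := hL.lipschitz (x := P) (y := -Φ a) (abs_of_pos hP).le
    (by rw [abs_neg, h1]; exact hf.c_le)
  have h3 := hf.c_le
  rw [add_comm (P ^ 2) a, hL.top, neg_sq, abs_of_nonneg (a := P - -Φ a) (by linarith)] at h2
  have := le_abs_self (P - Φ (Φ a ^ 2 + a))
  rw [h1]
  linarith

theorem LvlSemi.step (hs : LvlSemi lam Φ a P S) (hf : LvlFix lam Φ a P S ρ) (hL : Lvl Φ a P l) :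
    LvlSemi lam (fun y => -Φ ((Φ y) ^ 2 + a)) a ρ (S ^ 2) := by
  have hS := hs.one_lt
  have hlP := hs.pos
  refine ⟨hs.mono, hs.odd, ?_, by nlinarith, ?_⟩
  · rw [hf.lam_rho]
    have : 0 < S - 1 := by linarith
    positivity
  · intro x hx
    have hx' : |x| ≤ P := hx.trans hf.rho_lt.le
    have h1 := hL.abs_le hx'
    have h2 : Φ (x ^ 2 + a) ≤ -ρ := by
      rw [← hf.fix]
      exact hL.mono_abs (by rwa [abs_of_pos hf.rho_pos]) (by rw [abs_of_pos hf.rho_pos]; exact hf.rho_lt.le)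
    have h3 : |lam (Φ (x ^ 2 + a))| = -lam (Φ (x ^ 2 + a)) := by
      apply abs_of_nonpos
      rw [← hs.zero]
      exact hs.mono (by linarith [hf.rho_pos])
    have h5 := hs.eq x hx'
    rw [hs.odd, hs.odd, hs.eq _ h1, h3, h5, hf.lam_c2, hf.lamc]
    ring

theorem Lvl.step (hL : Lvl Φ a P l) (hf : LvlFix lam Φ a P S ρ)
    (hc : Φ ((Φ a) ^ 2 + a) ≤ ρ) :
    ∃ l', Lvl (fun y => -Φ ((Φ y) ^ 2 + a)) a ρ l' := by
  have h7 := hf.seven_le hL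
  have h6 := hf.six_le hL
  have hP := hL.pos
  have hγ := hf.rho_lt_c
  have hγP := hf.c_le
  have hρ := hf.rho_pos
  have hρP := hf.rho_lt
  have hll := hL.left_lt
  have hgap := hf.gap hL hc
  rw [abs_of_neg (by linarith)] at hgap
  have hfix' : Φ (a + ρ ^ 2) = -ρ := by rw [add_comm]; exact hf.fix
  obtain ⟨l', hl'm, hl'⟩ : (-P) ∈ Φ '' Icc l a :=
    intermediate_value_Icc hll.le hL.cont.continuousOn ⟨by linarith [hL.left], hL.bot⟩
  have hl'a : l' < a := by
    refine lt_of_le_of_ne hl'm.2 ?_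
    rintro rfl
    linarith
  have hbP : a + ρ ^ 2 ≤ a + P ^ 2 := by nlinarith
  obtain ⟨r', hr'm, hr'⟩ : (0 : ℝ) ∈ Φ '' Icc (a + ρ ^ 2) (a + P ^ 2) :=
    intermediate_value_Icc hbP hL.cont.continuousOn
      ⟨by rw [hfix']; linarith, by rw [hL.top]; linarith⟩
  have hbr : a + ρ ^ 2 < r' := by
    refine lt_of_le_of_ne hr'm.1 ?_
    rintro rfl
    linarith
  have hsub : Icc l' r' ⊆ Icc l (a + P ^ 2) := Icc_subset_Icc hl'm.1 hr'm.2
  have hmonoΦ : StrictMonoOn Φ (Icc l' r') := hL.mono.mono hsub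
  have hρ2 : 0 < ρ ^ 2 := by positivity
  have hlr : l' ≤ r' := by linarith
  have hmaps : MapsTo Φ (Icc l' r') (Icc (-P) 0) := by
    intro y hy
    constructor
    · rw [← hl']; exact hmonoΦ.monotoneOn ⟨le_rfl, hlr⟩ hy hy.1
    · rw [← hr']; exact hmonoΦ.monotoneOn hy ⟨hlr, le_rfl⟩ hy.2
  obtain ⟨hψ, hmψ⟩ := hL.cr.neg_comp_sq hll.le hL.mono
  have hcrΦ : CrossRatio Φ l' r' := by
    intro x₁ x₂ x₃ x₄ h1 h2 h3 h4 h5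
    exact hL.cr x₁ x₂ x₃ x₄ (hl'm.1.trans h1) h2 h3 h4 (h5.trans hr'm.2)
  have hcr := hcrΦ.comp hmonoΦ hmaps hψ hmψ
  have hmono : StrictMonoOn (fun y => -Φ ((Φ y) ^ 2 + a)) (Icc l' r') :=
    hmψ.comp hmonoΦ hmaps
  have vb : -Φ ((Φ (a + ρ ^ 2)) ^ 2 + a) = ρ := by
    rw [hfix', neg_sq, hf.fix, neg_neg]
  have vl : -Φ ((Φ l') ^ 2 + a) = -P := by
    rw [hl', neg_sq, add_comm, hL.top]
  have vr : -Φ ((Φ r') ^ 2 + a) = -Φ a := by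
    rw [hr', zero_pow two_ne_zero, zero_add]
  refine ⟨l', hρ, hl'a, by have := hL.cont; fun_prop,
    hmono.mono (Icc_subset_Icc le_rfl hbr.le), ?_, vb, by linarith, ?_, ?_⟩
  · intro x₁ x₂ x₃ x₄ h1 h2 h3 h4 h5
    exact hcr x₁ x₂ x₃ x₄ h1 h2 h3 h4 (h5.trans hbr.le)
  · simp only [vl]; linarith
  · intro y₁ y₂ h1 h12 h2
    have hm1 : y₁ ∈ Icc l' r' := ⟨by linarith, by linarith⟩
    have hm2 : y₂ ∈ Icc l' r' := ⟨by linarith, by linarith⟩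
    have hma : a ∈ Icc l' r' := ⟨by linarith, by linarith⟩
    have hmb : a + ρ ^ 2 ∈ Icc l' r' := ⟨by linarith, by linarith⟩
    have k1 := hmono.monotoneOn hma hm1 h1
    have k2 := hmono.monotoneOn hm1 hm2 h12
    have k3 := hmono.monotoneOn hm2 hmb h2
    rcases h12.eq_or_lt with rfl | h12'
    · simp
    have e2 : y₂ < a + ρ ^ 2 → _ := fun h => hcr y₁ y₂ (a + ρ ^ 2) r' hm1.1 h12' h hbr le_rfl
    have e1 : a < y₁ → _ := fun h => hcr l' a y₁ y₂ le_rfl hl'a h h12' hm2.2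
    simp only [vb, vl, vr] at k1 k2 k3 e1 e2 ⊢
    obtain ⟨u, hu⟩ : ∃ u, u = -Φ (Φ y₁ ^ 2 + a) := ⟨_, rfl⟩
    obtain ⟨v, hv⟩ : ∃ v, v = -Φ (Φ y₂ ^ 2 + a) := ⟨_, rfl⟩
    rw [← hu] at k1 k2 e1 e2 ⊢
    rw [← hv] at k2 k3 e1 e2 ⊢
    have hua : -ρ ≤ u := by linarith
    rw [div_mul_eq_mul_div, le_div_iff₀ hρ]
    rcases le_total y₁ (a + ρ ^ 2 / 2) with hmid | hmid
    · rcases h2.eq_or_lt with rfl | h2'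
      · have hv' : v = ρ := by rw [hv, vb]
        refine le_trans (b := 2 * ρ * ρ) ?_ (by nlinarith)
        gcongr
        linarith
      · have e := e2 h2'
        have e' : (v - u) * (-Φ a - ρ) * (a + ρ ^ 2 - y₁) ≤
            (y₂ - y₁) * ((2 * ρ) * (-Φ a + ρ)) := by
          refine le_of_mul_le_mul_right (a := r' - y₂) ?_ (by linarith)
          calc (v - u) * (-Φ a - ρ) * (a + ρ ^ 2 - y₁) * (r' - y₂)
              ≤ (y₂ - y₁) * (r' - (a + ρ ^ 2)) * ((ρ - u) * (-Φ a - v)) := by linarith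
            _ ≤ (y₂ - y₁) * (r' - y₂) * ((2 * ρ) * (-Φ a + ρ)) := by
                have : 0 ≤ y₂ - y₁ := by linarith
                have : 0 ≤ r' - y₂ := by linarith
                have : 0 ≤ -Φ a - v := by linarith
                have : 0 ≤ -Φ a + ρ := by linarith
                have : 0 ≤ ρ - u := by linarith
                gcongr
                · linarith
                · linarith
            _ = _ := by ring
        have e3 : (v - u) * (-Φ a - ρ) * (ρ ^ 2 / 2) ≤ (v - u) * (-Φ a - ρ) * (a + ρ ^ 2 - y₁) := by
          have : 0 ≤ v - u := by linarith
          have : 0 ≤ -Φ a - ρ := by linarith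
          gcongr
          linarith
        have e4 : (2 * ρ) * (-Φ a + ρ) ≤ 2 * ρ * (11 * (-Φ a - ρ)) := by
          gcongr
          linarith
        have e5 := mul_le_mul_of_nonneg_left e4 (show 0 ≤ y₂ - y₁ by linarith)
        have hpos : 0 < ρ * (-Φ a - ρ) := mul_pos hρ (by linarith)
        refine le_of_mul_le_mul_right ?_ hpos
        linarith
    · have e := e1 (by linarith)
      have e' : (Φ (Φ a ^ 2 + a)) ≤ ρ := hc
      have e3 : (P - ρ) * (v - u) * (y₂ - a) ≤ (y₂ - y₁) * ((ρ + P) * (2 * ρ)) := by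
        refine le_of_mul_le_mul_right (a := y₁ - l') ?_ (by linarith)
        have q1 : 0 ≤ v - u := by linarith
        have q2 : 0 ≤ y₂ - y₁ := by linarith
        have q3 : 0 ≤ y₁ - l' := by linarith
        have q4 : 0 ≤ y₂ - a := by linarith
        have q5 : 0 ≤ u - -P := by linarith
        have q6 : 0 ≤ v - -Φ (Φ a ^ 2 + a) := by linarith
        calc (P - ρ) * (v - u) * (y₂ - a) * (y₁ - l')
            ≤ (-Φ (Φ a ^ 2 + a) - -P) * (v - u) * (y₂ - a) * (y₁ - l') := by
              have : P - ρ ≤ -Φ (Φ a ^ 2 + a) - -P := by linarith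
              gcongr ?_ * _ * _ * _
          _ = (-Φ (Φ a ^ 2 + a) - -P) * (v - u) * ((y₁ - l') * (y₂ - a)) := by ring
          _ ≤ (a - l') * (y₂ - y₁) * ((u - -P) * (v - -Φ (Φ a ^ 2 + a))) := e
          _ ≤ (y₁ - l') * (y₂ - y₁) * ((ρ + P) * (2 * ρ)) := by
              gcongr
              · linarith
              · linarith
          _ = _ := by ring
      have e4 : (P - ρ) * (v - u) * (ρ ^ 2 / 2) ≤ (P - ρ) * (v - u) * (y₂ - a) := by
        have : 0 ≤ v - u := by linarith
        have : 0 ≤ P - ρ := by linarith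
        gcongr
        linarith
      have e5 : (ρ + P) * (2 * ρ) ≤ 6 * (P - ρ) * (2 * ρ) := by
        gcongr
        linarith
      have e6 := mul_le_mul_of_nonneg_left e5 (show 0 ≤ y₂ - y₁ by linarith)
      have hpos : 0 < ρ * (P - ρ) := mul_pos hρ (by linarith)
      refine le_of_mul_le_mul_right ?_ hpos
      have : 0 ≤ (y₂ - y₁) * (ρ * (P - ρ)) := mul_nonneg (by linarith) hpos.le
      linarith

end

theorem lvl_base {a : ℝ} (ha : a ∈ Icc (-2 : ℝ) (1 / 4)) :
    Lvl (fun x => x) a (bt a) (-(7 / 5) * bt a) := by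
  have h1 := bt_pos a
  have h2 := neg_bt_le ha
  have h3 := bt_sq ha.2
  refine ⟨h1, by linarith, continuous_id, fun x _ y _ hxy => hxy, crossRatio_id _ _, by linarith,
    h2, le_rfl, fun y₁ y₂ _ h _ => ?_⟩
  have h4 : 1 ≤ 44 / bt a := by
    rw [le_div_iff₀ h1]
    linarith [bt_le_two ha.1]
  nlinarith

/-- The iterate `f_a ^ (2 ^ m)`, up to the sign `(-1) ^ m`, as a function of the first image. -/
noncomputable def Phi (a : ℝ) : ℕ → ℝ → ℝ
  | 0 => fun y => y
  | m + 1 => fun y => -Phi a m ((Phi a m y) ^ 2 + a)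

theorem continuous_Phi (a : ℝ) (m : ℕ) : Continuous (Phi a m) := by
  induction m with
  | zero => exact continuous_id
  | succ m ih =>
    change Continuous fun y => -Phi a m ((Phi a m y) ^ 2 + a)
    fun_prop

theorem Phi_sq_add (a : ℝ) (m : ℕ) (x : ℝ) :
    Phi a m (x ^ 2 + a) = (-1) ^ m * (fa a)^[2 ^ m] x := by
  induction m generalizing x with
  | zero => simp [Phi, fa_apply]
  | succ m ih =>
    change -Phi a m ((Phi a m (x ^ 2 + a)) ^ 2 + a) = _
    rw [ih, ih x, pow_succ 2 m, mul_two, Function.iterate_add_apply]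
    have : (fa a)^[2 ^ m] ((-1) ^ m * (fa a)^[2 ^ m] x) = (fa a)^[2 ^ m] ((fa a)^[2 ^ m] x) := by
      rcases neg_one_pow_eq_or ℝ m with h | h
      · rw [h, one_mul]
      · rw [h, neg_one_mul, iterate_fa_neg _ _ (by positivity)]
    rw [this]
    ring

/-- The maximal tower of period doubling restrictive intervals `[-P m, P m]`, `m ≤ n`. -/
structure Chain (a : ℝ) (lam : ℝ → ℝ) (n : ℕ) (P : ℕ → ℝ) : Prop where
  zero : P 0 = bt a
  lvl : ∀ m ≤ n, ∃ l, Lvl (Phi a m) a (P m) l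
  semi : ∀ m ≤ n, LvlSemi lam (Phi a m) a (P m) (gr a ^ 2 ^ m)
  fix : ∀ m ≤ n, LvlFix lam (Phi a m) a (P m) (gr a ^ 2 ^ m) (P (m + 1))
  gap : ∀ m < n, |Phi a m a| ≤ (1 - 1 / 400) * P m
  last : P (n + 1) < Phi a n ((Phi a n a) ^ 2 + a)

theorem exists_chain {a : ℝ} (ha : a ∈ Icc (-2 : ℝ) (1 / 4)) (hs : 1 < gr a) :
    ∃ lam n P, Chain a lam n P := by
  obtain ⟨lam, hmono, hodd, hpos, heq⟩ := exists_semiconj ha hs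
  let P : ℕ → ℝ := fun m => Nat.rec (bt a)
    (fun m p => Classical.epsilon (fun ρ => LvlFix lam (Phi a m) a p (gr a ^ 2 ^ m) ρ)) m
  let good : ℕ → Prop := fun m => (∃ l, Lvl (Phi a m) a (P m) l) ∧
    LvlSemi lam (Phi a m) a (P m) (gr a ^ 2 ^ m)
  have h0 : good 0 := by
    refine ⟨⟨_, lvl_base ha⟩, hmono, hodd, hpos, by simpa using hs, ?_⟩
    intro x hx
    have := heq x (mem_Ia.2 hx)
    rw [fa_apply] at this
    simpa [Phi] using this
  have hfix : ∀ m, good m → LvlFix lam (Phi a m) a (P m) (gr a ^ 2 ^ m) (P (m + 1)) := by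
    rintro m ⟨⟨l, hl⟩, hsemi⟩
    exact Classical.epsilon_spec (hl.exists_fix hsemi)
  have hstep : ∀ m, good m → Phi a m ((Phi a m a) ^ 2 + a) ≤ P (m + 1) → good (m + 1) := by
    intro m hg hc
    have hf := hfix m hg
    obtain ⟨⟨l, hl⟩, hsemi⟩ := hg
    refine ⟨hl.step hf hc, ?_⟩
    rw [pow_succ 2 m, pow_mul]
    exact hsemi.step hf hl
  have hex : ∃ n, good n ∧ P (n + 1) < Phi a n ((Phi a n a) ^ 2 + a) := by
    by_contra hcon
    push Not at hcon
    have hall : ∀ m, good m := fun m => by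
      induction m with
      | zero => exact h0
      | succ m ih => exact hstep m ih (hcon m ih)
    obtain ⟨N, hN⟩ := pow_unbounded_of_one_lt 2 hs
    have h1 := (hfix N (hall N)).S_le
    have h2 : gr a ^ N ≤ gr a ^ 2 ^ N := pow_le_pow_right₀ hs.le Nat.lt_two_pow_self.le
    linarith
  classical
  have hn := Nat.find_spec hex
  have hmin : ∀ m < Nat.find hex, good m → Phi a m ((Phi a m a) ^ 2 + a) ≤ P (m + 1) := by
    intro m hm hg
    by_contra hcon
    exact Nat.find_min hex hm ⟨hg, not_le.1 hcon⟩
  have hall : ∀ m ≤ Nat.find hex, good m := by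
    intro m hm
    induction m with
    | zero => exact h0
    | succ m ih => exact hstep m (ih (by omega)) (hmin m (by omega) (ih (by omega)))
  refine ⟨lam, Nat.find hex, P, rfl, fun m hm => (hall m hm).1, fun m hm => (hall m hm).2,
    fun m hm => hfix m (hall m hm), fun m hm => ?_, hn.2⟩
  have hg := hall m hm.le
  obtain ⟨l, hl⟩ := hg.1
  exact (hfix m hg).gap hl (hmin m hm hg)

namespace Chain
variable {a : ℝ} {lam : ℝ → ℝ} {n : ℕ} {P : ℕ → ℝ}

theorem pos (hC : Chain a lam n P) {m : ℕ} (hm : m ≤ n + 1) : 0 < P m := by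
  rcases hm.lt_or_eq with h | rfl
  · obtain ⟨l, hl⟩ := hC.lvl m (by omega)
    exact hl.pos
  · exact (hC.fix n le_rfl).rho_pos

theorem seven_le (hC : Chain a lam n P) {m : ℕ} (hm : m ≤ n) : 7 * P (m + 1) ≤ 5 * P m := by
  obtain ⟨l, hl⟩ := hC.lvl m hm
  exact (hC.fix m hm).seven_le hl

theorem two_le_sq (hC : Chain a lam n P) : 2 ≤ (gr a ^ 2 ^ n) ^ 2 := by
  have hf := hC.fix n le_rfl
  have hs := hC.semi n le_rfl
  have h1 := hs.mono hC.last.le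
  rw [hf.lam_rho, hf.lam_c2] at h1
  have h2 := le_of_mul_le_mul_right h1 hs.pos
  have h3 := sub_pos.2 hs.one_lt
  set S := gr a ^ 2 ^ n
  rw [div_le_iff₀ (by linarith)] at h2
  nlinarith

end Chain

/-- The semiconjugacy to the tent map `t ↦ S * |t| - 1`. -/
noncomputable def nrm (lam : ℝ → ℝ) (P S x : ℝ) : ℝ := lam x / ((S - 1) * lam P)

section
variable {lam Φ : ℝ → ℝ} {a P S l ρ : ℝ}

theorem LvlSemi.nrm_pos (hs : LvlSemi lam Φ a P S) : 0 < (S - 1) * lam P :=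
  mul_pos (sub_pos.2 hs.one_lt) hs.pos

theorem LvlSemi.nrm_mono (hs : LvlSemi lam Φ a P S) : Monotone (nrm lam P S) :=
  fun _ _ h => div_le_div_of_nonneg_right (hs.mono h) hs.nrm_pos.le

theorem LvlSemi.nrm_zero (hs : LvlSemi lam Φ a P S) : nrm lam P S 0 = 0 := by
  rw [nrm, hs.zero, zero_div]

theorem LvlSemi.nrm_neg (hs : LvlSemi lam Φ a P S) (x : ℝ) :
    nrm lam P S (-x) = -nrm lam P S x := by
  rw [nrm, nrm, hs.odd, neg_div]

theorem LvlSemi.nrm_P (hs : LvlSemi lam Φ a P S) : nrm lam P S P = 1 / (S - 1) := by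
  have := hs.pos.ne'
  rw [nrm]
  field_simp

theorem LvlSemi.abs_nrm_le (hs : LvlSemi lam Φ a P S) {x : ℝ} (hx : |x| ≤ P) :
    |nrm lam P S x| ≤ 1 / (S - 1) := by
  rw [abs_le] at hx ⊢
  rw [← hs.nrm_P, ← hs.nrm_neg]
  exact ⟨hs.nrm_mono hx.1, hs.nrm_mono hx.2⟩

theorem inv_sub_one_le (hS : 1 < S) (h2 : 2 ≤ S ^ 2) : 1 / (S - 1) ≤ 24143 / 10000 := by
  have : 141421 / 100000 ≤ S := by
    by_contra hcon
    push Not at hcon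
    nlinarith
  rw [div_le_iff₀ (by linarith)]
  linarith

theorem LvlSemi.nrm_eq (hs : LvlSemi lam Φ a P S) (hf : LvlFix lam Φ a P S ρ) {x : ℝ}
    (hx : |x| ≤ P) : nrm lam P S (Φ (x ^ 2 + a)) = S * |nrm lam P S x| - 1 := by
  have h1 := hs.nrm_pos
  have h2 : S - 1 ≠ 0 := (sub_pos.2 hs.one_lt).ne'
  have h3 := hs.pos.ne'
  rw [nrm, nrm, hs.eq x hx, hf.lamc, abs_div, abs_of_pos h1]
  field_simp
  ring

theorem LvlSemi.nrm_near_zero (hL : Lvl Φ a P l) (hs : LvlSemi lam Φ a P S)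
    (hf : LvlFix lam Φ a P S ρ) (hlast : ρ < Φ ((Φ a) ^ 2 + a)) {z : ℝ}
    (hz : |z| ≤ P / 10 ^ 6) :
    ∃ x y, |x| ≤ P ∧ |y| ≤ P ∧ |x - y| ≤ |z| ∧
      S ^ 3 * |nrm lam P S z| = |nrm lam P S x - nrm lam P S y| := by
  have hP := hL.pos
  have hzP : |z| ≤ P := hz.trans (by rw [div_le_iff₀ (by norm_num)]; linarith)
  have h0P : |(0 : ℝ)| ≤ P := by rw [abs_zero]; exact hP.le
  have hρ := hf.P_le
  have d1 := hL.abs_sub_le hzP h0P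
  have b1 := hL.abs_le hzP
  have c1 := hL.abs_le h0P
  have t1 := hs.nrm_eq hf hzP
  have t1' := hs.nrm_eq hf h0P
  have v0 : Φ (0 ^ 2 + a) = Φ a := by rw [zero_pow two_ne_zero, zero_add]
  have d1' : |Φ (z ^ 2 + a) - Φ (0 ^ 2 + a)| ≤ 44 / 10 ^ 6 * |z| := by
    refine d1.trans ?_
    rw [zero_pow two_ne_zero, sub_zero, abs_of_nonneg (sq_nonneg z), ← sq_abs z, sq]
    calc 44 / P * (|z| * |z|) ≤ 44 / P * (P / 10 ^ 6 * |z|) := by gcongr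
      _ = _ := by field_simp
  have v1 := hf.rho_lt_c
  have d2 := hL.lipschitz b1 c1
  have b2 := hL.abs_le b1
  have c2 := hL.abs_le c1
  have t2 := hs.nrm_eq hf b1
  have t2' := hs.nrm_eq hf c1
  have d3 := hL.lipschitz b2 c2
  have b3 := hL.abs_le b2
  have c3 := hL.abs_le c2
  have t3 := hs.nrm_eq hf b2
  have t3' := hs.nrm_eq hf c2
  have q1 := abs_le.1 d1'
  have q2 := abs_le.1 d2
  have hz6 : |z| * 10 ^ 6 ≤ P := by rwa [le_div_iff₀ (by norm_num)] at hz
  have hsq : 44 / P * |z ^ 2| ≤ 44 / 10 ^ 12 * P := by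
    rw [abs_of_nonneg (sq_nonneg z), ← sq_abs z, sq, div_mul_eq_mul_div, div_le_iff₀ hP]
    have := mul_self_le_mul_self (by positivity) hz6
    nlinarith
  have d1'' : |Φ (z ^ 2 + a) - Φ (0 ^ 2 + a)| ≤ 44 / 10 ^ 12 * P := by
    refine d1.trans (le_trans (le_of_eq ?_) hsq)
    rw [zero_pow two_ne_zero, sub_zero]
  have q1' := abs_le.1 d1''
  have n1 : Φ (z ^ 2 + a) ≤ 0 := by
    rw [v0] at q1'
    linarith
  have n2 : 0 ≤ Φ (Φ (z ^ 2 + a) ^ 2 + a) := by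
    rw [v0] at q2 d1''
    linarith
  have s0 := hs.nrm_zero
  have s1 : nrm lam P S (Φ (z ^ 2 + a)) ≤ 0 := by rw [← s0]; exact hs.nrm_mono n1
  have s2 : 0 ≤ nrm lam P S (Φ (Φ (z ^ 2 + a) ^ 2 + a)) := by rw [← s0]; exact hs.nrm_mono n2
  have hS := hs.one_lt
  have hS0 : 0 < S := by linarith
  refine ⟨_, _, b3, c3, ?_, ?_⟩
  · calc _ ≤ _ := d3
      _ ≤ 88 * (88 * (44 / 10 ^ 6 * |z|)) :=
        mul_le_mul_of_nonneg_left
          (d2.trans (mul_le_mul_of_nonneg_left d1' (by norm_num))) (by norm_num)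
      _ ≤ |z| := by linarith [abs_nonneg z]
  · rw [t3, t3', abs_of_nonneg s2, t2, t2', abs_of_nonpos s1, t1, t1', s0]
    have e : |S * |(0 : ℝ)| - 1| = 1 := by norm_num
    rw [e]
    have e' : |S * 1 - 1| = S - 1 := by rw [mul_one, abs_of_pos (by linarith)]
    rw [e']
    have e'' : S * (S * -(S * |nrm lam P S z| - 1) - 1) - 1 - (S * (S - 1) - 1) =
      -(S ^ 3 * |nrm lam P S z|) := by ring
    rw [e'', abs_neg, abs_mul, abs_abs, abs_of_pos (pow_pos hS0 3)]

theorem LvlSemi.holder (hL : Lvl Φ a P l) (hs : LvlSemi lam Φ a P S)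
    (hf : LvlFix lam Φ a P S ρ) (hlast : ρ < Φ ((Φ a) ^ 2 + a)) (h2 : 2 ≤ S ^ 2) {x y : ℝ}
    (hx : |x| ≤ P) (hy : |y| ≤ P) :
    |nrm lam P S x - nrm lam P S y| ≤ 14 * (|x - y| / P) ^ (1 / 14 : ℝ) := by
  have hP := hL.pos
  have hS := hs.one_lt
  have hSi : 1 / S < 1 := by rw [div_lt_one (by linarith)]; exact hS
  have hS0 : (0 : ℝ) < S := by linarith
  have h88 : (88 : ℝ) ^ (1 / 14 : ℝ) ≤ S := by
    have e : S = (S ^ 14) ^ (1 / 14 : ℝ) := by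
      rw [← Real.rpow_natCast, ← Real.rpow_mul hS0.le]
      norm_num
    rw [e]
    refine Real.rpow_le_rpow (by norm_num) ?_ (by norm_num)
    calc (88 : ℝ) ≤ 2 ^ 7 := by norm_num
      _ ≤ (S ^ 2) ^ 7 := by gcongr
      _ = S ^ 14 := by ring
  have hbig : ∀ x y, |x| ≤ P → |y| ≤ P → |nrm lam P S x - nrm lam P S y| ≤ 5 := by
    intro x y hx hy
    have h3 := hs.abs_nrm_le hx
    have h4 := hs.abs_nrm_le hy
    have h5 := inv_sub_one_le hS h2
    linarith [abs_sub (nrm lam P S x) (nrm lam P S y)]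
  have key : ∀ k : ℕ, ∀ x y, |x| ≤ P → |y| ≤ P →
      |nrm lam P S x - nrm lam P S y| ≤ 14 * (|x - y| / P) ^ (1 / 14 : ℝ) + 5 * (1 / S) ^ k := by
    intro k
    induction k with
    | zero =>
      intro x y hx hy
      have : 0 ≤ (|x - y| / P) ^ (1 / 14 : ℝ) := by positivity
      have := hbig x y hx hy
      linarith
    | succ k ih =>
      intro x y hx hy
      have hnn : 0 ≤ (1 / S) ^ k := by positivity
      have hsame : ∀ x y, |x| ≤ P → |y| ≤ P →
          abs (|nrm lam P S x| - |nrm lam P S y|) ≤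
            14 * (|x - y| / P) ^ (1 / 14 : ℝ) + 5 * (1 / S) ^ (k + 1) := by
        intro x y hx hy
        have e := ih _ _ (hL.abs_le hx) (hL.abs_le hy)
        rw [hs.nrm_eq hf hx, hs.nrm_eq hf hy] at e
        have e1 : (|Φ (x ^ 2 + a) - Φ (y ^ 2 + a)| / P) ^ (1 / 14 : ℝ) ≤
            S * (|x - y| / P) ^ (1 / 14 : ℝ) := by
          calc _ ≤ (88 * (|x - y| / P)) ^ (1 / 14 : ℝ) := by
                refine Real.rpow_le_rpow (by positivity) ?_ (by norm_num)
                rw [mul_div_assoc', div_le_div_iff_of_pos_right hP]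
                exact hL.lipschitz hx hy
            _ = 88 ^ (1 / 14 : ℝ) * (|x - y| / P) ^ (1 / 14 : ℝ) :=
                Real.mul_rpow (by norm_num) (by positivity)
            _ ≤ _ := by gcongr
        rw [sub_sub_sub_cancel_right, ← mul_sub, abs_mul, abs_of_pos hS0] at e
        refine le_of_mul_le_mul_left ?_ hS0
        have e2 : S * (5 * (1 / S) ^ (k + 1)) = 5 * (1 / S) ^ k := by
          rw [pow_succ]
          field_simp
        rw [mul_add, e2]
        linarith
      rcases le_total 0 (x * y) with hxy | hxy
      · rcases mul_nonneg_iff.1 hxy with ⟨h1, h3⟩ | ⟨h1, h3⟩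
        · have k1 : 0 ≤ nrm lam P S x := by rw [← hs.nrm_zero]; exact hs.nrm_mono h1
          have k2 : 0 ≤ nrm lam P S y := by rw [← hs.nrm_zero]; exact hs.nrm_mono h3
          have := hsame x y hx hy
          rwa [abs_of_nonneg k1, abs_of_nonneg k2] at this
        · have k1 : nrm lam P S x ≤ 0 := by rw [← hs.nrm_zero]; exact hs.nrm_mono h1
          have k2 : nrm lam P S y ≤ 0 := by rw [← hs.nrm_zero]; exact hs.nrm_mono h3
          have := hsame x y hx hy
          rw [abs_of_nonpos k1, abs_of_nonpos k2, neg_sub_neg, abs_sub_comm] at this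
          exact this
      · have hdx : |x| ≤ |x - y| ∧ |y| ≤ |x - y| := by
          constructor
          · rw [← sq_le_sq]; nlinarith [sq_nonneg y]
          · rw [← sq_le_sq]; nlinarith [sq_nonneg x]
        rcases le_total (|x - y|) (P / 10 ^ 6) with hd | hd
        · have hone : ∀ z, |z| ≤ |x - y| → |nrm lam P S z| ≤
              (14 * (|x - y| / P) ^ (1 / 14 : ℝ) + 5 * (1 / S) ^ (k + 1)) / 2 := by
            intro z hz
            obtain ⟨u, v, hu, hv, huv, e⟩ := hs.nrm_near_zero hL hf hlast (hz.trans hd)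
            have e1 := ih u v hu hv
            rw [← e] at e1
            have e2 : (|u - v| / P) ^ (1 / 14 : ℝ) ≤ (|x - y| / P) ^ (1 / 14 : ℝ) := by
              refine Real.rpow_le_rpow (by positivity) ?_ (by norm_num)
              exact div_le_div_of_nonneg_right (huv.trans hz) hP.le
            have e3 : S * (5 * (1 / S) ^ (k + 1)) = 5 * (1 / S) ^ k := by
              rw [pow_succ]
              field_simp
            have e4 : 2 * S * |nrm lam P S z| ≤ S ^ 3 * |nrm lam P S z| := by
              gcongr
              nlinarith
            have e5 : 0 ≤ (|x - y| / P) ^ (1 / 14 : ℝ) := by positivity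
            rw [le_div_iff₀ two_pos]
            refine le_of_mul_le_mul_left ?_ hS0
            rw [mul_add, e3]
            nlinarith
          have := hone x hdx.1
          have := hone y hdx.2
          linarith [abs_sub (nrm lam P S x) (nrm lam P S y)]
        · have e1 := hbig x y hx hy
          have e2 : 5 / 14 ≤ (|x - y| / P) ^ (1 / 14 : ℝ) := by
            have e : (5 / 14 : ℝ) = ((5 / 14 : ℝ) ^ 14) ^ (1 / 14 : ℝ) := by
              rw [← Real.rpow_natCast, ← Real.rpow_mul (by norm_num)]
              norm_num
            rw [e]
            refine Real.rpow_le_rpow (by norm_num) ?_ (by norm_num)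
            rw [le_div_iff₀ hP]
            refine le_trans ?_ hd
            rw [le_div_iff₀ (by norm_num)]
            have : (5 / 14 : ℝ) ^ 14 * 10 ^ 6 ≤ 1 := by norm_num
            nlinarith
          have : 0 ≤ (1 / S) ^ (k + 1) := by positivity
          linarith
  have hlim : Tendsto (fun k : ℕ => 14 * (|x - y| / P) ^ (1 / 14 : ℝ) + 5 * (1 / S) ^ k) atTop
      (nhds (14 * (|x - y| / P) ^ (1 / 14 : ℝ) + 5 * 0)) :=
    ((tendsto_pow_atTop_nhds_zero_of_lt_one (by positivity) hSi).const_mul 5).const_add _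
  rw [mul_zero, add_zero] at hlim
  exact ge_of_tendsto' hlim fun k => key k x y hx hy

end

namespace Chain
variable {a a' : ℝ} {lam : ℝ → ℝ} {n : ℕ} {P : ℕ → ℝ}

theorem le_of_le (hC : Chain a' lam n P) {m k : ℕ} (hmk : m ≤ k) (hk : k ≤ n + 1) :
    P k ≤ P m := by
  induction k, hmk using Nat.le_induction with
  | base => exact le_rfl
  | succ k hmk ih =>
    have h1 := hC.seven_le (show k ≤ n by omega)
    have h2 := hC.pos (show k ≤ n + 1 by omega)
    linarith [ih (by omega)]

theorem P_le (hC : Chain a' lam n P) {m : ℕ} (hm : m ≤ n) : P m ≤ 3872 * P (m + 1) :=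
  (hC.fix m hm).P_le

theorem err_le (hC : Chain a' lam n P) {ε : ℝ} (hε : 0 ≤ ε) (hE : 89 ^ n * ε ≤ P n / 10 ^ 5)
    {m : ℕ} (hm : m ≤ n) : 89 ^ m * ε ≤ P m / 10 ^ 5 := by
  calc 89 ^ m * ε ≤ 89 ^ n * ε := by gcongr; norm_num
    _ ≤ P n / 10 ^ 5 := hE
    _ ≤ P m / 10 ^ 5 := by gcongr; exact hC.le_of_le hm (by omega)

theorem dip (hC : Chain a' lam n P) {m : ℕ} (hm : m < n) {x : ℝ}
    (hx : |x| ≤ 101 / 100 * P (m + 1)) :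
    -((1 - 1 / 400) * P m) ≤ Phi a' m (x ^ 2 + a') ∧
      Phi a' m (x ^ 2 + a') ≤ -(3 / 25) * P (m + 1) := by
  obtain ⟨l, hl⟩ := hC.lvl m hm.le
  have hf := hC.fix m hm.le
  have hP := hC.pos (show m ≤ n + 1 by omega)
  have hρ := hC.pos (show m + 1 ≤ n + 1 by omega)
  have h7 := hC.seven_le hm.le
  have hgap := hC.gap m hm
  have hxP : |x| ≤ P m := by linarith
  constructor
  · have h1 := hl.mono_abs (x := 0) (by simp) hxP
    rw [zero_pow two_ne_zero, zero_add] at h1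
    linarith [neg_abs_le (Phi a' m a')]
  · have h0 : |101 / 100 * P (m + 1)| = 101 / 100 * P (m + 1) := abs_of_pos (by positivity)
    have h1 := hl.mono_abs (x := x) (y := 101 / 100 * P (m + 1)) (by rwa [h0])
      (by rw [h0]; linarith)
    have h2 := hl.lipschitz (x := 101 / 100 * P (m + 1)) (y := P (m + 1)) (by rw [h0]; linarith)
      (by rw [abs_of_pos hρ]; linarith)
    rw [hf.fix, show 101 / 100 * P (m + 1) - P (m + 1) = P (m + 1) / 100 by ring,
      abs_of_pos (show 0 < P (m + 1) / 100 by positivity)] at h2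
    have h3 := (abs_le.1 h2).2
    linarith

theorem dip_of_close (hC : Chain a' lam n P) {ε : ℝ} (hε : 0 ≤ ε)
    (hE : 89 ^ n * ε ≤ P n / 10 ^ 5) {m : ℕ} (hm : m < n) {x u : ℝ}
    (hx : |x| ≤ 101 / 100 * P (m + 1)) (hu : |u - Phi a' m (x ^ 2 + a')| ≤ 89 ^ m * ε) :
    -P m ≤ u ∧ u ≤ 0 := by
  have h1 := hC.dip hm hx
  have h2 := hC.err_le hε hE hm.le
  have h3 := abs_le.1 hu
  have h4 := hC.P_le hm.le
  have h5 := hC.pos (show m ≤ n + 1 by omega)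
  constructor <;> linarith

theorem close (hC : Chain a' lam n P) (hE : 89 ^ n * |a - a'| ≤ P n / 10 ^ 5) {m : ℕ}
    (hm : m ≤ n) {x : ℝ} (hx : |x| ≤ 101 / 100 * P m) :
    |Phi a m (x ^ 2 + a) - Phi a' m (x ^ 2 + a')| ≤ 89 ^ m * |a - a'| := by
  induction m generalizing x with
  | zero => simp [Phi]
  | succ m ih =>
    obtain ⟨l, hl⟩ := hC.lvl m (by omega)
    have hP := hC.pos (show m ≤ n + 1 by omega)
    have h7 := hC.seven_le (show m ≤ n by omega)
    have hxm : |x| ≤ P m := by linarith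
    have h1 := ih (by omega) (x := x) (by linarith)
    have h2 := hC.dip_of_close (abs_nonneg _) hE (by omega) hx h1
    have h3 := hl.abs_le hxm
    change |-Phi a m ((Phi a m (x ^ 2 + a)) ^ 2 + a) -
      -Phi a' m ((Phi a' m (x ^ 2 + a')) ^ 2 + a')| ≤ _
    have h4 : |Phi a m (x ^ 2 + a)| ≤ P m := abs_le.2 ⟨h2.1, by linarith⟩
    have h5 := ih (by omega) (x := Phi a m (x ^ 2 + a)) (by linarith)
    have h6 := hl.lipschitz h4 h3
    rw [neg_sub_neg, abs_sub_comm]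
    refine (abs_sub_le _ (Phi a' m ((Phi a m (x ^ 2 + a)) ^ 2 + a')) _).trans ?_
    rw [pow_succ (89 : ℝ) m]
    linarith

theorem pert_dip (hC : Chain a' lam n P) (hE : 89 ^ n * |a - a'| ≤ P n / 10 ^ 5) {m : ℕ}
    (hm : m < n) {x : ℝ} (hx : |x| ≤ 101 / 100 * P (m + 1)) :
    -P m ≤ Phi a m (x ^ 2 + a) ∧ Phi a m (x ^ 2 + a) ≤ 0 := by
  have h7 := hC.seven_le hm.le
  have hP := hC.pos (show m ≤ n + 1 by omega)
  exact hC.dip_of_close (abs_nonneg _) hE hm hx (hC.close hE hm.le (by linarith))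

theorem pert_mono (hC : Chain a' lam n P) (hE : 89 ^ n * |a - a'| ≤ P n / 10 ^ 5) {m : ℕ}
    (hm : m ≤ n) {x y : ℝ} (hxy : |x| ≤ |y|) (hy : |y| ≤ 101 / 100 * P m) :
    Phi a m (x ^ 2 + a) ≤ Phi a m (y ^ 2 + a) := by
  induction m generalizing x y with
  | zero =>
    have := sq_le_sq.2 hxy
    change x ^ 2 + a ≤ y ^ 2 + a
    linarith
  | succ m ih =>
    have h7 := hC.seven_le (show m ≤ n by omega)
    have hP := hC.pos (show m ≤ n + 1 by omega)
    have h1 := hC.pert_dip hE (by omega) (hxy.trans hy)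
    have h3 := ih (by omega) hxy (by linarith)
    refine neg_le_neg (ih (by omega) ?_ ?_)
    · rw [abs_of_nonpos h1.2, abs_of_nonpos (hC.pert_dip hE (by omega) hy).2]
      linarith
    · rw [abs_of_nonpos h1.2]
      linarith

theorem abs_Phi_le (ha : a ∈ Icc (-2 : ℝ) (1 / 4)) {x : ℝ} (hx : |x| ≤ bt a) (m : ℕ) :
    |Phi a m (x ^ 2 + a)| ≤ bt a := by
  rw [Phi_sq_add, abs_mul, abs_pow, abs_neg, abs_one, one_pow, one_mul]
  exact mem_Ia.1 (iterate_mem ha (mem_Ia.2 hx) _)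

theorem pert_semi (hC : Chain a' lam n P) (hE : 89 ^ n * |a - a'| ≤ P n / 10 ^ 5)
    (ha : a ∈ Icc (-2 : ℝ) (1 / 4)) {L : ℝ → ℝ} {s : ℝ} (hmono : Monotone L)
    (hodd : ∀ x, L (-x) = -L x) (heq : ∀ x ∈ Ia a, L (fa a x) = L a + s * |L x|) {m : ℕ}
    (hm : m ≤ n) {x : ℝ} (hx : |x| ≤ 101 / 100 * P m) (hxb : |x| ≤ bt a) :
    L (Phi a m (x ^ 2 + a)) = L (Phi a m a) + s ^ 2 ^ m * |L x| := by
  have hL0 : L 0 = 0 := by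
    have := hodd 0
    rw [neg_zero] at this
    linarith
  induction m generalizing x with
  | zero =>
    have := heq x (mem_Ia.2 hxb)
    rw [fa_apply] at this
    simpa [Phi] using this
  | succ m ih =>
    have h7 := hC.seven_le (show m ≤ n by omega)
    have hP := hC.pos (show m ≤ n + 1 by omega)
    have hP' := hC.pos (show m + 1 ≤ n + 1 by omega)
    have key : ∀ x, |x| ≤ 101 / 100 * P (m + 1) → |x| ≤ bt a →
        L (Phi a (m + 1) (x ^ 2 + a)) =
          -L (Phi a m a) + s ^ 2 ^ m * L (Phi a m a) + s ^ 2 ^ (m + 1) * |L x| := by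
      intro x hx hxb
      have h1 := hC.pert_dip hE (by omega) hx
      have h2 := ih (by omega) (x := x) (by linarith) hxb
      have h3 := ih (by omega) (x := Phi a m (x ^ 2 + a))
        (by rw [abs_of_nonpos h1.2]; linarith) (abs_Phi_le ha hxb m)
      have h4 : L (Phi a m (x ^ 2 + a)) ≤ 0 := by rw [← hL0]; exact hmono h1.2
      change L (-Phi a m ((Phi a m (x ^ 2 + a)) ^ 2 + a)) = _
      rw [hodd, h3, abs_of_nonpos h4, h2, pow_succ 2 m, pow_mul]
      ring
    have h0 := key 0 (by rw [abs_zero]; positivity) (by rw [abs_zero]; exact (bt_pos a).le)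
    rw [zero_pow two_ne_zero, zero_add, hL0, abs_zero, mul_zero, add_zero] at h0
    rw [key x hx hxb, h0]

theorem lt_neg_one (hC : Chain a' lam n P) : a' < -1 := by
  have hf := hC.fix 0 (by omega)
  have h1 := hf.c2_pos
  have h2 := hf.rho_lt_c
  have h3 := hf.rho_pos
  simp only [Phi] at h1 h2
  nlinarith

theorem abs_bt_sub_le (ha : a ≤ 1 / 4) (ha' : a' < -1) : |bt a - bt a'| ≤ |a - a'| := by
  have h1 := bt_sq ha
  have h2 := bt_sq (show a' ≤ 1 / 4 by linarith)
  have h3 := half_le_bt a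
  have h4 : 3 / 2 ≤ bt a' := by
    have := bt_pos a'
    nlinarith
  have h5 : (bt a - bt a') * (bt a + bt a' - 1) = -(a - a') := by linarith
  have h6 : |bt a - bt a'| * (bt a + bt a' - 1) = |a - a'| := by
    rw [← abs_neg (a - a'), ← h5, abs_mul, abs_of_pos (show 0 < bt a + bt a' - 1 by linarith)]
  nlinarith [abs_nonneg (bt a - bt a')]

theorem exists_pert_fix (hC : Chain a' lam n P) (hE : 89 ^ n * |a - a'| ≤ P n / 10 ^ 5)
    (ha : a ∈ Icc (-2 : ℝ) (1 / 4)) {m : ℕ} (hm : m ≤ n) :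
    ∃ q, |q - P m| ≤ 89 ^ m * |a - a'| ∧ 0 < q ∧ q ≤ bt a ∧ Phi a m (q ^ 2 + a) = q ∧
      ∀ L : ℝ → ℝ, ∀ s : ℝ, Monotone L → (∀ x, L (-x) = -L x) →
        (∀ x ∈ Ia a, L (fa a x) = L a + s * |L x|) → 1 < s → 0 < L (bt a) → 0 < L q := by
  induction m with
  | zero =>
    refine ⟨bt a, ?_, bt_pos a, le_rfl, ?_, fun _ _ _ _ _ _ h => h⟩
    · rw [hC.zero, pow_zero, one_mul]
      exact abs_bt_sub_le ha.2 hC.lt_neg_one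
    · simp only [Phi]
      linarith [bt_sq ha.2]
  | succ m ih =>
    obtain ⟨q, hqP, hq0, hqb, hqfix, hLq⟩ := ih (by omega)
    have hm' : m ≤ n := by omega
    obtain ⟨l, hl⟩ := hC.lvl m hm'
    have hf := hC.fix m hm'
    have hP := hC.pos (show m ≤ n + 1 by omega)
    have hρ := hC.pos (show m + 1 ≤ n + 1 by omega)
    have h7 := hC.seven_le hm'
    have hPl := hC.P_le hm'
    have herr := hC.err_le (abs_nonneg _) hE hm'
    obtain ⟨E, hEd⟩ : ∃ E, E = 89 ^ m * |a - a'| := ⟨_, rfl⟩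
    rw [← hEd] at herr hqP
    have hE0 : 0 ≤ E := by rw [hEd]; positivity
    have hbound : P (m + 1) + E ≤ P m := by linarith
    have hlow : 0 < P (m + 1) - E := by linarith
    have habs : ∀ x ∈ Icc (P (m + 1) - E) (P (m + 1) + E), |x| = x := fun x hx =>
      abs_of_pos (hlow.trans_le hx.1)
    have hcl : ∀ x ∈ Icc (P (m + 1) - E) (P (m + 1) + E),
        |Phi a m (x ^ 2 + a) - Phi a' m (x ^ 2 + a')| ≤ E := by
      intro x hx
      rw [hEd]
      refine hC.close hE hm' ?_
      rw [habs x hx]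
      linarith [hx.2]
    have hle : P (m + 1) - E ≤ P (m + 1) + E := by linarith
    have m1 : P (m + 1) - E ∈ Icc (P (m + 1) - E) (P (m + 1) + E) := ⟨le_rfl, hle⟩
    have m2 : P (m + 1) + E ∈ Icc (P (m + 1) - E) (P (m + 1) + E) := ⟨hle, le_rfl⟩
    have hcont : Continuous fun x => Phi a m (x ^ 2 + a) + x := by
      have := continuous_Phi a m
      fun_prop
    have g1 := hl.mono_abs (x := P (m + 1) - E) (y := P (m + 1))
      (by rw [habs _ m1, abs_of_pos hρ]; linarith) (by rw [abs_of_pos hρ]; linarith)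
    have g2 := hl.mono_abs (x := P (m + 1)) (y := P (m + 1) + E)
      (by rw [habs _ m2, abs_of_pos hρ]; linarith) (by rw [habs _ m2]; linarith)
    rw [hf.fix] at g1 g2
    have k1 := abs_le.1 (hcl _ m1)
    have k2 := abs_le.1 (hcl _ m2)
    obtain ⟨r, hr, hr0⟩ := intermediate_value_Icc hle hcont.continuousOn
      (show (0 : ℝ) ∈ Icc _ _ from ⟨by linarith, by linarith⟩)
    simp only at hr0
    have hrfix : Phi a m (r ^ 2 + a) = -r := by linarith
    have hr1 : 0 < r := hlow.trans_le hr.1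
    have hqP' := abs_le.1 hqP
    have hrq : r ≤ q := by linarith [hr.2]
    refine ⟨r, ?_, hr1, hrq.trans hqb, ?_, ?_⟩
    · rw [pow_succ]
      have : |r - P (m + 1)| ≤ E := abs_le.2 ⟨by linarith [hr.1], by linarith [hr.2]⟩
      linarith
    · change -Phi a m ((Phi a m (r ^ 2 + a)) ^ 2 + a) = r
      rw [hrfix, neg_sq, hrfix, neg_neg]
    · intro L s hmono hodd heq hs hLb
      have h1 := hLq L s hmono hodd heq hs hLb
      have e1 := hC.pert_semi hE ha hmono hodd heq hm' (x := q)
        (by rw [abs_of_pos hq0]; linarith) (by rwa [abs_of_pos hq0])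
      have e2 := hC.pert_semi hE ha hmono hodd heq hm' (x := r)
        (by rw [abs_of_pos hr1]; linarith [hr.2]) (by rw [abs_of_pos hr1]; linarith)
      have hL0 : L 0 = 0 := by
        have := hodd 0
        rw [neg_zero] at this
        linarith
      have hLr : 0 ≤ L r := by rw [← hL0]; exact hmono hr1.le
      rw [hqfix, abs_of_pos h1] at e1
      rw [hrfix, hodd, abs_of_nonneg hLr] at e2
      have hS : 1 < s ^ 2 ^ m := one_lt_pow₀ hs (by positivity)
      by_contra hcon
      have : L r = 0 := le_antisymm (not_lt.1 hcon) hLr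
      rw [this] at e2
      nlinarith

end Chain

/-- A pseudo-orbit of `0` for the tent-like map `u ↦ T |u| - 1`. -/
structure TentOrbit (T η : ℝ) (z : ℕ → ℝ) : Prop where
  two_le_sq : 2 ≤ T ^ 2
  le_two : T ≤ 2
  pos : 0 < T
  err_nonneg : 0 ≤ η
  err_le : η ≤ 1 / 10000
  zero : z 0 = 0
  step : ∀ k, |z (k + 1) - (T * |z k| - 1)| ≤ η
  bdd : ∀ k, |z k| ≤ 24143 / 10000

namespace TentOrbit
variable {T η : ℝ} {z : ℕ → ℝ}

theorem slope_ge (hz : TentOrbit T η z) : 14142 / 10000 ≤ T := by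
  have := hz.two_le_sq
  have := hz.pos
  by_contra hcon
  nlinarith

theorem step_of_close (hz : TentOrbit T η z) {k : ℕ} {c r : ℝ} (hr : abs (|z k| - c) ≤ r) :
    |z (k + 1) - (T * c - 1)| ≤ 2 * r + η := by
  have h1 := hz.step k
  have h2 := hz.le_two
  have h3 := hz.pos
  have h4 : abs (T * |z k| - 1 - (T * c - 1)) ≤ 2 * r := by
    rw [show T * |z k| - 1 - (T * c - 1) = T * (|z k| - c) by ring, abs_mul, abs_of_pos h3]
    have := abs_nonneg (|z k| - c)
    nlinarith
  have h5 := abs_sub_le (z (k + 1)) (T * |z k| - 1) (T * c - 1)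
  linarith

theorem close_one (hz : TentOrbit T η z) : |z 1 + 1| ≤ η := by
  have := hz.step 0
  rwa [hz.zero, abs_zero, mul_zero, zero_sub, sub_neg_eq_add] at this

theorem neg_one (hz : TentOrbit T η z) : z 1 < 0 := by
  have := abs_le.1 hz.close_one
  linarith [hz.err_le]

theorem close_two (hz : TentOrbit T η z) : |z 2 - (T - 1)| ≤ 3 * η := by
  have h1 := hz.step_of_close (k := 1) (c := 1) (r := η) (by
    rw [abs_of_neg hz.neg_one, ← abs_neg]
    convert hz.close_one using 2
    ring)
  rw [mul_one] at h1
  linarith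

theorem pos_two (hz : TentOrbit T η z) : 0 < z 2 := by
  have := abs_le.1 hz.close_two
  linarith [hz.err_le, hz.slope_ge]

theorem close_three (hz : TentOrbit T η z) : |z 3 - (T ^ 2 - T - 1)| ≤ 7 * η := by
  have h1 := hz.step_of_close (k := 2) (c := T - 1) (r := 3 * η) (by
    rw [abs_of_pos hz.pos_two]
    exact hz.close_two)
  rw [show T * (T - 1) - 1 = T ^ 2 - T - 1 by ring] at h1
  linarith

theorem pos_three (hz : TentOrbit T η z) (hT : 17 / 10 ≤ T) : 0 < z 3 := by
  have := abs_le.1 hz.close_three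
  have := hz.err_le
  nlinarith

theorem neg_four (hz : TentOrbit T η z) (hT : T ≤ 17 / 10) : z 4 ≤ -(27 / 100) := by
  have h1 := abs_le.1 hz.close_three
  have h2 := hz.err_le
  have h3 := hz.slope_ge
  have h4 : |z 3| ≤ 42 / 100 := by
    rw [abs_le]
    constructor <;> nlinarith
  have h5 := (abs_le.1 (hz.step 3)).2
  simp only [Nat.reduceAdd] at h5
  nlinarith

theorem six_lt_neg_four (hz : TentOrbit T η z) (hT : T ≤ 17 / 10) : z 6 < -z 4 := by
  have h1 := hz.neg_four hT
  have h2 := hz.err_le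
  have h3 := hz.slope_ge
  have h4 := abs_le.1 (hz.step 3)
  have h5 := abs_le.1 (hz.step 4)
  have h6 := abs_le.1 (hz.step 5)
  simp only [Nat.reduceAdd] at h4 h5 h6
  rw [abs_of_neg (show z 4 < 0 by linarith)] at h5
  have h7 : 0 ≤ T * |z 3| := mul_nonneg hz.pos.le (abs_nonneg _)
  obtain ⟨u, hu⟩ : ∃ u, u = -z 4 := ⟨_, rfl⟩
  rw [← hu] at h5 ⊢
  have hu1 : 27 / 100 ≤ u := by linarith
  have hu2 : u ≤ 1 + 1 / 10000 := by linarith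
  have h8 : T * |z 5| - 1 + 1 / 10000 < u := by
    rcases abs_cases (z 5) with ⟨h, _⟩ | ⟨h, _⟩ <;> rw [h]
    · have : T * z 5 ≤ T * (T * u - 1 + η) := mul_le_mul_of_nonneg_left (by linarith) hz.pos.le
      nlinarith [mul_nonneg (show 0 ≤ T + 1 by linarith) (show (0:ℝ) ≤ u by linarith)]
    · have : T * -z 5 ≤ T * (1 - T * u + η) := mul_le_mul_of_nonneg_left (by linarith) hz.pos.le
      nlinarith [mul_nonneg (show 0 ≤ T ^ 2 - 2 by linarith [hz.two_le_sq])
        (show (0:ℝ) ≤ u by linarith)]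
  linarith

end TentOrbit

/-- An expanding recursion with a bounded solution. -/
theorem mul_le_of_expanding {d : ℕ → ℝ} {T t B : ℝ} (hT : 1 < T)
    (hstep : ∀ k, T * d k - t ≤ d (k + 1)) (hB : ∀ k, d k ≤ B) (k : ℕ) : d k * (T - 1) ≤ t := by
  by_contra! hcon
  have hT' : 0 < T - 1 := by linarith
  have h1 : ∀ j, T ^ j * (d k * (T - 1) - t) ≤ d (k + j) * (T - 1) - t := by
    intro j
    induction j with
    | zero => simp
    | succ j ih =>
      have h2 := hstep (k + j)
      have h3 := mul_le_mul_of_nonneg_left ih (show 0 ≤ T by linarith)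
      have h4 := mul_le_mul_of_nonneg_right h2 hT'.le
      rw [pow_succ', ← add_assoc]
      nlinarith
  have h5 : 0 < d k * (T - 1) - t := by linarith
  obtain ⟨j, hj⟩ := pow_unbounded_of_one_lt ((B * (T - 1) - t) / (d k * (T - 1) - t)) hT
  rw [div_lt_iff₀ h5] at hj
  have h6 := h1 j
  have h7 := mul_le_mul_of_nonneg_right (hB (k + j)) hT'.le
  linarith

namespace TentOrbit
variable {T S η : ℝ} {z y : ℕ → ℝ}

theorem abs_exact_le (hS1 : 1 < S) (hS2 : S ≤ 2) (hy0 : y 0 = 0)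
    (hy : ∀ k, y (k + 1) = S * |y k| - 1) (k : ℕ) : |y k| ≤ 1 := by
  induction k with
  | zero => simp [hy0]
  | succ k ih =>
    rw [hy, abs_le]
    have := abs_nonneg (y k)
    constructor <;> nlinarith

theorem abs_abs_sub (hsign : ∀ k, 0 ≤ z k * y k) (k : ℕ) :
    abs (|z k| - |y k|) = |z k - y k| := by
  have := hsign k
  rcases mul_nonneg_iff.1 this with ⟨h1, h2⟩ | ⟨h1, h2⟩
  · rw [abs_of_nonneg h1, abs_of_nonneg h2]
  · rw [abs_of_nonpos h1, abs_of_nonpos h2, ← abs_neg]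
    congr 1
    ring

theorem diff_le (hz : TentOrbit T η z) (hS1 : 1 < S) (hST : S ≤ T) (hy0 : y 0 = 0)
    (hy : ∀ k, y (k + 1) = S * |y k| - 1) (hsign : ∀ k, 0 ≤ z k * y k) (k : ℕ) :
    |z k - y k| * (T - 1) ≤ T - S + η := by
  have hy1 := abs_exact_le hS1 (hST.trans hz.le_two) hy0 hy
  refine mul_le_of_expanding (d := fun k => |z k - y k|) (hS1.trans_le hST) (B := 24143 / 10000 + 1)
    (fun k => ?_) (fun k => ?_) k
  · have h1 := hz.step k
    rw [hy, ← abs_abs_sub hsign k]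
    have h2 : T * abs (|z k| - |y k|) ≤
        |z (k + 1) - (S * |y k| - 1)| + |z (k + 1) - (T * |z k| - 1)| + (T - S) * |y k| := by
      have h3 : T * abs (|z k| - |y k|) = abs (T * (|z k| - |y k|)) := by
        rw [abs_mul, abs_of_pos hz.pos]
      rw [h3, show T * (|z k| - |y k|) = (z (k + 1) - (S * |y k| - 1)) +
        -(z (k + 1) - (T * |z k| - 1)) + -((T - S) * |y k|) by ring]
      refine (abs_add_le _ _).trans (add_le_add ((abs_add_le _ _).trans ?_) ?_)
      · rw [abs_neg (z (k + 1) - (T * |z k| - 1))]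
      · rw [abs_neg, abs_of_nonneg]
        exact mul_nonneg (by linarith) (abs_nonneg _)
    nlinarith [hy1 k]
  · exact (abs_sub _ _).trans (add_le_add (hz.bdd k) (hy1 k))

end TentOrbit

namespace TentOrbit
variable {T S η : ℝ} {z y : ℕ → ℝ}

theorem abs_diff_le (hz : TentOrbit T η z) (hS1 : 1 < S) (hST : S ≤ T) (hy0 : y 0 = 0)
    (hy : ∀ k, y (k + 1) = S * |y k| - 1) (hsign : ∀ k, 0 ≤ z k * y k) (k : ℕ) :
    |z k - y k| ≤ 24143 / 10000 * (T - S + η) := by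
  have h1 := hz.diff_le hS1 hST hy0 hy hsign k
  have h2 := hz.slope_ge
  nlinarith [abs_nonneg (z k - y k)]

theorem exact_values (hS1 : 1 < S) (hy0 : y 0 = 0) (hy : ∀ k, y (k + 1) = S * |y k| - 1) :
    y 1 = -1 ∧ y 2 = S - 1 ∧ y 3 = S ^ 2 - S - 1 := by
  have h1 : y 1 = -1 := by rw [hy, hy0]; simp
  have h2 : y 2 = S - 1 := by rw [hy, h1]; simp
  refine ⟨h1, h2, ?_⟩
  rw [hy, h2, abs_of_pos (by linarith)]
  ring

theorem slope_sub_le_of_two_le_sq (hz : TentOrbit T η z) (hS1 : 1 < S) (hST : S ≤ T) (hy0 : y 0 = 0)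
    (hy : ∀ k, y (k + 1) = S * |y k| - 1) (hsign : ∀ k, 0 ≤ z k * y k) (hS : 2 ≤ S ^ 2) :
    T - S ≤ 100 * η := by
  obtain ⟨y1, y2, y3⟩ := exact_values hS1 hy0 hy
  have hD := hz.abs_diff_le hS1 hST hy0 hy hsign
  have hD' := hz.diff_le hS1 hST hy0 hy hsign
  have z3 := abs_le.1 hz.close_three
  have hη := hz.err_nonneg
  have hT2 := hz.le_two
  have hS' : 14142 / 10000 ≤ S := by
    by_contra hcon
    nlinarith
  rcases le_or_gt (1618 / 1000) S with h | h
  · have h1 := hD' 3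
    have h2 : (z 3 - y 3) * (T - 1) ≤ T - S + η :=
      (mul_le_mul_of_nonneg_right (le_abs_self _) (by linarith)).trans h1
    rw [y3] at h2
    have h3 : (T - S) * (2236 / 1000) - 7 * η ≤ z 3 - (S ^ 2 - S - 1) := by nlinarith
    have h4 := mul_le_mul_of_nonneg_right h3 (show 0 ≤ T - 1 by linarith)
    nlinarith [mul_nonneg (sub_nonneg.2 hST) (show 0 ≤ T - 1618 / 1000 by linarith)]
  · have hy3 : y 3 < 0 := by rw [y3]; nlinarith
    have hz3 : z 3 ≤ 0 := by
      by_contra! hcon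
      have := hsign 3
      nlinarith
    have s4 := abs_le.1 (hz.step 3)
    have s5 := abs_le.1 (hz.step 4)
    simp only [Nat.reduceAdd] at s4 s5
    have y4 : y 4 = -((S - 1) * (S ^ 2 - 1)) := by
      rw [hy, abs_of_neg hy3, y3]
      ring
    have hy4 : y 4 < 0 := by
      rw [y4]
      have : 0 < (S - 1) * (S ^ 2 - 1) := mul_pos (by linarith) (by linarith)
      linarith
    have hz4 : z 4 ≤ 0 := by
      by_contra! hcon
      have := hsign 4
      nlinarith
    have y5 : y 5 = S * -y 4 - 1 := by rw [hy, abs_of_neg hy4]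
    rw [abs_of_nonpos hz3] at s4
    rw [abs_of_nonpos hz4] at s5
    have d4 : 217 / 100 * (T - S) - 15 * η ≤ y 4 - z 4 := by
      have h1 : T * -z 3 ≤ T * (-(T ^ 2 - T - 1) + 7 * η) :=
        mul_le_mul_of_nonneg_left (by linarith) hz.pos.le
      have h2 : T * (7 * η) ≤ 14 * η := by nlinarith
      have h3 : (T - S) * (217 / 100) ≤ (T - S) * (T ^ 2 + T * S + S ^ 2 - T - S - 1) := by
        refine mul_le_mul_of_nonneg_left ?_ (by linarith)
        nlinarith
      rw [y4]
      nlinarith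
    have d5 : 306 / 100 * (T - S) - 31 * η ≤ z 5 - y 5 := by
      have h1 : T * (217 / 100 * (T - S) - 15 * η) ≤ T * (y 4 - z 4) :=
        mul_le_mul_of_nonneg_left d4 hz.pos.le
      have h2 : 0 ≤ (T - S) * -y 4 := mul_nonneg (by linarith) (by linarith)
      have h3 : T * (15 * η) ≤ 30 * η := by nlinarith
      have h4 : 14142 / 10000 * (217 / 100 * (T - S)) ≤ T * (217 / 100 * (T - S)) :=
        mul_le_mul_of_nonneg_right (by linarith) (by linarith)
      rw [y5]
      nlinarith
    have h5 := (le_abs_self _).trans (hD 5)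
    nlinarith

set_option maxHeartbeats 2000000 in
theorem slope_sub_le_of_sq_lt_two (hz : TentOrbit T η z) (hS1 : 1 < S) (hST : S ≤ T) (hy0 : y 0 = 0)
    (hy : ∀ k, y (k + 1) = S * |y k| - 1) (hsign : ∀ k, 0 ≤ z k * y k) (hS : S ^ 2 < 2) :
    T - S ≤ 200 * η := by
  obtain ⟨y1, y2, y3⟩ := exact_values hS1 hy0 hy
  have hD := hz.abs_diff_le hS1 hST hy0 hy hsign
  have hη := hz.err_nonneg
  have hη' := hz.err_le
  have hT2 := hz.le_two
  have hT := hz.slope_ge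
  have hTT := hz.two_le_sq
  have hSu : S < 14143 / 10000 := by
    by_contra hcon
    nlinarith
  have hodd : ∀ k, -1 ≤ y (2 * k + 1) ∧ y (2 * k + 1) ≤ S ^ 2 - S - 1 := by
    intro k
    induction k with
    | zero =>
      simp only [mul_zero, zero_add, y1]
      constructor <;> nlinarith
    | succ k ih =>
      have h0 : y (2 * k + 1) < 0 := by nlinarith [ih.2]
      have e1 : y (2 * k + 2) = S * -y (2 * k + 1) - 1 := by rw [hy, abs_of_neg h0]
      have e2 : y (2 * (k + 1) + 1) = S * |y (2 * k + 2)| - 1 := by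
        rw [show 2 * (k + 1) + 1 = 2 * k + 2 + 1 by ring, hy]
      have e3 : |y (2 * k + 2)| ≤ S - 1 := by
        rw [e1, abs_le]
        constructor
        · have h1 : S * -(S ^ 2 - S - 1) ≤ S * -y (2 * k + 1) :=
            mul_le_mul_of_nonneg_left (by linarith [ih.2]) (by linarith)
          have h2 : 0 ≤ (S - 1) * (2 - S ^ 2) := mul_nonneg (by linarith) (by linarith)
          nlinarith
        · nlinarith [ih.1]
      rw [e2]
      constructor
      · nlinarith [abs_nonneg (y (2 * k + 2))]
      · nlinarith
  have hyodd : ∀ k, y (2 * k + 1) < 0 := fun k => by nlinarith [(hodd k).2]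
  have hzodd : ∀ k, z (2 * k + 1) ≤ 0 := by
    intro k
    by_contra! hcon
    have := hsign (2 * k + 1)
    nlinarith [hyodd k]
  have zeven : ∀ k, |z (2 * k + 2) - (T - 1 - T ^ 2 * |z (2 * k)|)| ≤ 3 * η := by
    intro k
    have h1 := hz.step_of_close (k := 2 * k + 1) (c := 1 - T * |z (2 * k)|) (r := η) (by
      rw [abs_of_nonpos (hzodd k), ← abs_neg]
      convert hz.step (2 * k) using 2
      ring)
    rw [show T * (1 - T * |z (2 * k)|) - 1 = T - 1 - T ^ 2 * |z (2 * k)| by ring] at h1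
    linarith
  have yeven : ∀ k, y (2 * k + 2) = S - 1 - S ^ 2 * |y (2 * k)| := by
    intro k
    rw [hy, abs_of_neg (hyodd k), hy]
    ring
  have z2 := abs_le.1 hz.close_two
  have z4 := abs_le.1 (zeven 1)
  have z6 := abs_le.1 (zeven 2)
  simp only [Nat.reduceAdd, Nat.reduceMul] at z4 z6
  have y4 : y 4 = -((S - 1) * (S ^ 2 - 1)) := by
    have := yeven 1
    simp only [Nat.reduceAdd, Nat.reduceMul] at this
    rw [this, y2, abs_of_pos (by linarith)]
    ring
  have hy4 : y 4 < 0 := by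
    rw [y4]
    have : 0 < (S - 1) * (S ^ 2 - 1) := mul_pos (by linarith) (by nlinarith)
    linarith
  have hz4 : z 4 ≤ 0 := by
    by_contra! hcon
    have := hsign 4
    nlinarith
  have y6 : y 6 = S - 1 - S ^ 2 * -y 4 := by
    have := yeven 2
    simp only [Nat.reduceAdd, Nat.reduceMul] at this
    rw [this, abs_of_neg hy4]
  rw [abs_of_pos hz.pos_two] at z4
  rw [abs_of_nonpos hz4] at z6
  have hbound : -z 4 * (T ^ 2 - 1) ≤ T - 1 + 3 * η := by
    have := mul_le_of_expanding (d := fun k => |z (2 * k)|) (T := T ^ 2) (t := T - 1 + 3 * η)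
      (by linarith) (fun k => ?_) (fun k => hz.bdd (2 * k)) 2
    · simp only [Nat.reduceMul] at this
      rwa [abs_of_nonpos hz4] at this
    · have h1 := (abs_le.1 (zeven k)).2
      have h2 := neg_abs_le (z (2 * k + 2))
      rw [show 2 * (k + 1) = 2 * k + 2 by ring]
      linarith
  have hz4l : (T - 1) * (T ^ 2 - 1) - 15 * η ≤ -z 4 := by
    have : T ^ 2 * (T - 1 - 3 * η) ≤ T ^ 2 * z 2 := mul_le_mul_of_nonneg_left (by linarith)
      (by positivity)
    nlinarith
  have hT4 : T ^ 2 ≤ 4 := by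
    have := pow_le_pow_left₀ hz.pos.le hT2 2
    linarith
  have hTu : T ≤ 1417 / 1000 := by
    by_contra! hcon
    have h1 := mul_le_mul_of_nonneg_right hz4l (show 0 ≤ T ^ 2 - 1 by linarith)
    have h2 : 1007 / 1000 ≤ T ^ 2 - 1 := by
      have := pow_le_pow_left₀ (by norm_num) hcon.le 2
      linarith
    have h3 : 15 * η * (T ^ 2 - 1) ≤ 15 * η * 3 :=
      mul_le_mul_of_nonneg_left (by linarith) (by linarith)
    have h4 : 1014 / 1000 ≤ (T ^ 2 - 1) ^ 2 := by
      have := pow_le_pow_left₀ (by norm_num) h2 2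
      linarith
    have h5 : (T - 1) * (1014 / 1000) ≤ (T - 1) * (T ^ 2 - 1) ^ 2 :=
      mul_le_mul_of_nonneg_left h4 (by linarith)
    linarith
  have hz6 : z 6 < 0 := by
    have h1 : T ^ 2 * ((T - 1) * (T ^ 2 - 1) - 15 * η) ≤ T ^ 2 * -z 4 :=
      mul_le_mul_of_nonneg_left hz4l (by positivity)
    have h2 : (4142 / 10000 : ℝ) ≤ (T - 1) * (T ^ 2 - 1) := by nlinarith
    nlinarith
  have hy6 : y 6 ≤ 0 := by
    by_contra! hcon
    have := hsign 6
    nlinarith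
  have hSl : 127 / 100 ≤ S := by
    by_contra! hcon
    rw [y6, y4] at hy6
    have h1 : (S - 1) * (1 + S ^ 2 - S ^ 4) ≤ 0 := by linarith
    have h2 : S ^ 2 < 1613 / 1000 := by nlinarith
    have h3 : 0 < 1 + S ^ 2 - S ^ 4 := by nlinarith
    have := mul_pos (show 0 < S - 1 by linarith) h3
    linarith
  have hδ : 0 ≤ T - S := by linarith
  have hT3 : T ^ 2 ≤ 3 := by
    have := pow_le_pow_left₀ hz.pos.le hTu 2
    linarith
  have hS3 : 16129 / 10000 ≤ S ^ 2 := by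
    have := pow_le_pow_left₀ (by norm_num) hSl 2
    linarith
  have d4 : 172 / 100 * (T - S) - 16 * η ≤ y 4 - z 4 := by
    have h1 : T ^ 2 * (T - 1 - 3 * η) ≤ T ^ 2 * z 2 := mul_le_mul_of_nonneg_left (by linarith)
      (by positivity)
    have h2 : T ^ 2 * (3 * η) ≤ 3 * (3 * η) :=
      mul_le_mul_of_nonneg_right hT3 (by linarith)
    have h3 : (T - S) * (172 / 100) ≤ (T - S) * (T ^ 2 - 1 + (S + T) * (S - 1)) := by
      refine mul_le_mul_of_nonneg_left ?_ hδ
      have : (268 / 100 : ℝ) * (27 / 100) ≤ (S + T) * (S - 1) :=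
        mul_le_mul (by linarith) (by linarith) (by norm_num) (by linarith)
      linarith
    rw [y4]
    linarith
  have d6 : 288 / 100 * (T - S) - 51 * η ≤ y 6 - z 6 := by
    have h1 : T ^ 2 * (172 / 100 * (T - S) - 16 * η) ≤ T ^ 2 * (y 4 - z 4) :=
      mul_le_mul_of_nonneg_left d4 (by positivity)
    have h2 : T ^ 2 * (16 * η) ≤ 3 * (16 * η) :=
      mul_le_mul_of_nonneg_right hT3 (by linarith)
    have h3 : 2 * (172 / 100 * (T - S)) ≤ T ^ 2 * (172 / 100 * (T - S)) :=
      mul_le_mul_of_nonneg_right hTT (by positivity)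
    have h4 : (165 / 1000 : ℝ) ≤ -y 4 := by
      rw [y4]
      have : (27 / 100 : ℝ) * (6129 / 10000) ≤ (S - 1) * (S ^ 2 - 1) :=
        mul_le_mul (by linarith) (by linarith) (by norm_num) (by linarith)
      linarith
    have h5 : (44 / 100 : ℝ) ≤ (S + T) * -y 4 := by
      have : (268 / 100 : ℝ) * (165 / 1000) ≤ (S + T) * -y 4 :=
        mul_le_mul (by linarith) h4 (by norm_num) (by linarith)
      linarith
    have h6 : (T - S) * (44 / 100) ≤ (T - S) * ((S + T) * -y 4) :=
      mul_le_mul_of_nonneg_left h5 hδ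
    rw [y6]
    linarith
  have h5 := (neg_abs_le _).trans (le_refl (z 6 - y 6))
  have h6 := hD 6
  linarith

theorem slope_sub_le (hz : TentOrbit T η z) (hS1 : 1 < S) (hST : S ≤ T) (hy0 : y 0 = 0)
    (hy : ∀ k, y (k + 1) = S * |y k| - 1) (hsign : ∀ k, 0 ≤ z k * y k) :
    T - S ≤ 200 * η := by
  rcases le_or_gt 2 (S ^ 2) with h | h
  · linarith [hz.slope_sub_le_of_two_le_sq hS1 hST hy0 hy hsign h, hz.err_nonneg]
  · exact hz.slope_sub_le_of_sq_lt_two hS1 hST hy0 hy hsign h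

end TentOrbit

/-- Truncation to `[-P, P]`. -/
noncomputable def trunc (P x : ℝ) : ℝ := max (-P) (min x P)

theorem trunc_mono (P : ℝ) : Monotone (trunc P) :=
  fun _ _ h => max_le_max le_rfl (min_le_min h le_rfl)

theorem abs_trunc_le {P : ℝ} (hP : 0 ≤ P) (x : ℝ) : |trunc P x| ≤ P :=
  abs_le.2 ⟨le_max_left _ _, max_le (by linarith) (min_le_right _ _)⟩

theorem trunc_of_abs_le {P x : ℝ} (hx : |x| ≤ P) : trunc P x = x := by
  rw [abs_le] at hx
  rw [trunc, min_eq_left hx.2, max_eq_right hx.1]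

theorem trunc_of_le {P x : ℝ} (hP : 0 ≤ P) (hx : P ≤ x) : trunc P x = P := by
  rw [trunc, min_eq_right hx, max_eq_right (by linarith)]

theorem trunc_neg {P : ℝ} (hP : 0 ≤ P) (x : ℝ) : trunc P (-x) = -trunc P x := by
  rcases le_total |x| P with hx | hx
  · rw [trunc_of_abs_le hx, trunc_of_abs_le (by rwa [abs_neg])]
  · rcases abs_cases x with ⟨h, _⟩ | ⟨h, _⟩ <;> rw [h] at hx
    · rw [trunc_of_le hP hx, trunc, min_eq_left (by linarith), max_eq_left (by linarith)]
    · rw [trunc_of_le hP hx, trunc, min_eq_left (by linarith), max_eq_left (by linarith), neg_neg]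

theorem abs_trunc_sub_le (P x y : ℝ) : |trunc P x - trunc P y| ≤ |x - y| := by
  rw [trunc, trunc]
  refine (abs_max_sub_max_le_max _ _ _ _).trans ?_
  refine max_le (by simp) ((abs_min_sub_min_le_max _ _ _ _).trans ?_)
  simp

namespace Chain
variable {a a' : ℝ} {lam : ℝ → ℝ} {n : ℕ} {P : ℕ → ℝ}

theorem slope_le_two (hC : Chain a' lam n P) : gr a' ^ 2 ^ n ≤ 2 := (hC.fix n le_rfl).S_le

theorem two_le_slope_sq (hC : Chain a' lam n P) : 2 ≤ (gr a' ^ 2 ^ n) ^ 2 := hC.two_le_sq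

theorem slope_lt (hlt : gr a < gr a') : gr a ^ 2 ^ n < gr a' ^ 2 ^ n :=
  pow_lt_pow_left₀ hlt (zero_le_one.trans (one_le_gr a)) (by positivity)

theorem abs_return_le (hC : Chain a' lam n P) (hE : 89 ^ n * |a - a'| ≤ P n / 10 ^ 5)
    (ha : a ∈ Icc (-2 : ℝ) (1 / 4)) (hlt : gr a < gr a') {q : ℝ}
    (hqP : |q - P n| ≤ 89 ^ n * |a - a'|) (hq : 0 < q) (hqb : q ≤ bt a)
    (hfix : Phi a n (q ^ 2 + a) = q) {x : ℝ} (hx : |x| ≤ q) : |Phi a n (x ^ 2 + a)| ≤ q := by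
  have hP := hC.pos (show n ≤ n + 1 by omega)
  have hqP' := (abs_le.1 hqP).2
  have hq1 : |q| ≤ 101 / 100 * P n := by rw [abs_of_pos hq]; linarith
  have hx' : |x| ≤ |q| := by rwa [abs_of_pos hq]
  have h1 := hC.pert_mono hE le_rfl hx' hq1
  have h2 := hC.pert_mono hE le_rfl (x := 0) (y := x) (by simp) (hx'.trans hq1)
  rw [hfix] at h1
  refine abs_le.2 ⟨le_trans ?_ h2, h1⟩
  by_contra! hcon
  have hτ : |((-1 : ℝ)) ^ n| = 1 := by simp
  have hττ : ((-1 : ℝ)) ^ n * (-1) ^ n = 1 := by rw [← mul_pow]; simp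
  rw [Phi_sq_add] at hfix hcon
  have h3 := two_le_gr_pow ha (M := 2 ^ n) (by positivity) hq hqb hτ (by
    rw [← hfix, ← mul_assoc, hττ, one_mul, hfix]) hcon.le
  have h4 := hC.slope_le_two
  have h5 := slope_lt (n := n) hlt
  linarith

/-- The renormalized semiconjugacy of the unperturbed map is an approximate semiconjugacy of the
perturbed return map. -/
theorem abs_nrm_return_sub_le (hC : Chain a' lam n P) (hE : 89 ^ n * |a - a'| ≤ P n / 10 ^ 5)
    {x : ℝ} (hx : |x| ≤ 101 / 100 * P n) :
    |nrm lam (P n) (gr a' ^ 2 ^ n) (trunc (P n) (Phi a n (x ^ 2 + a))) -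
      (gr a' ^ 2 ^ n * |nrm lam (P n) (gr a' ^ 2 ^ n) (trunc (P n) x)| - 1)| ≤
      14 * (89 ^ n * |a - a'| / P n) ^ (1 / 14 : ℝ) := by
  obtain ⟨l, hl⟩ := hC.lvl n le_rfl
  have hs := hC.semi n le_rfl
  have hf := hC.fix n le_rfl
  have hP := hC.pos (show n ≤ n + 1 by omega)
  have ht := abs_trunc_le hP.le x
  have hw := hl.abs_le ht
  rw [← hs.nrm_eq hf ht]
  refine (hs.holder hl hf hC.last hC.two_le_slope_sq (abs_trunc_le hP.le _) hw).trans ?_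
  gcongr
  rcases le_total |x| (P n) with h | h
  · rw [trunc_of_abs_le h] at hw ⊢
    rw [← trunc_of_abs_le hw]
    refine (abs_trunc_sub_le _ _ _).trans ?_
    exact hC.close hE le_rfl hx
  · have h1 : (trunc (P n) x) ^ 2 = P n ^ 2 := by
      rcases abs_cases x with ⟨h', _⟩ | ⟨h', _⟩ <;> rw [h'] at h
      · rw [trunc_of_le hP.le h]
      · rw [← neg_neg x, trunc_neg hP.le, trunc_of_le hP.le h, neg_sq]
    have h2 : |P n| = P n := abs_of_pos hP
    have h3 := hC.pert_mono hE le_rfl (x := P n) (y := x) (by rwa [h2]) hx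
    have h4 := hC.close hE le_rfl (x := P n) (by rw [h2]; linarith)
    have h5 : Phi a' n (P n ^ 2 + a') = P n := by rw [add_comm]; exact hl.top
    have h6 := trunc_mono (P n) h3
    have h7 := abs_trunc_sub_le (P n) (Phi a n (P n ^ 2 + a)) (P n)
    have h8 := (abs_le.1 (abs_trunc_le hP.le (Phi a n (x ^ 2 + a)))).2
    rw [h1, h5]
    rw [h5] at h4
    rw [trunc_of_le hP.le le_rfl] at h7
    rw [abs_le]
    have h9 := (abs_le.1 (h7.trans h4)).1
    have h10 := (abs_nonneg _).trans h4
    constructor <;> linarith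

theorem exists_exact (hC : Chain a' lam n P) (hE : 89 ^ n * |a - a'| ≤ P n / 10 ^ 5)
    (ha : a ∈ Icc (-2 : ℝ) (1 / 4)) (hs : 1 < gr a) {q : ℝ}
    (hqP : |q - P n| ≤ 89 ^ n * |a - a'|) (hq : 0 < q) (hqb : q ≤ bt a)
    (hfix : Phi a n (q ^ 2 + a) = q)
    (hLq : ∀ L : ℝ → ℝ, ∀ s : ℝ, Monotone L → (∀ x, L (-x) = -L x) →
        (∀ x ∈ Ia a, L (fa a x) = L a + s * |L x|) → 1 < s → 0 < L (bt a) → 0 < L q) :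
    ∃ y : ℝ → ℝ, Monotone y ∧ y 0 = 0 ∧
      ∀ x, |x| ≤ q → y (Phi a n (x ^ 2 + a)) = gr a ^ 2 ^ n * |y x| - 1 := by
  obtain ⟨L, hmono, hodd, hpos, heq⟩ := exists_semiconj ha hs
  have h1 := hLq L _ hmono hodd heq hs hpos
  have hP := hC.pos (show n ≤ n + 1 by omega)
  have hqP' := (abs_le.1 hqP).2
  have h2 : ∀ x, |x| ≤ q → L (Phi a n (x ^ 2 + a)) = L (Phi a n a) + gr a ^ 2 ^ n * |L x| :=
    fun x hx => hC.pert_semi hE ha hmono hodd heq le_rfl (by linarith) (by linarith)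
  have hL0 : L 0 = 0 := by
    have := hodd 0
    rw [neg_zero] at this
    linarith
  have h3 := h2 q (abs_of_pos hq).le
  rw [hfix, abs_of_pos h1] at h3
  have hS : 1 < gr a ^ 2 ^ n := one_lt_pow₀ hs (by positivity)
  obtain ⟨v, hv⟩ : ∃ v, L (Phi a n a) = -v := ⟨-L (Phi a n a), (neg_neg _).symm⟩
  rw [hv] at h2 h3
  have hv0 : 0 < v := by nlinarith
  refine ⟨fun x => L x / v, fun x y h => div_le_div_of_nonneg_right (hmono h) hv0.le,
    by simp [hL0], fun x hx => ?_⟩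
  simp only
  rw [h2 x hx, abs_div, abs_of_pos hv0]
  field_simp
  ring

end Chain

theorem Phi_sq_add_two (a : ℝ) (n : ℕ) (x : ℝ) :
    Phi a n ((Phi a n (x ^ 2 + a)) ^ 2 + a) = (-1) ^ n * (fa a)^[2 ^ n + 2 ^ n] x := by
  rw [Phi_sq_add a n x, Phi_sq_add, Function.iterate_add_apply,
    ← iterate_fa_abs a _ (show 2 ^ n ≠ 0 by positivity), abs_mul, abs_pow, abs_neg, abs_one,
    one_pow, one_mul, iterate_fa_abs a _ (by positivity)]

/-- The signs of an approximate tent orbit of slope at least `√2` force positive entropy. -/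
theorem two_le_gr_pow_of_tentOrbit {a : ℝ} (ha : a ∈ Icc (-2 : ℝ) (1 / 4)) {n : ℕ} {T η : ℝ}
    {z : ℝ → ℝ} (hmono : Monotone z) (hodd : ∀ x, z (-x) = -z x)
    (hz : TentOrbit T η fun k => z ((fun x => Phi a n (x ^ 2 + a))^[k] 0)) :
    ∃ M, 2 ≤ gr a ^ M := by
  obtain ⟨G, hG⟩ : ∃ G : ℝ → ℝ, G = fun x => Phi a n (x ^ 2 + a) := ⟨_, rfl⟩
  rw [← hG] at hz
  have hGe : ∀ x, G (-x) = G x := fun x => by simp only [hG, neg_sq]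
  have hz0 : z 0 = 0 := by
    have := hodd 0
    rw [neg_zero] at this
    linarith
  have hpos : ∀ {x}, 0 < z x → 0 < x := fun {x} h => by
    by_contra! hcon
    linarith [hmono hcon]
  have hneg : ∀ {x}, z x < 0 → x < 0 := fun {x} h => by
    by_contra! hcon
    linarith [hmono hcon]
  have e1 : G^[1] 0 = G 0 := rfl
  have e2 : G^[2] 0 = G (G 0) := rfl
  have e3 : G^[3] 0 = G (G (G 0)) := rfl
  have e4 : G^[4] 0 = G (G (G (G 0))) := rfl
  have e6 : G^[6] 0 = G (G (G (G (G (G 0))))) := rfl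
  have z2 := hpos hz.pos_two
  simp only [e2] at z2
  rcases le_total (17 / 10) T with hT | hT
  · have z1 := hneg hz.neg_one
    have z3 := hpos (hz.pos_three hT)
    simp only [e1] at z1
    simp only [e3] at z3
    refine ⟨2 * 2 ^ n, two_le_gr_pow_of_signs ha (M := 2 ^ n) (by positivity) (σ := -(-1) ^ n)
      (by simp) (G := fun x => -G x) (fun x => ?_) ?_ ?_ ?_⟩
    · rw [hG]
      simp only
      rw [Phi_sq_add, neg_mul]
    · linarith
    · simp only [hGe]
      linarith
    · simp only [hGe]
      linarith
  · have z4 := hneg (lt_of_le_of_lt (hz.neg_four hT) (by norm_num))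
    have z6 := hz.six_lt_neg_four hT
    simp only [e4] at z4 z6
    rw [← hodd] at z6
    have z6' := hmono.reflect_lt z6
    simp only [e6] at z6'
    refine ⟨2 * (2 ^ n + 2 ^ n), two_le_gr_pow_of_signs ha (M := 2 ^ n + 2 ^ n) (by positivity)
      (σ := (-1) ^ n) (by simp) (G := fun x => G (G x)) (fun x => ?_) z2 z4 z6'.le⟩
    rw [hG]
    simp only
    rw [Phi_sq_add_two]

namespace Chain
variable {a a' : ℝ} {lam : ℝ → ℝ} {n : ℕ} {P : ℕ → ℝ}

theorem slope_sub_le (hC : Chain a' lam n P) (hE : 89 ^ n * |a - a'| ≤ P n / 10 ^ 5)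
    (ha : a ∈ Icc (-2 : ℝ) (1 / 4)) (hlt : gr a < gr a') {η : ℝ}
    (hη : 14 * (89 ^ n * |a - a'| / P n) ^ (1 / 14 : ℝ) ≤ η) (hη' : η ≤ 1 / 10000) :
    gr a' ^ 2 ^ n - gr a ^ 2 ^ n ≤ 200 * η := by
  have hP := hC.pos (show n ≤ n + 1 by omega)
  have hs := hC.semi n le_rfl
  have hS := hs.one_lt
  obtain ⟨q, hqP, hq, hqb, hfix, hLq⟩ := hC.exists_pert_fix hE ha le_rfl
  have hqP' := (abs_le.1 hqP).2
  have hret : ∀ x, |x| ≤ q → |Phi a n (x ^ 2 + a)| ≤ q := fun x hx =>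
    hC.abs_return_le hE ha hlt hqP hq hqb hfix hx
  have horb : ∀ k, |(fun x => Phi a n (x ^ 2 + a))^[k] 0| ≤ q := by
    intro k
    induction k with
    | zero => simpa using hq.le
    | succ k ih =>
      rw [Function.iterate_succ_apply']
      exact hret _ ih
  let z : ℝ → ℝ := fun x => nrm lam (P n) (gr a' ^ 2 ^ n) (trunc (P n) x)
  have zmono : Monotone z := hs.nrm_mono.comp (trunc_mono _)
  have zodd : ∀ x, z (-x) = -z x := fun x => by
    simp only [z, trunc_neg hP.le, hs.nrm_neg]
  have z0 : z 0 = 0 := by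
    have := zodd 0
    rw [neg_zero] at this
    linarith
  have hz : TentOrbit (gr a' ^ 2 ^ n) η fun k => z ((fun x => Phi a n (x ^ 2 + a))^[k] 0) :=
    { two_le_sq := hC.two_le_slope_sq
      le_two := hC.slope_le_two
      pos := by linarith
      err_nonneg := le_trans (by positivity) hη
      err_le := hη'
      zero := z0
      step := fun k => by
        simp only [Function.iterate_succ_apply']
        exact (hC.abs_nrm_return_sub_le hE (by linarith [horb k])).trans hη
      bdd := fun k => (hs.abs_nrm_le (abs_trunc_le hP.le _)).trans
        (inv_sub_one_le hS hC.two_le_slope_sq) }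
  rcases (one_le_gr a).eq_or_lt with h | h
  · obtain ⟨M, hM⟩ := two_le_gr_pow_of_tentOrbit ha zmono zodd hz
    rw [← h, one_pow] at hM
    norm_num at hM
  · obtain ⟨y, ymono, y0, hy⟩ := hC.exists_exact hE ha h hqP hq hqb hfix hLq
    refine hz.slope_sub_le (y := fun k => y ((fun x => Phi a n (x ^ 2 + a))^[k] 0))
      (one_lt_pow₀ h (by positivity)) (slope_lt hlt).le y0 (fun k => ?_) (fun k => ?_)
    · simp only [Function.iterate_succ_apply']
      exact hy _ (horb k)
    · rcases le_total 0 ((fun x => Phi a n (x ^ 2 + a))^[k] 0) with h' | h'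
      · exact mul_nonneg (z0.symm.le.trans (zmono h')) (y0.symm.le.trans (ymono h'))
      · exact mul_nonneg_of_nonpos_of_nonpos ((zmono h').trans z0.le)
          ((ymono h').trans y0.le)

end Chain

namespace Chain
variable {a a' : ℝ} {lam : ℝ → ℝ} {n : ℕ} {P : ℕ → ℝ}

theorem one_le_mul_P (hC : Chain a' lam n P) {m : ℕ} (hm : m ≤ n) : 1 ≤ 3872 ^ m * P m := by
  induction m with
  | zero =>
    rw [pow_zero, one_mul, hC.zero]
    have h1 := hC.lt_neg_one
    have h2 := bt_sq (show a' ≤ 1 / 4 by linarith)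
    have h3 := bt_pos a'
    nlinarith
  | succ m ih =>
    have h1 := ih (by omega)
    have h2 := hC.P_le (show m ≤ n by omega)
    have h3 : (3872 : ℝ) ^ m * P m ≤ 3872 ^ m * (3872 * P (m + 1)) := by gcongr
    rw [pow_succ]
    linarith

theorem entropy_sub_le (hC : Chain a' lam n P) (ha : a ∈ Icc (-2 : ℝ) (1 / 4))
    (hlt : h a < h a') : h a' - h a ≤ 2800 * |a - a'| ^ (1 / 28 : ℝ) := by
  have hP := hC.pos (show n ≤ n + 1 by omega)
  obtain ⟨ξ, hξ⟩ : ∃ ξ, ξ = 89 ^ n * |a - a'| / P n := ⟨_, rfl⟩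
  have hξ0 : 0 ≤ ξ := by rw [hξ]; positivity
  obtain ⟨r, hr⟩ : ∃ r, r = ξ ^ (1 / 28 : ℝ) := ⟨_, rfl⟩
  have hr0 : 0 ≤ r := by rw [hr]; positivity
  have hr14 : ξ ^ (1 / 14 : ℝ) = r ^ 2 := by
    rw [hr, ← Real.rpow_natCast, ← Real.rpow_mul hξ0]
    norm_num
  have hr28 : ξ = r ^ 28 := by
    rw [hr, ← Real.rpow_natCast, ← Real.rpow_mul hξ0]
    norm_num
  have h2n : (0 : ℝ) < 2 ^ n := by positivity
  have hS : ∀ b, gr b ^ 2 ^ n = Real.exp (2 ^ n * h b) := fun b => by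
    rw [gr, ← Real.exp_nat_mul]
    push_cast
    rfl
  have key : 2 ^ n * (h a' - h a) ≤ 2800 * r := by
    rcases le_or_gt (r ^ 2) (1 / 140000) with hr1 | hr1
    · have hrle : r ≤ 1 := by nlinarith
      have hE : 89 ^ n * |a - a'| ≤ P n / 10 ^ 5 := by
        have h1 : ξ ≤ 1 / 10 ^ 5 := by
          rw [hr28]
          have : r ^ 28 ≤ r ^ 2 := pow_le_pow_of_le_one hr0 hrle (by norm_num)
          linarith
        rw [hξ, div_le_iff₀ hP] at h1
        linarith
      have h2 := hC.slope_sub_le hE ha (Real.exp_lt_exp.2 hlt) (η := 14 * r ^ 2)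
        (by rw [← hξ, hr14]) (by linarith)
      have h3 : gr a' ^ 2 ^ n = gr a ^ 2 ^ n * Real.exp (2 ^ n * (h a' - h a)) := by
        rw [hS, hS, ← Real.exp_add]
        congr 1
        ring
      have h4 := Real.add_one_le_exp (2 ^ n * (h a' - h a))
      have h5 : 1 ≤ gr a ^ 2 ^ n := one_le_pow₀ (one_le_gr a)
      have h6 : 0 ≤ 2 ^ n * (h a' - h a) := mul_nonneg h2n.le (by linarith)
      nlinarith
    · have h1 := hC.slope_le_two
      rw [hS] at h1
      have h2 := Real.add_one_le_exp (2 ^ n * h a')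
      have h3 := mul_nonneg h2n.le (h_nonneg a)
      nlinarith
  have hξle : ξ ≤ (2 ^ n) ^ 28 * |a - a'| := by
    have h1 := hC.one_le_mul_P le_rfl
    rw [hξ, div_le_iff₀ hP]
    have h2 : (89 : ℝ) ^ n * 3872 ^ n ≤ (2 ^ n) ^ 28 := by
      rw [← mul_pow, ← pow_mul, mul_comm n 28, pow_mul]
      gcongr
      norm_num
    calc 89 ^ n * |a - a'| ≤ 89 ^ n * |a - a'| * (3872 ^ n * P n) :=
          le_mul_of_one_le_right (by positivity) h1
      _ = 89 ^ n * 3872 ^ n * (|a - a'| * P n) := by ring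
      _ ≤ (2 ^ n) ^ 28 * (|a - a'| * P n) := by gcongr
      _ = (2 ^ n) ^ 28 * |a - a'| * P n := by ring
  have hrle : r ≤ 2 ^ n * |a - a'| ^ (1 / 28 : ℝ) := by
    rw [hr]
    refine (Real.rpow_le_rpow hξ0 hξle (by norm_num)).trans ?_
    rw [Real.mul_rpow (by positivity) (abs_nonneg _), ← Real.rpow_natCast (2 ^ n) 28,
      ← Real.rpow_mul h2n.le]
    norm_num
  have h7 : 2 ^ n * (h a' - h a) ≤ 2 ^ n * (2800 * |a - a'| ^ (1 / 28 : ℝ)) := by linarith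
  exact le_of_mul_le_mul_left h7 h2n

end Chain

/-- Theorem (Guckenheimer; uniform Hölder continuity): the entropy function of the
quadratic family is Hölder continuous on `[-2, 1/4]`. -/
theorem entropy_holder_continuous :
    ∃ C : ℝ, 0 < C ∧ ∃ β : ℝ, 0 < β ∧
      ∀ a ∈ Set.Icc (-2 : ℝ) (1 / 4), ∀ a' ∈ Set.Icc (-2 : ℝ) (1 / 4),
        |h a - h a'| ≤ C * |a - a'| ^ β := by
  refine ⟨2800, by norm_num, 1 / 28, by norm_num, ?_⟩
  have key : ∀ a ∈ Set.Icc (-2 : ℝ) (1 / 4), ∀ a' ∈ Set.Icc (-2 : ℝ) (1 / 4), h a < h a' →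
      h a' - h a ≤ 2800 * |a - a'| ^ (1 / 28 : ℝ) := by
    intro a ha a' ha' hlt
    obtain ⟨lam, n, P, hC⟩ :=
      exists_chain ha' (Real.one_lt_exp_iff.2 ((h_nonneg a).trans_lt hlt))
    exact hC.entropy_sub_le ha hlt
  intro a ha a' ha'
  rcases lt_trichotomy (h a) (h a') with hlt | heq | hlt
  · rw [abs_sub_comm (h a), abs_of_pos (sub_pos.2 hlt)]
    exact key a ha a' ha' hlt
  · rw [heq, sub_self, abs_zero]
    positivity
  · rw [abs_of_pos (sub_pos.2 hlt), abs_sub_comm a]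
    exact key a' ha' a ha hlt
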